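/- There exist absolute constants C ≥ 1 and c > 0 with the following property: for every simple graph G on n ≥ 2 vertices with degree sequence d_1, …, d_n, and every set S of at least n^C points in general position in the plane, there is a drawing of G in which the vertices are represented by distinct points of S and every edge is drawn as the straight-line segment between its endpoints, having at most c · log n · (pcr(G) + Σ_{k=1}^n d_k²) crossings. -/

import Mathlib

open scoped BigOperators

/-- A drawing of a simple graph in the plane: vertices are distinct points, each edge is a
simple continuous curve joining its endpoints, not passing through any other vertex point;
two distinct edge curves share only finitely many points, and no three edge curves pass
through a common interior point. -/
structure Drawing {V : Type*} (G : SimpleGraph V) where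
  pos : V → ℝ × ℝ
  pos_inj : Function.Injective pos
  curve : G.edgeSet → ℝ → ℝ × ℝ
  curve_cont : ∀ e, ContinuousOn (curve e) (Set.Icc 0 1)
  curve_inj : ∀ e, Set.InjOn (curve e) (Set.Icc 0 1)
  curve_ends : ∀ e : G.edgeSet, ∃ u v : V, (e : Sym2 V) = s(u, v) ∧
    curve e 0 = pos u ∧ curve e 1 = pos v
  curve_avoid : ∀ (e : G.edgeSet), ∀ t ∈ Set.Ioo (0:ℝ) 1, curve e t ∉ Set.range pos
  curve_finite_inter : ∀ e f : G.edgeSet, e ≠ f →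
    (curve e '' Set.Icc 0 1 ∩ curve f '' Set.Icc 0 1).Finite
  no_triple_point : ∀ e f g : G.edgeSet, e ≠ f → f ≠ g → e ≠ g → ∀ p : ℝ × ℝ,
    ¬ (p ∈ curve e '' Set.Ioo 0 1 ∧ p ∈ curve f '' Set.Ioo 0 1 ∧ p ∈ curve g '' Set.Ioo 0 1)

namespace Drawing

variable {V : Type*} {G : SimpleGraph V} (D : Drawing G)

/-- `p` is a crossing point of the edges `e` and `f`: a common interior point of their curves. -/
def IsCross (e f : G.edgeSet) (p : ℝ × ℝ) : Prop :=
  p ∈ D.curve e '' Set.Ioo 0 1 ∧ p ∈ D.curve f '' Set.Ioo 0 1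

/-- The set of crossings of a drawing, recorded as (unordered pair of edges, crossing point). -/
def crossings : Set (Sym2 G.edgeSet × (ℝ × ℝ)) :=
  { x | ∃ e f : G.edgeSet, e ≠ f ∧ x.1 = s(e, f) ∧ D.IsCross e f x.2 }

/-- The number of crossings of a drawing. -/
noncomputable def numCrossings : ℕ := D.crossings.ncard

/-- The set of unordered pairs of distinct edges that cross each other. -/
def crossingPairs : Set (Sym2 G.edgeSet) :=
  { q | ∃ e f : G.edgeSet, e ≠ f ∧ q = s(e, f) ∧ ∃ p, D.IsCross e f p }

/-- The number of pairs of edges that cross each other. -/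
noncomputable def numCrossingPairs : ℕ := D.crossingPairs.ncard

/-- An edge participating in at least one crossing. -/
def CrossingEdge (e : G.edgeSet) : Prop :=
  ∃ f : G.edgeSet, e ≠ f ∧ ∃ p, D.IsCross e f p

/-- A drawing is straight-line if every edge is the line segment between its endpoints. -/
def IsStraightLine : Prop :=
  ∀ (e : G.edgeSet), ∀ t ∈ Set.Icc (0:ℝ) 1,
    D.curve e t = D.curve e 0 + t • (D.curve e 1 - D.curve e 0)

/-- A convex drawing: the vertices are in convex position and edges are straight segments. -/
def IsConvex : Prop :=
  ConvexIndependent ℝ D.pos ∧ D.IsStraightLine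

end Drawing

/-- The crossing number of a graph. -/
noncomputable def crNum {V : Type*} (G : SimpleGraph V) : ℕ :=
  sInf { n | ∃ D : Drawing G, D.numCrossings = n }

/-- The pair crossing number of a graph. -/
noncomputable def pcrNum {V : Type*} (G : SimpleGraph V) : ℕ :=
  sInf { n | ∃ D : Drawing G, D.numCrossingPairs = n }

/-- The sum of the squares of the degrees of a graph. -/
noncomputable def ssqd {V : Type*} (G : SimpleGraph V) : ℕ :=
  ∑ᶠ v : V, ((G.neighborSet v).ncard) ^ 2

/-- The sum over all vertices of (degree choose 2). -/
noncomputable def bds {V : Type*} (G : SimpleGraph V) : ℕ :=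
  ∑ᶠ v : V, ((G.neighborSet v).ncard).choose 2


/-- A finite set of points in the plane is in general position if no three of its points
are collinear. -/
def InGeneralPosition (S : Set (ℝ × ℝ)) : Prop :=
  ∀ p ∈ S, ∀ q ∈ S, ∀ r ∈ S, p ≠ q → p ≠ r → q ≠ r →
    ¬ Collinear ℝ ({p, q, r} : Set (ℝ × ℝ))

open scoped BigOperators

namespace PCR

noncomputable def AA (x x' y : ℂ) : ℝ := Complex.arg ((x' - y) / (x - y))

theorem ratio_re_pos {z d : ℂ} (h : ‖d‖ < ‖z‖) : 0 < ((z + d) / z).re := by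
  have hz : z ≠ 0 := by
    rintro rfl
    have := norm_nonneg d
    simp at h; linarith
  have e : (z + d) / z = 1 + d / z := by field_simp
  rw [e, Complex.add_re, Complex.one_re]
  have h1 : ‖d / z‖ < 1 := by
    rw [norm_div]; exact (div_lt_one (by positivity)).2 h
  have h2 := (abs_le.1 ((Complex.abs_re_le_norm (d/z)))).1
  linarith

theorem arg_mul_of_re_pos {u v : ℂ} (hu : 0 < u.re) (hv : 0 < v.re) :
    Complex.arg (u * v) = Complex.arg u + Complex.arg v := by
  have hu0 : u ≠ 0 := by rintro rfl; simp at hu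
  have hv0 : v ≠ 0 := by rintro rfl; simp at hv
  have h1 := abs_lt.1 (Complex.abs_arg_lt_pi_div_two_iff.2 (Or.inl hu))
  have h2 := abs_lt.1 (Complex.abs_arg_lt_pi_div_two_iff.2 (Or.inl hv))
  apply Complex.arg_mul hu0 hv0
  constructor <;> linarith [h1.1, h1.2, h2.1, h2.2]

theorem square {x x' y y' : ℂ} (h1 : ‖x' - x‖ < ‖x - y‖) (h2 : ‖y' - y‖ < ‖x' - y‖)
    (h3 : ‖y' - y‖ < ‖x - y‖) (h4 : ‖x' - x‖ < ‖x - y'‖) :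
    AA x x' y + AA y y' x' = AA y y' x + AA x x' y' := by
  have ne : ∀ {a b c d : ℂ}, ‖a - b‖ < ‖c - d‖ → c - d ≠ 0 := by
    intro a b c d h h0
    rw [h0] at h
    have := norm_nonneg (a - b)
    simp at h; linarith
  have n1 := ne h1
  have n2 := ne h2
  have n4 := ne h4
  unfold AA
  have p1 : 0 < ((x' - y) / (x - y)).re := by
    have := ratio_re_pos h1
    convert this using 3; ring
  have p4 : 0 < ((x' - y') / (x - y')).re := by
    have := ratio_re_pos h4
    convert this using 3; ring
  have p2 : 0 < ((y' - x') / (y - x')).re := by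
    have := ratio_re_pos (z := y - x') (d := y' - y) (by rw [norm_sub_rev y x']; exact h2)
    convert this using 3; ring
  have p3 : 0 < ((y' - x) / (y - x)).re := by
    have := ratio_re_pos (z := y - x) (d := y' - y) (by rw [norm_sub_rev y x]; exact h3)
    convert this using 3; ring
  rw [← arg_mul_of_re_pos p1 p2, ← arg_mul_of_re_pos p3 p4]
  congr 1
  have m1 : y - x ≠ 0 := by rw [← neg_sub]; exact neg_ne_zero.2 n1
  have m2 : y - x' ≠ 0 := by rw [← neg_sub]; exact neg_ne_zero.2 n2
  field_simp
  ring

noncomputable def WW (N : ℕ) (p : ℕ → ℂ) (v : ℂ) : ℝ :=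
  ∑ m ∈ Finset.range N, AA (p m) (p (m+1)) v

theorem grid (N : ℕ) (p q : ℕ → ℂ)
    (hp : ∀ m < N, ∀ m' ≤ N, ∀ n ≤ N, ‖p (m+1) - p m‖ < ‖p m' - q n‖)
    (hq : ∀ n < N, ∀ m' ≤ N, ∀ n' ≤ N, ‖q (n+1) - q n‖ < ‖p m' - q n'‖) :
    WW N p (q N) - WW N p (q 0) = WW N q (p N) - WW N q (p 0) := by
  have h1 : WW N p (q N) - WW N p (q 0)
      = ∑ n ∈ Finset.range N, (WW N p (q (n+1)) - WW N p (q n)) :=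
    (Finset.sum_range_sub (fun n => WW N p (q n)) N).symm
  have h2 : WW N q (p N) - WW N q (p 0)
      = ∑ n ∈ Finset.range N, (WW N q (p (n+1)) - WW N q (p n)) :=
    (Finset.sum_range_sub (fun n => WW N q (p n)) N).symm
  rw [h1, h2]
  unfold WW
  simp_rw [← Finset.sum_sub_distrib]
  rw [Finset.sum_comm]
  refine Finset.sum_congr rfl fun m hm => Finset.sum_congr rfl fun n hn => ?_
  rw [Finset.mem_range] at hm hn
  have := square (x := p m) (x' := p (m+1)) (y := q n) (y' := q (n+1))
    (hp _ hm _ (by omega) _ (by omega)) (hq _ hn _ (by omega) _ (by omega))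
    (hq _ hn _ (by omega) _ (by omega)) (hp _ hm _ (by omega) _ (by omega))
  linarith

theorem WW_mod (N : ℕ) (p : ℕ → ℂ) (v : ℂ) (h : ∀ m ≤ N, p m ≠ v) :
    ∃ k : ℤ, WW N p v = Complex.arg (p N - v) - Complex.arg (p 0 - v) + 2 * Real.pi * k := by
  have : ((WW N p v : ℝ) : Real.Angle)
      = ((Complex.arg (p N - v) - Complex.arg (p 0 - v) : ℝ) : Real.Angle) := by
    induction N with
    | zero => simp [WW]
    | succ N ih =>
      have := ih (fun m hm => h m (by omega))
      unfold WW at this ⊢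
      rw [Finset.sum_range_succ, Real.Angle.coe_add, this]
      unfold AA
      rw [Complex.arg_div_coe_angle (sub_ne_zero.2 (h _ le_rfl)) (sub_ne_zero.2 (h _ (by omega)))]
      rw [Real.Angle.coe_sub, Real.Angle.coe_sub]
      abel
  obtain ⟨k, hk⟩ := Real.Angle.angle_eq_iff_two_pi_dvd_sub.1 this
  exact ⟨k, by linarith⟩

theorem arg_neg_odd (z : ℂ) (hz : z ≠ 0) :
    ∃ k : ℤ, Complex.arg z - Complex.arg (-z) = Real.pi * (2 * k + 1) := by
  have := Complex.arg_neg_coe_angle hz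
  have h2 : ((Complex.arg (-z) : ℝ) : Real.Angle) = ((Complex.arg z + Real.pi : ℝ) : Real.Angle) := by
    rw [this]; rfl
  obtain ⟨k, hk⟩ := Real.Angle.angle_eq_iff_two_pi_dvd_sub.1 h2
  refine ⟨-k - 1, ?_⟩
  push_cast
  linarith

theorem parity (al be c : Fin 3 → Fin 3 → ℤ) (na nb : Fin 3 → Fin 3 → Fin 3 → ℤ)
    (hbe : ∀ j l, j ≠ l → (2 * be j l + 1) = - (2 * be l j + 1))
    (h : ∀ i k j l, i ≠ k → j ≠ l →
      (2 * be j l + 1) + (2 * al i k + 1) + (2 * c k j + 1) - (2 * c i l + 1)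
       + 2 * (nb l i j - na k i j - nb j k l + na i k l) = 0) : False := by
  have e01 := hbe 0 1 (by decide)
  have e02 := hbe 0 2 (by decide)
  have e12 := hbe 1 2 (by decide)
  have H : ∀ i k, i ≠ k → _ := fun i k hik =>
    And.intro (h i k 0 1 hik (by decide)) (And.intro (h i k 1 0 hik (by decide))
    (And.intro (h i k 0 2 hik (by decide)) (And.intro (h i k 2 0 hik (by decide))
    (And.intro (h i k 1 2 hik (by decide)) (h i k 2 1 hik (by decide))))))
  have h01 := H 0 1 (by decide)
  have h02 := H 0 2 (by decide)
  have h12 := H 1 2 (by decide)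
  omega

theorem k33_discrete (N : ℕ) (p : Fin 3 → Fin 3 → ℕ → ℂ) (a b : Fin 3 → ℂ)
    (ha : ∀ i j, p i j 0 = a i) (hb : ∀ i j, p i j N = b j)
    (hne : ∀ i k, i ≠ k → a i ≠ a k) (hneb : ∀ i k, i ≠ k → b i ≠ b k) (hab : ∀ i j, a i ≠ b j)
    (h : ∀ i j k l, i ≠ k → j ≠ l → ∀ m < N, ∀ m' ≤ N, ∀ n ≤ N,
      ‖p i j (m+1) - p i j m‖ < ‖p i j m' - p k l n‖) : False := by
  have hpos : ∀ i j k l, i ≠ k → j ≠ l → ∀ m ≤ N, ∀ n ≤ N, p i j m ≠ p k l n := by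
    intro i j k l hik hjl m hm n hn he
    rcases Nat.eq_zero_or_pos N with h0 | h0
    · subst h0
      exact hab i j ((ha i j).symm.trans (hb i j))
    · have := h i j k l hik hjl 0 h0 m hm n hn
      rw [he] at this
      have h2 := norm_nonneg (p i j (0+1) - p i j 0)
      simp only [sub_self, norm_zero] at this
      linarith
  have sa : ∀ i k, ∃ z : ℤ, i ≠ k → Complex.arg (a i - a k) - Complex.arg (a k - a i) = Real.pi * (2 * z + 1) := by
    intro i k
    by_cases hik : i = k
    · exact ⟨0, fun h => absurd hik h⟩
    · obtain ⟨z, hz⟩ := arg_neg_odd (a i - a k) (sub_ne_zero.2 (hne i k hik))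
      exact ⟨z, fun _ => by rw [← hz, neg_sub]⟩
  have sb : ∀ i k, ∃ z : ℤ, i ≠ k → Complex.arg (b i - b k) - Complex.arg (b k - b i) = Real.pi * (2 * z + 1) := by
    intro i k
    by_cases hik : i = k
    · exact ⟨0, fun h => absurd hik h⟩
    · obtain ⟨z, hz⟩ := arg_neg_odd (b i - b k) (sub_ne_zero.2 (hneb i k hik))
      exact ⟨z, fun _ => by rw [← hz, neg_sub]⟩
  have sc : ∀ i k, ∃ z : ℤ, Complex.arg (a i - b k) - Complex.arg (b k - a i) = Real.pi * (2 * z + 1) := by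
    intro i k
    obtain ⟨z, hz⟩ := arg_neg_odd (a i - b k) (sub_ne_zero.2 (hab i k))
    exact ⟨z, by rw [← hz, neg_sub]⟩
  have xa : ∀ k i j, ∃ z : ℤ, i ≠ k → WW N (p i j) (a k) =
      Complex.arg (b j - a k) - Complex.arg (a i - a k) + 2 * Real.pi * z := by
    intro k i j
    by_cases hik : i = k
    · exact ⟨0, fun h => absurd hik h⟩
    · obtain ⟨l, hl⟩ := exists_ne j
      obtain ⟨z, hz⟩ := WW_mod N (p i j) (a k) (fun m hm => by
        rw [← ha k l]; exact hpos i j k l hik (Ne.symm hl) m hm 0 (by omega))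
      exact ⟨z, fun _ => by rw [hz, ha, hb]⟩
  have xb : ∀ l i j, ∃ z : ℤ, j ≠ l → WW N (p i j) (b l) =
      Complex.arg (b j - b l) - Complex.arg (a i - b l) + 2 * Real.pi * z := by
    intro l i j
    by_cases hjl : j = l
    · exact ⟨0, fun h => absurd hjl h⟩
    · obtain ⟨k, hk⟩ := exists_ne i
      obtain ⟨z, hz⟩ := WW_mod N (p i j) (b l) (fun m hm => by
        rw [← hb k l]; exact hpos i j k l (Ne.symm hk) hjl m hm N le_rfl)
      exact ⟨z, fun _ => by rw [hz, ha, hb]⟩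
  choose al hal using sa
  choose be hbe using sb
  choose c hc using sc
  choose na hna using xa
  choose nb hnb using xb
  have hpi := Real.pi_pos
  refine parity al be c na nb ?_ ?_
  · intro j l hjl
    have h1 := hbe j l hjl
    have h2 := hbe l j hjl.symm
    have : Real.pi * ((2 * be j l + 1 : ℝ) + (2 * be l j + 1)) = 0 := by linarith
    have h3 := (mul_eq_zero.1 this).resolve_left hpi.ne'
    have h4 : (2 * be j l + 1 : ℤ) + (2 * be l j + 1) = 0 := by exact_mod_cast h3
    linarith
  · intro i k j l hik hjl
    have g := grid N (p i j) (p k l) (h i j k l hik hjl) (by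
      intro n hn m' hm' n' hn'
      rw [norm_sub_rev (p i j m')]
      exact h k l i j hik.symm hjl.symm n hn n' hn' m' hm')
    rw [ha, hb, ha, hb, hnb l i j hjl, hna k i j hik, hnb j k l hjl.symm, hna i k l hik.symm] at g
    have h1 := hbe j l hjl
    have h2 := hal i k hik
    have h3 := hc k j
    have h4 := hc i l
    have : Real.pi * ((2 * be j l + 1) + (2 * al i k + 1) + (2 * c k j + 1) - (2 * c i l + 1)
       + 2 * (nb l i j - na k i j - nb j k l + na i k l) : ℝ) = 0 := by linarith
    have h5 := (mul_eq_zero.1 this).resolve_left hpi.ne'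
    exact_mod_cast h5

theorem k33_cont (g : Fin 3 → Fin 3 → ℝ → ℂ) (a b : Fin 3 → ℂ)
    (hg : ∀ i j, ContinuousOn (g i j) (Set.Icc 0 1))
    (ha : ∀ i j, g i j 0 = a i) (hb : ∀ i j, g i j 1 = b j)
    (hne : ∀ i k, i ≠ k → a i ≠ a k) (hneb : ∀ i k, i ≠ k → b i ≠ b k) (hab : ∀ i j, a i ≠ b j)
    (h : ∀ i j k l, i ≠ k → j ≠ l → ∀ s ∈ Set.Icc (0:ℝ) 1, ∀ t ∈ Set.Icc (0:ℝ) 1,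
      g i j s ≠ g k l t) : False := by
  have hcomp : IsCompact (Set.Icc (0:ℝ) 1) := isCompact_Icc
  have hne' : (Set.Icc (0:ℝ) 1).Nonempty := ⟨0, by simp⟩
  have heps : ∀ i j k l, ∃ ε > 0, i ≠ k → j ≠ l → ∀ s ∈ Set.Icc (0:ℝ) 1, ∀ t ∈ Set.Icc (0:ℝ) 1,
      ε ≤ ‖g i j s - g k l t‖ := by
    intro i j k l
    by_cases hh : i ≠ k ∧ j ≠ l
    · have hc : ContinuousOn (fun x : ℝ × ℝ => ‖g i j x.1 - g k l x.2‖)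
          (Set.Icc (0:ℝ) 1 ×ˢ Set.Icc (0:ℝ) 1) := by
        apply ContinuousOn.norm
        apply ContinuousOn.sub
        · exact (hg i j).comp continuousOn_fst (fun x hx => hx.1)
        · exact (hg k l).comp continuousOn_snd (fun x hx => hx.2)
      obtain ⟨x, hx, hm⟩ := (hcomp.prod hcomp).exists_isMinOn (hne'.prod hne') hc
      refine ⟨‖g i j x.1 - g k l x.2‖, norm_pos_iff.2 (sub_ne_zero.2
        (h i j k l hh.1 hh.2 _ hx.1 _ hx.2)), fun _ _ s hs t ht => ?_⟩
      exact hm (Set.mk_mem_prod hs ht)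
    · exact ⟨1, one_pos, fun h1 h2 => absurd ⟨h1, h2⟩ hh⟩
  choose ε hε0 hε using heps
  have hδ : ∀ i j k l, ∃ δ > 0, ∀ s ∈ Set.Icc (0:ℝ) 1, ∀ t ∈ Set.Icc (0:ℝ) 1, dist s t < δ →
      dist (g i j s) (g i j t) < ε i j k l := by
    intro i j k l
    exact Metric.uniformContinuousOn_iff.1 (hcomp.uniformContinuousOn_of_continuous (hg i j)) _ (hε0 i j k l)
  choose δ hδ0 hδ using hδ
  have : ∃ d > 0, ∀ i j k l, d ≤ δ i j k l := by
    have : ∃ m : Fin 3 × Fin 3 × Fin 3 × Fin 3, ∀ x : Fin 3 × Fin 3 × Fin 3 × Fin 3, δ m.1 m.2.1 m.2.2.1 m.2.2.2 ≤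
        δ x.1 x.2.1 x.2.2.1 x.2.2.2 :=
      Finite.exists_min (fun x : Fin 3 × Fin 3 × Fin 3 × Fin 3 => δ x.1 x.2.1 x.2.2.1 x.2.2.2)
    obtain ⟨m, hm⟩ := this
    exact ⟨_, hδ0 _ _ _ _, fun i j k l => hm (i,j,k,l)⟩
  obtain ⟨d, hd, hdm⟩ := this
  obtain ⟨N, hN⟩ := exists_nat_gt (1 / d)
  have hN0 : (0:ℝ) < N := lt_trans (by positivity) hN
  have mem : ∀ m ≤ N, (m / N : ℝ) ∈ Set.Icc (0:ℝ) 1 := fun m hm =>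
    ⟨by positivity, (div_le_one hN0).2 (by exact_mod_cast hm)⟩
  refine k33_discrete N (fun i j m => g i j (m / N)) a b ?_ ?_ hne hneb hab ?_
  · intro i j; simp [ha]
  · intro i j; simp [hN0.ne', hb]
  · intro i j k l hik hjl m hm m' hm' n hn
    refine lt_of_lt_of_le ?_ (hε i j k l hik hjl _ (mem m' hm') _ (mem n hn))
    rw [← dist_eq_norm]
    refine hδ i j k l _ (mem _ (by omega)) _ (mem _ (by omega)) (lt_of_lt_of_le ?_ (hdm i j k l))
    rw [Real.dist_eq]
    have : ((m+1 : ℕ) / N - m / N : ℝ) = 1 / N := by push_cast; ring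
    rw [this, abs_of_pos (by positivity)]
    rw [div_lt_iff₀ hN0]
    rw [div_lt_iff₀ hd] at hN
    linarith

theorem k33_joined (C : Fin 3 → Fin 3 → Set (ℝ × ℝ)) (a b : Fin 3 → ℝ × ℝ)
    (h : ∀ i j, JoinedIn (C i j) (a i) (b j)) :
    ∃ i j k l, i ≠ k ∧ j ≠ l ∧ (C i j ∩ C k l).Nonempty := by
  by_contra hcon
  have hne : ∀ i k, i ≠ k → a i ≠ a k := by
    intro i k hik e
    exact hcon ⟨i, 0, k, 1, hik, by decide, a i, (h i 0).source_mem, e ▸ (h k 1).source_mem⟩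
  have hneb : ∀ i k, i ≠ k → b i ≠ b k := by
    intro i k hik e
    exact hcon ⟨0, i, 1, k, by decide, hik, b i, (h 0 i).target_mem, e ▸ (h 1 k).target_mem⟩
  have hab : ∀ i j, a i ≠ b j := by
    intro i j e
    obtain ⟨k, hk⟩ := exists_ne i
    obtain ⟨l, hl⟩ := exists_ne j
    exact hcon ⟨i, l, k, j, hk.symm, hl, a i, (h i l).source_mem, e ▸ (h k j).target_mem⟩
  let φ := Complex.equivRealProdCLM.symm
  have hφ : Function.Injective φ := φ.injective
  refine k33_cont (fun i j t => φ ((h i j).somePath.extend t)) (fun i => φ (a i)) (fun j => φ (b j))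
    ?_ ?_ ?_ ?_ ?_ ?_ ?_
  · intro i j
    exact (φ.continuous.comp (Path.continuous_extend _)).continuousOn
  · intro i j; simp
  · intro i j; simp
  · intro i k hik e; exact hne i k hik (hφ e)
  · intro i k hik e; exact hneb i k hik (hφ e)
  · intro i k e; exact hab i k (hφ e)
  · intro i j k l hik hjl s hs t ht e
    have e' := hφ e
    apply hcon
    refine ⟨i, j, k, l, hik, hjl, (h i j).somePath.extend s, ?_, ?_⟩
    · rw [Path.extend_apply _ hs]; exact (h i j).somePath_mem _
    · rw [e', Path.extend_apply _ ht]; exact (h k l).somePath_mem _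

end PCR

open scoped BigOperators

namespace PCR

open Relation

theorem rtg_mono {X : Type} {r r' : X → X → Prop} (h : ∀ x y, r x y → r' x y) {a b : X}
    (hab : ReflTransGen r a b) : ReflTransGen r' a b := by
  induction hab with
  | refl => exact ReflTransGen.refl
  | tail _ hst ih => exact ih.tail (h _ _ hst)

theorem rtg_symm {X : Type} {r : X → X → Prop} (h : ∀ x y, r x y → r y x) {a b : X}
    (hab : ReflTransGen r a b) : ReflTransGen r b a := by
  induction hab with
  | refl => exact ReflTransGen.refl
  | tail _ hst ih => exact ReflTransGen.head (h _ _ hst) ih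

/-- walks along strings -/
def RchAdj {X ι : Type} (adj : ι → X → X → Prop) (Y : Set X) (p q : X) : Prop :=
  p ∈ Y ∧ ReflTransGen (fun x y => y ∈ Y ∧ ∃ s, adj s x y) p q

structure Host (X ι : Type) where
  adj : ι → X → X → Prop
  reg : ι → Set X
  symm : ∀ s p q, adj s p q → adj s q p
  mem : ∀ s p q, adj s p q → p ∈ reg s
  conn : ∀ s p q, p ∈ reg s → q ∈ reg s → ReflTransGen (adj s) p q
  h33 : ∀ (a b : Fin 3 → X) (C : Fin 3 → Fin 3 → Set X),
    (∀ i j, RchAdj adj (C i j) (a i) (b j)) →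
    ∃ i j k l, i ≠ k ∧ j ≠ l ∧ (C i j ∩ C k l).Nonempty

namespace Host
variable {X ι : Type} (H : Host X ι)

def Rch (Y : Set X) (p q : X) : Prop := RchAdj H.adj Y p q

theorem mem' (s : ι) (p q : X) (h : H.adj s p q) : q ∈ H.reg s := H.mem s q p (H.symm s p q h)

def comap {κ : Type} (f : κ → ι) : Host X κ where
  adj s := H.adj (f s)
  reg s := H.reg (f s)
  symm s := H.symm (f s)
  mem s := H.mem (f s)
  conn s := H.conn (f s)
  h33 a b C h := H.h33 a b C (fun i j => ⟨(h i j).1, rtg_mono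
    (fun x y hxy => ⟨hxy.1, hxy.2.elim fun s hs => ⟨f s, hs⟩⟩) (h i j).2⟩)

end Host
end PCR

set_option linter.all false
open scoped BigOperators

namespace PCR
open Relation

theorem chain_conn (R : ℝ → ℝ → Prop) (T : Finset ℝ)
    (hR : ∀ s ∈ T, ∀ u ∈ T, s < u → (∀ x ∈ T, s < x → ¬ x < u) → R s u) :
    ∀ n : ℕ, ∀ s ∈ T, ∀ t ∈ T, s ≤ t → (T.filter (fun x => s < x)).card = n → ReflTransGen R s t := by
  intro n
  induction n using Nat.strong_induction_on with
  | _ n ih =>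
    intro s hs t ht hst hn
    rcases hst.eq_or_lt with rfl | hlt
    · exact ReflTransGen.refl
    · have hne : (T.filter (fun x => s < x)).Nonempty := ⟨t, by simp [ht, hlt]⟩
      obtain ⟨u, hu, hmin⟩ := Finset.exists_min_image _ id hne
      simp only [Finset.mem_filter, id] at hu hmin
      have hut : u ≤ t := hmin t ⟨ht, hlt⟩
      refine ReflTransGen.head (hR s hs u hu.1 hu.2 (fun x hx hsx hxu => ?_)) ?_
      · exact absurd (hmin x ⟨hx, hsx⟩) (not_le.2 hxu)
      · refine ih _ ?_ u hu.1 t ht hut rfl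
        rw [← hn]
        apply Finset.card_lt_card
        rw [Finset.ssubset_iff_of_subset]
        · exact ⟨u, by simp [hu], by simp⟩
        · intro x hx
          simp only [Finset.mem_filter] at hx ⊢
          exact ⟨hx.1, hu.2.trans hx.2⟩

variable {V : Type} {G : SimpleGraph V} (D : Drawing G)

def KK : Set (ℝ × ℝ) := Set.range D.pos ∪ ⋃ e : G.edgeSet, ⋃ f : G.edgeSet, ⋃ _ : e ≠ f,
  (D.curve e '' Set.Icc 0 1 ∩ D.curve f '' Set.Icc 0 1)

theorem KK_finite [Finite V] : (KK D).Finite := by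
  have : Finite G.edgeSet := Subtype.finite
  refine (Set.finite_range _).union (Set.finite_iUnion fun e => Set.finite_iUnion fun f =>
    Set.finite_iUnion fun h => D.curve_finite_inter e f h)

/-- consecutive special points along `e` with parameters `s, t` -/
def Cons (e : G.edgeSet) (s t : ℝ) : Prop :=
  s ∈ Set.Icc (0:ℝ) 1 ∧ t ∈ Set.Icc (0:ℝ) 1 ∧ s ≤ t ∧ D.curve e s ∈ KK D ∧ D.curve e t ∈ KK D ∧
    ∀ u ∈ Set.Ioo s t, D.curve e u ∉ KK D

def dadj (e : G.edgeSet) (p q : KK D) : Prop :=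
  ∃ s t, Cons D e s t ∧ ((p.1 = D.curve e s ∧ q.1 = D.curve e t) ∨
    (q.1 = D.curve e s ∧ p.1 = D.curve e t))

def hull (Y : Set (KK D)) : Set (ℝ × ℝ) :=
  {z | (∃ y ∈ Y, y.1 = z) ∨ ∃ e s t, ∃ p ∈ Y, ∃ q ∈ Y, Cons D e s t ∧
    p.1 = D.curve e s ∧ q.1 = D.curve e t ∧ z ∈ D.curve e '' Set.Icc s t}

theorem hull_K {Y : Set (KK D)} {z : ℝ × ℝ} (h : z ∈ hull D Y) (hz : z ∈ KK D) :
    (⟨z, hz⟩ : KK D) ∈ Y := by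
  rcases h with ⟨y, hy, rfl⟩ | ⟨e, s, t, p, hp, q, hq, hc, hps, hqt, u, hu, rfl⟩
  · exact hy
  · obtain ⟨_, _, _, _, _, h6⟩ := hc
    rcases hu.1.eq_or_lt with h1 | h1
    · subst h1
      convert hp
      exact hps.symm
    rcases hu.2.eq_or_lt with h2 | h2
    · subst h2
      convert hq
      exact hqt.symm
    exact absurd hz (h6 u ⟨h1, h2⟩)

theorem hull_disj {Y Y' : Set (KK D)} (h : (hull D Y ∩ hull D Y').Nonempty) : (Y ∩ Y').Nonempty := by
  obtain ⟨z, h1, h2⟩ := h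
  by_cases hz : z ∈ KK D
  · exact ⟨⟨z, hz⟩, hull_K D h1 hz, hull_K D h2 hz⟩
  rcases h1 with ⟨y, hy, rfl⟩ | ⟨e, s, t, p, hp, q, hq, hc, hps, hqt, u, hu, rfl⟩
  · exact absurd y.2 hz
  rcases h2 with ⟨y, hy, h⟩ | ⟨e', s', t', p', hp', q', hq', hc', hps', hqt', u', hu', he⟩
  · rw [← h] at hz; exact absurd y.2 hz
  have hu01 : u ∈ Set.Icc (0:ℝ) 1 := ⟨hc.1.1.trans hu.1, hu.2.trans hc.2.1.2⟩
  have hu01' : u' ∈ Set.Icc (0:ℝ) 1 := ⟨hc'.1.1.trans hu'.1, hu'.2.trans hc'.2.1.2⟩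
  have hee : e = e' := by
    by_contra hne
    apply hz
    right
    simp only [Set.mem_iUnion]
    exact ⟨e, e', hne, ⟨u, hu01, rfl⟩, ⟨u', hu01', he⟩⟩
  subst hee
  have := D.curve_inj e hu01' hu01 he
  subst this
  have key : ∀ x, x ∈ Set.Icc (0:ℝ) 1 → D.curve e x ∈ KK D → x ≠ u' := by
    rintro x hx hK rfl; exact hz hK
  have n1 := key s hc.1 hc.2.2.2.1
  have n2 := key t hc.2.1 hc.2.2.2.2.1
  have n3 := key s' hc'.1 hc'.2.2.2.1
  have n4 := key t' hc'.2.1 hc'.2.2.2.2.1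
  have l1 := lt_of_le_of_ne hu.1 n1
  have l2 := lt_of_le_of_ne hu.2 n2.symm
  have l3 := lt_of_le_of_ne hu'.1 n3
  have l4 := lt_of_le_of_ne hu'.2 n4.symm
  have hss : s = s' := by
    apply le_antisymm
    · by_contra hlt
      exact hc'.2.2.2.2.2 s ⟨not_le.1 hlt, l1.trans l4⟩ hc.2.2.2.1
    · by_contra hlt
      exact hc.2.2.2.2.2 s' ⟨not_le.1 hlt, l3.trans l2⟩ hc'.2.2.2.1
  subst hss
  have : p = p' := Subtype.ext (hps.trans hps'.symm)
  subst this
  exact ⟨p, hp, hp'⟩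

theorem hull_joined {Y : Set (KK D)} {p q : KK D} (h : RchAdj (dadj D) Y p q) :
    JoinedIn (hull D Y) p.1 q.1 := by
  obtain ⟨hp, h⟩ := h
  have : q ∈ Y ∧ JoinedIn (hull D Y) p.1 q.1 := by
    induction h with
    | refl => exact ⟨hp, JoinedIn.refl (Or.inl ⟨p, hp, rfl⟩)⟩
    | @tail x y hxy hst ih =>
      refine ⟨hst.1, ih.2.trans ?_⟩
      obtain ⟨hy, e, s, t, hc, hh⟩ := hst
      have hx := ih.1
      have main : ∀ x y : KK D, x ∈ Y → y ∈ Y → x.1 = D.curve e s → y.1 = D.curve e t →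
          JoinedIn (hull D Y) x.1 y.1 := by
        intro x y hx hy hxs hyt
        have hcv : IsPathConnected (D.curve e '' Set.Icc s t) := by
          apply IsPathConnected.image'
          · exact (convex_Icc s t).isPathConnected ⟨s, by simp [hc.2.2.1]⟩
          · exact (D.curve_cont e).mono (Set.Icc_subset_Icc hc.1.1 hc.2.1.2)
        have := hcv.joinedIn (D.curve e s) ⟨s, by simp [hc.2.2.1], rfl⟩ (D.curve e t) ⟨t, by simp [hc.2.2.1], rfl⟩
        rw [hxs, hyt]
        refine this.mono fun z hz => Or.inr ⟨e, s, t, x, hx, y, hy, hc, hxs, hyt, hz⟩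
      rcases hh with ⟨h1, h2⟩ | ⟨h1, h2⟩
      · exact main x y hx hy h1 h2
      · exact (main y x hy hx h1 h2).symm
  exact this.2

def drawHost [Finite V] : Host (KK D) G.edgeSet where
  adj := dadj D
  reg e := {p | p.1 ∈ D.curve e '' Set.Icc 0 1}
  symm := by
    rintro e p q ⟨s, t, hc, h⟩
    exact ⟨s, t, hc, h.symm⟩
  mem := by
    rintro e p q ⟨s, t, hc, h | h⟩
    · exact ⟨s, hc.1, h.1.symm⟩
    · exact ⟨t, hc.2.1, h.2.symm⟩
  conn := by
    intro e
    have hfin : ({u | u ∈ Set.Icc (0:ℝ) 1 ∧ D.curve e u ∈ KK D} : Set ℝ).Finite := by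
      refine Set.Finite.of_finite_image (f := D.curve e) ((KK_finite D).subset ?_) ?_
      · rintro _ ⟨u, hu, rfl⟩; exact hu.2
      · intro x hx y hy; exact D.curve_inj e hx.1 hy.1
    let R : ℝ → ℝ → Prop := Cons D e
    have key : ∀ s t, ReflTransGen R s t → ∀ (p q : KK D), p.1 = D.curve e s → q.1 = D.curve e t →
        ReflTransGen (dadj D e) p q := by
      intro s t h
      induction h with
      | refl => intro p q hp hq; rw [Subtype.ext (hp.trans hq.symm)]
      | @tail x y hxy hst ih =>
        intro p q hp hq
        exact (ih p ⟨D.curve e x, hst.2.2.2.1⟩ hp rfl).tail ⟨x, y, hst, Or.inl ⟨rfl, hq⟩⟩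
    have cc := chain_conn R hfin.toFinset (by
      intro s hs u hu hsu hb
      simp only [Set.Finite.mem_toFinset, Set.mem_ofPred_eq] at hs hu hb
      refine ⟨hs.1, hu.1, hsu.le, hs.2, hu.2, fun x hx hK => ?_⟩
      exact hb x ⟨⟨hs.1.1.trans hx.1.le, hx.2.le.trans hu.1.2⟩, hK⟩ hx.1 hx.2)
    have main : ∀ (p q : KK D) (s t : ℝ), s ∈ Set.Icc (0:ℝ) 1 → t ∈ Set.Icc (0:ℝ) 1 →
        D.curve e s = p.1 → D.curve e t = q.1 → s ≤ t → ReflTransGen (dadj D e) p q := by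
      intro p q s t hs ht hp hq hst
      exact key s t (cc _ s (by simp only [Set.Finite.mem_toFinset]; exact ⟨hs, hp ▸ p.2⟩) t
        (by simp only [Set.Finite.mem_toFinset]; exact ⟨ht, hq ▸ q.2⟩) hst rfl) p q hp.symm hq.symm
    rintro p q ⟨s, hs, hp⟩ ⟨t, ht, hq⟩
    rcases le_total s t with h | h
    · exact main p q s t hs ht hp hq h
    · have := main q p t s ht hs hq hp h
      exact rtg_symm (fun x y hxy => by
        obtain ⟨s, t, hc, h⟩ := hxy; exact ⟨s, t, hc, h.symm⟩) this
  h33 := by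
    intro a b C h
    obtain ⟨i, j, k, l, h1, h2, h3⟩ := k33_joined (fun i j => hull D (C i j)) (fun i => (a i).1)
      (fun j => (b j).1) (fun i j => hull_joined D (h i j))
    exact ⟨i, j, k, l, h1, h2, hull_disj D h3⟩

def vpt (v : V) : KK D := ⟨D.pos v, Or.inl ⟨v, rfl⟩⟩

theorem vpt_mem [Finite V] (v : V) (e : G.edgeSet) (h : v ∈ (e : Sym2 V)) :
    vpt D v ∈ (drawHost D).reg e := by
  obtain ⟨u, w, he, h0, h1⟩ := D.curve_ends e
  rw [he, Sym2.mem_iff] at h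
  rcases h with rfl | rfl
  · exact ⟨0, by simp, h0⟩
  · exact ⟨1, by simp, h1⟩

theorem touch_cases [Finite V] (e f : G.edgeSet)
    (h : ((drawHost D).reg e ∩ (drawHost D).reg f).Nonempty) :
    (∃ p, D.IsCross e f p) ∨ ∃ v : V, v ∈ (e : Sym2 V) ∧ v ∈ (f : Sym2 V) := by
  obtain ⟨p, ⟨s, hs, hp⟩, ⟨t, ht, hq⟩⟩ := h
  have ends : ∀ (e : G.edgeSet) (s : ℝ), s ∈ Set.Icc (0:ℝ) 1 → s ∈ Set.Ioo (0:ℝ) 1 ∨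
      ∃ v ∈ (e : Sym2 V), D.curve e s = D.pos v := by
    intro e s hs
    obtain ⟨u, w, he, h0, h1⟩ := D.curve_ends e
    rcases hs.1.eq_or_lt with h | h
    · right; exact ⟨u, by simp [he], by rw [← h, h0]⟩
    rcases hs.2.eq_or_lt with h' | h'
    · right; exact ⟨w, by simp [he], by rw [h', h1]⟩
    exact Or.inl ⟨h, h'⟩
  rcases ends e s hs with h1 | ⟨v, hv, h1⟩ <;> rcases ends f t ht with h2 | ⟨w, hw, h2⟩
  · exact Or.inl ⟨p.1, ⟨s, h1, hp⟩, ⟨t, h2, hq⟩⟩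
  · exact absurd ⟨w, by rw [hp, ← hq, h2]⟩ (D.curve_avoid e s h1)
  · exact absurd ⟨v, by rw [hq, ← hp, h1]⟩ (D.curve_avoid f t h2)
  · have : v = w := D.pos_inj (by rw [← h1, ← h2, hp, hq])
    subst this
    exact Or.inr ⟨v, hv, hw⟩

end PCR

set_option linter.all false
open scoped BigOperators

namespace PCR
open Relation

theorem first_hit {X : Type} {r : X → X → Prop} (P : X → Prop) {p q : X}
    (h : ReflTransGen r p q) (hp : P p) (hq : ¬ P q) :
    ∃ q' q'', ReflTransGen (fun x y => P x ∧ P y ∧ r x y) p q' ∧ P q' ∧ r q' q'' ∧ ¬ P q'' := by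
  induction h with
  | refl => exact absurd hp hq
  | @tail y z hy hst ih =>
    by_cases hPy : P y
    · have : ∀ b, ReflTransGen r p b → (ReflTransGen (fun x y => P x ∧ P y ∧ r x y) p b ∨
          ∃ q' q'', ReflTransGen (fun x y => P x ∧ P y ∧ r x y) p q' ∧ P q' ∧ r q' q'' ∧ ¬ P q'') := by
        intro b hb
        induction hb with
        | refl => exact Or.inl ReflTransGen.refl
        | @tail y z hy hst ih =>
          rcases ih with h | h
          · have hPy : P y := by
              rcases h.cases_tail with h1 | ⟨c, _, h2⟩
              · exact h1 ▸ hp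
              · exact h2.2.1
            by_cases hz : P z
            · exact Or.inl (h.tail ⟨hPy, hz, hst⟩)
            · exact Or.inr ⟨y, z, h, hPy, hst, hz⟩
          · exact Or.inr h
      rcases this y hy with h | h
      · exact ⟨y, z, h, hPy, hst, hq⟩
      · exact h
    · exact ih hPy

namespace Host
variable {X ι : Type} (H : Host X ι)

theorem Rch.mono {H : Host X ι} {Y Y' : Set X} (h : Y ⊆ Y') {p q : X} (hpq : H.Rch Y p q) :
    H.Rch Y' p q :=
  ⟨h hpq.1, rtg_mono (fun _ _ hxy => ⟨h hxy.1, hxy.2⟩) hpq.2⟩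

theorem Rch.target {H : Host X ι} {Y : Set X} {p q : X} (hpq : H.Rch Y p q) : q ∈ Y := by
  rcases hpq.2.cases_tail with h1 | ⟨c, _, h2⟩
  · exact h1 ▸ hpq.1
  · exact h2.1

theorem Rch.trans {H : Host X ι} {Y : Set X} {p q r : X} (h1 : H.Rch Y p q) (h2 : H.Rch Y q r) :
    H.Rch Y p r := ⟨h1.1, h1.2.trans h2.2⟩

theorem Rch.refl {H : Host X ι} {Y : Set X} {p : X} (h : p ∈ Y) : H.Rch Y p p := ⟨h, ReflTransGen.refl⟩

theorem Rch.tail {H : Host X ι} {Y : Set X} {p q r : X} (h1 : H.Rch Y p q) (hr : r ∈ Y) (s : ι)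
    (h : H.adj s q r) : H.Rch Y p r := ⟨h1.1, h1.2.tail ⟨hr, s, h⟩⟩

theorem Rch.symm {H : Host X ι} {Y : Set X} {p q : X} (h : H.Rch Y p q) : H.Rch Y q p := by
  have : p ∈ Y → ReflTransGen (fun x y => y ∈ Y ∧ ∃ s, H.adj s x y) q p ∧ q ∈ Y := by
    obtain ⟨hp, h⟩ := h
    intro _
    induction h with
    | refl => exact ⟨ReflTransGen.refl, hp⟩
    | tail _ hst ih =>
      refine ⟨ReflTransGen.head ⟨ih.2, hst.2.elim fun s hs => ⟨s, H.symm s _ _ hs⟩⟩ ih.1, hst.1⟩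
  exact ⟨(this h.1).2, (this h.1).1⟩

def Mv (s : ι) (Y : Set X) (p q : X) : Prop :=
  ReflTransGen (fun x y => x ∈ Y ∧ y ∈ Y ∧ H.adj s x y) p q

theorem Mv.mono {H : Host X ι} {s : ι} {Y Y' : Set X} (h : Y ⊆ Y') {p q : X} (hpq : H.Mv s Y p q) :
    H.Mv s Y' p q := rtg_mono (fun _ _ hxy => ⟨h hxy.1, h hxy.2.1, hxy.2.2⟩) hpq

theorem Mv.symm {H : Host X ι} {s : ι} {Y : Set X} {p q : X} (hpq : H.Mv s Y p q) :
    H.Mv s Y q p := rtg_symm (fun _ _ hxy => ⟨hxy.2.1, hxy.1, H.symm s _ _ hxy.2.2⟩) hpq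

theorem Mv.target {H : Host X ι} {s : ι} {Y : Set X} {p q : X} (hpq : H.Mv s Y p q) (hp : p ∈ Y) :
    q ∈ Y := by
  rcases hpq.cases_tail with h1 | ⟨c, _, h2⟩
  · exact h1 ▸ hp
  · exact h2.2.1

/-- a move restricted to the set of points reachable by that move -/
theorem Mv.self {H : Host X ι} {s : ι} {Y : Set X} {p q : X} (hpq : H.Mv s Y p q) :
    H.Mv s {z | H.Mv s Y p z ∧ H.Mv s Y z q} p q := by
  have : ∀ b, H.Mv s Y b q → H.Mv s Y p b →
      H.Mv s {z | H.Mv s Y p z ∧ H.Mv s Y z q} p b := by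
    intro b hb hpb
    unfold Mv at hpb
    induction hpb with
    | refl => exact ReflTransGen.refl
    | @tail y z hy hst ih =>
      have hyq : H.Mv s Y y q := ReflTransGen.head hst hb
      exact (ih hyq).tail ⟨⟨hy, hyq⟩, ⟨hy.tail hst, hb⟩, hst.2.2⟩
  exact this q ReflTransGen.refl hpq

variable (w : ι → ℕ)

inductive Cst (Y : Set X) (p : X) : X → ℕ → Prop
  | refl : p ∈ Y → Cst Y p p 0
  | step (q r : X) (n : ℕ) (s : ι) : Cst Y p q n → H.Mv s Y q r → Cst Y p r (n + w s)

variable {H w}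

theorem Cst.source {Y : Set X} {p q : X} {n : ℕ} (h : H.Cst w Y p q n) : p ∈ Y := by
  induction h with
  | refl h => exact h
  | step q r n s _ _ ih => exact ih

theorem Cst.target {Y : Set X} {p q : X} {n : ℕ} (h : H.Cst w Y p q n) : q ∈ Y := by
  induction h with
  | refl h => exact h
  | step q r n s _ hm ih => exact hm.target ih

theorem Cst.mono {Y Y' : Set X} (hY : Y ⊆ Y') {p q : X} {n : ℕ} (h : H.Cst w Y p q n) :
    H.Cst w Y' p q n := by
  induction h with
  | refl h => exact Cst.refl (hY h)
  | step q r n s _ hm ih => exact Cst.step q r n s ih (hm.mono hY)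

theorem Cst.trans {Y : Set X} {p q r : X} {n m : ℕ} (h : H.Cst w Y p q n) (h' : H.Cst w Y q r m) :
    H.Cst w Y p r (n + m) := by
  induction h' with
  | refl _ => exact h
  | step q' r' n' s _ hm ih => rw [← add_assoc]; exact Cst.step _ _ _ s ih hm

theorem Cst.single {Y : Set X} {p q : X} {s : ι} (hp : p ∈ Y) (h : H.Mv s Y p q) :
    H.Cst w Y p q (w s) := by
  have := Cst.step (w := w) p q 0 s (Cst.refl hp) h
  rwa [zero_add] at this

theorem Cst.symm {Y : Set X} {p q : X} {n : ℕ} (h : H.Cst w Y p q n) : H.Cst w Y q p n := by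
  induction h with
  | refl h => exact Cst.refl h
  | step q r n s h1 hm ih =>
    rw [add_comm]
    exact (Cst.single (hm.target h1.target) hm.symm).trans ih

theorem Rch.cst {Y : Set X} {p q : X} (h : H.Rch Y p q) : ∃ n, H.Cst w Y p q n := by
  obtain ⟨hp, h⟩ := h
  induction h with
  | refl => exact ⟨0, Cst.refl hp⟩
  | tail _ hst ih =>
    obtain ⟨n, hn⟩ := ih
    obtain ⟨hy, s, hs⟩ := hst
    exact ⟨_, Cst.step _ _ _ s hn (ReflTransGen.single ⟨hn.target, hy, hs⟩)⟩

theorem Mv.rch {s : ι} {Y : Set X} {p q : X} (hp : p ∈ Y) (h : H.Mv s Y p q) : H.Rch Y p q :=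
  ⟨hp, rtg_mono (fun _ _ hxy => ⟨hxy.2.1, s, hxy.2.2⟩) h⟩

theorem Cst.rch {Y : Set X} {p q : X} {n : ℕ} (h : H.Cst w Y p q n) : H.Rch Y p q := by
  induction h with
  | refl h => exact Rch.refl h
  | step q r n s h1 hm ih => exact ih.trans (hm.rch h1.target)

variable (H w)

def NN (Y : Set X) (p : X) (n : ℕ) : Set X := {z | ∃ m ≤ n, H.Cst w Y p z m}

variable {H w}

theorem NN_mono {Y Y' : Set X} {p : X} {n n' : ℕ} (hY : Y ⊆ Y') (hn : n ≤ n') :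
    H.NN w Y p n ⊆ H.NN w Y' p n' := by
  rintro z ⟨m, hm, h⟩
  exact ⟨m, hm.trans hn, h.mono hY⟩

theorem NN_trans {Y : Set X} {p q r : X} {n n' : ℕ} (h : q ∈ H.NN w Y p n) (h' : r ∈ H.NN w Y q n') :
    r ∈ H.NN w Y p (n + n') := by
  obtain ⟨m, hm, h⟩ := h
  obtain ⟨m', hm', h'⟩ := h'
  exact ⟨m + m', by omega, h.trans h'⟩

theorem NN_symm {Y : Set X} {p q : X} {n : ℕ} (h : q ∈ H.NN w Y p n) : p ∈ H.NN w Y q n := by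
  obtain ⟨m, hm, h⟩ := h
  exact ⟨m, hm, h.symm⟩

theorem Cst.rchN {Y : Set X} {p q : X} {n : ℕ} (h : H.Cst w Y p q n) :
    H.Rch (H.NN w Y p n) p q := by
  induction h with
  | refl h => exact Rch.refl ⟨0, le_rfl, Cst.refl h⟩
  | step q r n s h1 hm ih =>
    refine (ih.mono (NN_mono le_rfl (Nat.le_add_right _ _))).trans ?_
    have := hm.self
    have hq : q ∈ {z | H.Mv s Y q z ∧ H.Mv s Y z r} := ⟨ReflTransGen.refl, hm⟩
    refine (this.rch hq).mono ?_
    rintro z ⟨hz, _⟩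
    exact ⟨_, le_rfl, Cst.step _ _ _ s h1 hz⟩

theorem NN.rch {Y : Set X} {p q : X} {n : ℕ} (h : q ∈ H.NN w Y p n) : H.Rch (H.NN w Y p n) p q := by
  obtain ⟨m, hm, h⟩ := h
  exact h.rchN.mono (NN_mono le_rfl hm)

variable (H w)

noncomputable def FF (U : Set X) (x z : X) : ℕ := sInf {n | H.Cst w U x z n}

variable {H w}

theorem FF_le {U : Set X} {x z : X} {n : ℕ} (h : H.Cst w U x z n) : H.FF w U x z ≤ n := Nat.sInf_le h

theorem FF_spec {U : Set X} {x z : X} (h : H.Rch U x z) : H.Cst w U x z (H.FF w U x z) :=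
  Nat.sInf_mem (s := {n | H.Cst w U x z n}) h.cst

theorem FF_lip {U : Set X} {x z z' : X} {n : ℕ} (h : H.Rch U x z) (h' : H.Cst w U z z' n) :
    H.FF w U x z' ≤ H.FF w U x z + n := FF_le ((FF_spec h).trans h')

theorem FF_adj {U : Set X} {x z z' : X} {s : ι} (h : H.Rch U x z) (hz' : z' ∈ U)
    (h' : H.adj s z z') : H.FF w U x z' ≤ H.FF w U x z + w s :=
  FF_lip h (Cst.single h.target (ReflTransGen.single ⟨h.target, hz', h'⟩))

/-- last step of a geodesic -/
theorem FF_last {U : Set X} {x z : X} (h : H.Rch U x z) (hz : H.FF w U x z ≠ 0) :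
    ∃ q s, H.Rch U x q ∧ H.FF w U x q + w s = H.FF w U x z ∧
      H.Mv s {y | y ∈ U ∧ H.FF w U x q ≤ H.FF w U x y ∧ H.FF w U x y ≤ H.FF w U x z} q z := by
  have hs := FF_spec (w := w) h
  generalize hn : H.FF w U x z = n at hs hz
  cases hs with
  | refl _ => exact absurd rfl hz
  | step q r m s h1 hm =>
    have e1 : H.FF w U x q ≤ m := FF_le h1
    have e2 := FF_lip h1.rch (Cst.single (w := w) h1.target hm)
    refine ⟨q, s, h1.rch, by omega, ?_⟩
    have hm' := hm.self
    refine hm'.mono ?_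
    rintro y ⟨hy1, hy2⟩
    have hyU := hy1.target h1.target
    have e3 := FF_lip h1.rch (Cst.single (w := w) h1.target hy1)
    have e4 := FF_lip (h1.rch.trans (hy1.rch h1.target)) (Cst.single (w := w) hyU hy2)
    exact ⟨hyU, by omega, by omega⟩

/-- balls are connected -/
theorem ball_conn (hw : ∀ s, 0 < w s) {U : Set X} {x : X} : ∀ n, ∀ z, H.Rch U x z →
    H.FF w U x z = n → H.Rch {y | y ∈ U ∧ H.FF w U x y ≤ n} x z := by
  intro n
  induction n using Nat.strong_induction_on with
  | _ n ih =>
    intro z hz hn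
    by_cases h0 : H.FF w U x z = 0
    · have := FF_spec (w := w) hz
      rw [h0] at this
      generalize hm : 0 = m at this
      cases this with
      | refl h => exact Rch.refl ⟨h, by omega⟩
      | step q r m s _ _ => have := hw s; omega
    · obtain ⟨q, s, hq, he, hm⟩ := FF_last hz h0
      have := hw s
      have h1 := ih (H.FF w U x q) (by omega) q hq rfl
      refine (h1.mono ?_).trans (Rch.mono ?_ (hm.rch ?_))
      · rintro y ⟨h1, h2⟩; exact ⟨h1, by omega⟩
      · rintro y ⟨h1, h2, h3⟩; exact ⟨h1, by omega⟩
      · exact ⟨hq.target, le_rfl, by omega⟩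

theorem lemE (τ : ℕ) (hw : ∀ s, 0 < w s ∧ w s < τ) {U : Set X} {x : X} (b : ℕ) (hb : 0 < b) : ∀ n,
    ∀ p, H.Rch U x p → H.FF w U x p = n → b ≤ n →
    ∃ q' q s n', H.Cst w {y | y ∈ U ∧ b ≤ H.FF w U x y ∧ H.FF w U x y ≤ n} p q' n' ∧ n' + b ≤ n + τ ∧
      H.adj s q' q ∧ q ∈ U ∧ H.FF w U x q < b := by
  intro n
  induction n using Nat.strong_induction_on with
  | _ n ih =>
    intro p hp hn hbn
    obtain ⟨q0, s, hq, he, hm⟩ := FF_last (w := w) hp (by omega)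
    have hws := hw s
    have hm := hm.symm
    by_cases hq0 : b ≤ H.FF w U x q0
    · obtain ⟨q', q, s', n', h1, h2, h3⟩ := ih _ (by omega) q0 hq rfl hq0
      refine ⟨q', q, s', w s + n', ?_, by omega, h3⟩
      refine Cst.trans (q := q0) (Cst.single ⟨hp.target, by omega, by omega⟩ (hm.mono ?_)) (h1.mono ?_)
      · rintro y ⟨h1, h2, h3⟩; exact ⟨h1, by omega, by omega⟩
      · rintro y ⟨h1, h2, h3⟩; exact ⟨h1, by omega, by omega⟩
    · obtain ⟨q', q'', h1, h2, h3, h4⟩ := first_hit (fun y => b ≤ H.FF w U x y) hm (show b ≤ H.FF w U x p by omega) hq0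
      replace h4 : ¬ b ≤ H.FF w U x q'' := h4
      refine ⟨q', q'', s, w s, Cst.single ?_ ?_, ?_, h3.2.2, h3.2.1.1, lt_of_not_ge h4⟩
      · exact ⟨hp.target, by omega, by omega⟩
      refine rtg_mono ?_ h1
      rintro y z ⟨hy, hz, ⟨a1, a2, a3⟩, ⟨b1, b2, b3⟩, ha⟩
      exact ⟨⟨a1, hy, by omega⟩, ⟨b1, hz, by omega⟩, ha⟩
      have := hws.2
      omega

end Host
end PCR

set_option linter.all false
open scoped BigOperators

namespace PCR
open Relation
namespace Host
variable {X ι : Type} {H : Host X ι} {w : ι → ℕ}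

structure Lev (H : Host X ι) (w : ι → ℕ) (τ : ℕ) (U U' : Set X) (x : X) (a : ℕ) : Prop where
  conn : ∀ z ∈ U, H.Rch U x z
  sub : U' ⊆ U
  lo : ∀ z ∈ U', a ≤ H.FF w U x z
  hi : ∀ z ∈ U', H.FF w U x z < a + τ
  closed : 0 < a → ∀ z ∈ U', ∀ s z', H.adj s z z' → z' ∈ U → a ≤ H.FF w U x z' →
    H.FF w U x z' < a + τ → z' ∈ U'

theorem Cst.restrict {Y U' : Set X} {p q : X} {n : ℕ} (h : H.Cst w Y p q n) (hp : p ∈ U')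
    (hcl : ∀ z ∈ U', ∀ s z', H.adj s z z' → z' ∈ Y → z' ∈ U') : H.Cst w U' p q n := by
  induction h with
  | refl _ => exact Cst.refl hp
  | step q r n s h1 hm ih =>
    refine Cst.step _ _ _ s ih ?_
    have hq := ih.target
    unfold Mv at hm
    induction hm with
    | refl => exact ReflTransGen.refl
    | @tail y z hy hst ih2 =>
      have hyU : y ∈ U' := Mv.target ih2 hq
      exact ih2.tail ⟨hyU, hcl _ hyU _ _ hst.2.2 hst.2.1, hst.2.2⟩

theorem phaseOne {τ : ℕ} (hw : ∀ s, 0 < w s ∧ w s < τ) {U U' : Set X} {x : X} {a : ℕ}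
    (L : Lev H w τ U U' x a) (ha : 0 < a) {v : X} (hv : v ∈ U') :
    ∃ q' q s, q' ∈ H.NN w U' v (2 * τ) ∧ H.adj s q' q ∧ q ∈ U ∧ H.FF w U x q < a ∧
      a ≤ H.FF w U x q + τ := by
  have h1 := L.lo v hv
  have h2 := L.hi v hv
  obtain ⟨q', q, s, n, hc, hn, hadj, hq, hF⟩ := lemE τ hw a ha _ v (L.conn v (L.sub hv)) rfl h1
  have hq' := hc.target
  have hc' : H.Cst w U' v q' n := hc.restrict hv (by
    intro z hz s z' hzz hz'
    have := hz'.2.2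
    exact L.closed ha z hz s z' hzz hz'.1 hz'.2.1 (by omega))
  refine ⟨q', q, s, ⟨n, by omega, hc'⟩, hadj, hq, hF, ?_⟩
  have := FF_adj (w := w) (L.conn q hq) hq'.1 (H.symm _ _ _ hadj)
  have := hq'.2.1
  have := (hw s).2
  omega

theorem adjN {τ : ℕ} (hw : ∀ s, 0 < w s ∧ w s < τ) {p q : X} {s : ι} (h : H.adj s p q) :
    q ∈ H.NN w Set.univ p τ :=
  ⟨w s, (hw s).2.le, Cst.single trivial (ReflTransGen.single ⟨trivial, trivial, h⟩)⟩

theorem tentacle {τ : ℕ} (hw : ∀ s, 0 < w s ∧ w s < τ) {U0 U1 U2 U3 : Set X} {x0 x1 x2 : X}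
    {a0 a1 a2 : ℕ} (L0 : Lev H w τ U0 U1 x0 a0) (L1 : Lev H w τ U1 U2 x1 a1)
    (L2 : Lev H w τ U2 U3 x2 a2) (h0 : 9 * τ ≤ a0) (h1 : 9 * τ ≤ a1) (h2 : 9 * τ ≤ a2)
    (hτ : 0 < τ) {v : X} (hv : v ∈ U3) (R0 R1 R2 : Set X)
    (hR0 : R0 = {z | z ∈ U0 ∧ H.FF w U0 x0 z < a0})
    (hR1 : R1 = {z | z ∈ U1 ∧ H.FF w U1 x1 z < a1 - 8 * τ})
    (hR2 : R2 = {z | z ∈ U2 ∧ H.FF w U2 x2 z < a2 - 8 * τ}) :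
    ∃ A0 A1 A2 : Set X,
      (H.Rch (A0 ∪ R0) x0 v ∧ H.Rch (A1 ∪ R1) x1 v ∧ H.Rch (A2 ∪ R2) x2 v) ∧
      (A0 ⊆ U1 ∧ A1 ⊆ U1 ∧ A2 ⊆ U2) ∧
      (A0 ⊆ H.NN w Set.univ v (20 * τ) ∧ A1 ⊆ H.NN w Set.univ v (20 * τ) ∧
        A2 ⊆ H.NN w Set.univ v (20 * τ)) ∧
      (∀ z ∈ A0, z ∉ R1 ∧ z ∉ R2) ∧ (∀ z ∈ A1, z ∉ R2) := by
  have hw0 : ∀ s, 0 < w s := fun s => (hw s).1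
  have hv2 := L2.sub hv
  have f1 := L2.lo v hv
  have f2 := L2.hi v hv
  -- level two
  obtain ⟨q2', q2, s2, n2, hc2, hn2, hadj2, hq2, hF2⟩ :=
    lemE τ hw (a2 - 8 * τ) (by omega) _ v (L2.conn v hv2) rfl (by omega)
  -- part A
  obtain ⟨w1, r1, t1, m1, hcA, hmA, -, -, -⟩ :=
    lemE τ hw (a2 - 4 * τ) (by omega) _ v (L2.conn v hv2) rfl (by omega)
  have hw1 := hcA.target
  -- part B
  obtain ⟨q1', q1, s1, hB, hadj1, hq1, hF1, hF1'⟩ := phaseOne hw L1 (by omega) hw1.1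
  -- part C
  obtain ⟨c', c, s3, n3, hcC, hnC, hadjC, hqC, hFC⟩ :=
    lemE τ hw (a1 - 8 * τ) (by omega) _ q1 (L1.conn q1 hq1) rfl (by omega)
  obtain ⟨w0, d, s4, n4, hcD, hnD, hadjD, hqD, hFD⟩ :=
    lemE τ hw (a1 - 4 * τ) (by omega) _ q1 (L1.conn q1 hq1) rfl (by omega)
  have hw0' := hcD.target
  have hFw0 : H.FF w U1 x1 w0 < a1 - 3 * τ := by
    have := FF_adj (w := w) (L1.conn d hqD) hw0'.1 (H.symm _ _ _ hadjD)
    have := (hw s4).2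
    omega
  obtain ⟨q0', q0, s0, hE, hadj0, hq0, hF0, -⟩ := phaseOne hw L0 (by omega) hw0'.1
  let Y2 : Set X := {y | y ∈ U2 ∧ a2 - 8 * τ ≤ H.FF w U2 x2 y ∧ H.FF w U2 x2 y ≤ H.FF w U2 x2 v}
  let YA : Set X := {y | y ∈ U2 ∧ a2 - 4 * τ ≤ H.FF w U2 x2 y ∧ H.FF w U2 x2 y ≤ H.FF w U2 x2 v}
  let YC : Set X := {y | y ∈ U1 ∧ a1 - 8 * τ ≤ H.FF w U1 x1 y ∧ H.FF w U1 x1 y ≤ H.FF w U1 x1 q1}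
  let YD : Set X := {y | y ∈ U1 ∧ a1 - 4 * τ ≤ H.FF w U1 x1 y ∧ H.FF w U1 x1 y ≤ H.FF w U1 x1 q1}
  have memY : ∀ {Y : Set X} {p z : X} {n : ℕ}, z ∈ H.NN w Y p n → z ∈ Y := by
    rintro Y p z n ⟨m, _, h⟩; exact h.target
  -- distances
  have dA : ∀ z ∈ H.NN w YA v (6 * τ), z ∈ H.NN w Set.univ v (6 * τ) := fun z hz =>
    NN_mono (Set.subset_univ _) le_rfl hz
  have dw1 : w1 ∈ H.NN w YA v (6 * τ) := ⟨m1, by omega, hcA⟩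
  have dB : ∀ z ∈ H.NN w U2 w1 (2 * τ), z ∈ H.NN w Set.univ v (6 * τ + 2 * τ) := fun z hz =>
    NN_trans (dA _ dw1) (NN_mono (Set.subset_univ _) le_rfl hz)
  have dq1 : q1 ∈ H.NN w Set.univ v (6 * τ + 2 * τ + τ) := NN_trans (dB _ hB) (adjN hw hadj1)
  have dC : ∀ z ∈ H.NN w YC q1 (9 * τ), z ∈ H.NN w Set.univ v (6 * τ + 2 * τ + τ + 9 * τ) := fun z hz =>
    NN_trans dq1 (NN_mono (Set.subset_univ _) le_rfl hz)
  have dD : ∀ z ∈ H.NN w YD q1 (5 * τ), z ∈ H.NN w Set.univ v (6 * τ + 2 * τ + τ + 5 * τ) := fun z hz =>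
    NN_trans dq1 (NN_mono (Set.subset_univ _) le_rfl hz)
  have dw0 : w0 ∈ H.NN w YD q1 (5 * τ) := ⟨n4, by omega, hcD⟩
  have dE : ∀ z ∈ H.NN w U1 w0 (2 * τ), z ∈ H.NN w Set.univ v (6 * τ + 2 * τ + τ + 5 * τ + 2 * τ) :=
    fun z hz => NN_trans (dD _ dw0) (NN_mono (Set.subset_univ _) le_rfl hz)
  have dc' : c' ∈ H.NN w YC q1 (9 * τ) := ⟨n3, by omega, hcC⟩
  have dq2' : q2' ∈ H.NN w Y2 v (10 * τ) := ⟨n2, by omega, hc2⟩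
  have big : ∀ n ≤ 20 * τ, H.NN w Set.univ v n ⊆ H.NN w Set.univ v (20 * τ) := fun n hn =>
    NN_mono le_rfl hn
  -- F estimates
  have eB : ∀ z ∈ H.NN w U2 w1 (2 * τ), a2 - 6 * τ ≤ H.FF w U2 x2 z := by
    rintro z ⟨m, hm, hz⟩
    have := FF_lip (L2.conn z hz.target) hz.symm
    have := hw1.2.1
    omega
  have eE1 : ∀ z ∈ H.NN w U1 w0 (2 * τ), a1 - 6 * τ ≤ H.FF w U1 x1 z := by
    rintro z ⟨m, hm, hz⟩
    have := FF_lip (L1.conn z hz.target) hz.symm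
    have := hw0'.2.1
    omega
  have eE2 : ∀ z ∈ H.NN w U1 w0 (2 * τ), H.FF w U1 x1 z < a1 := by
    rintro z ⟨m, hm, hz⟩
    have := FF_lip (L1.conn w0 hw0'.1) hz
    omega
  refine ⟨H.NN w YA v (6 * τ) ∪ H.NN w U2 w1 (2 * τ) ∪ H.NN w YD q1 (5 * τ) ∪ H.NN w U1 w0 (2 * τ),
    H.NN w YA v (6 * τ) ∪ H.NN w U2 w1 (2 * τ) ∪ H.NN w YC q1 (9 * τ),
    H.NN w Y2 v (10 * τ), ⟨?_, ?_, ?_⟩, ⟨?_, ?_, ?_⟩, ⟨?_, ?_, ?_⟩, ?_, ?_⟩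
  · -- Rch 0
    have r1 := (NN.rch dw1)
    have r2 := (NN.rch hB)
    have r3 := (NN.rch dw0)
    have r4 := (NN.rch hE)
    have hb := ball_conn hw0 _ q0 (L0.conn q0 hq0) rfl
    set A := H.NN w YA v (6 * τ) ∪ H.NN w U2 w1 (2 * τ) ∪ H.NN w YD q1 (5 * τ) ∪ H.NN w U1 w0 (2 * τ) with hA
    have s1 : H.Rch (A ∪ R0) v w1 := r1.mono (fun z hz => Or.inl (Or.inl (Or.inl (Or.inl hz))))
    have s2 : H.Rch (A ∪ R0) w1 q1' := r2.mono (fun z hz => Or.inl (Or.inl (Or.inl (Or.inr hz))))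
    have s3 : H.Rch (A ∪ R0) q1 w0 := r3.mono (fun z hz => Or.inl (Or.inl (Or.inr hz)))
    have s4 : H.Rch (A ∪ R0) w0 q0' := r4.mono (fun z hz => Or.inl (Or.inr hz))
    have s5 : H.Rch (A ∪ R0) x0 q0 := hb.mono (by
      rintro z ⟨hz1, hz2⟩; right; rw [hR0]; exact ⟨hz1, by omega⟩)
    exact ((((((s1.trans s2).tail s3.1 _ hadj1).trans s3).trans s4).tail s5.target _ hadj0).trans s5.symm).symm
  · have r1 := (NN.rch dw1)
    have r2 := (NN.rch hB)
    have r3 := (NN.rch dc')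
    have hb := ball_conn hw0 _ c (L1.conn c hqC) rfl
    set A := H.NN w YA v (6 * τ) ∪ H.NN w U2 w1 (2 * τ) ∪ H.NN w YC q1 (9 * τ) with hA
    have s1 : H.Rch (A ∪ R1) v w1 := r1.mono (fun z hz => Or.inl (Or.inl (Or.inl hz)))
    have s2 : H.Rch (A ∪ R1) w1 q1' := r2.mono (fun z hz => Or.inl (Or.inl (Or.inr hz)))
    have s3 : H.Rch (A ∪ R1) q1 c' := r3.mono (fun z hz => Or.inl (Or.inr hz))
    have s5 : H.Rch (A ∪ R1) x1 c := hb.mono (by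
      rintro z ⟨hz1, hz2⟩; right; rw [hR1]; exact ⟨hz1, by omega⟩)
    exact (((((s1.trans s2).tail s3.1 _ hadj1).trans s3).tail s5.target _ hadjC).trans s5.symm).symm
  · have r1 := (NN.rch dq2')
    have hb := ball_conn hw0 _ q2 (L2.conn q2 hq2) rfl
    have s1 : H.Rch (H.NN w Y2 v (10 * τ) ∪ R2) v q2' := r1.mono (fun z hz => Or.inl hz)
    have s5 : H.Rch (H.NN w Y2 v (10 * τ) ∪ R2) x2 q2 := hb.mono (by
      rintro z ⟨hz1, hz2⟩; right; rw [hR2]; exact ⟨hz1, by omega⟩)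
    exact ((s1.tail s5.target _ hadj2).trans s5.symm).symm
  · rintro z (((hz | hz) | hz) | hz)
    · exact L1.sub (memY hz).1
    · exact L1.sub (memY hz)
    · exact (memY hz).1
    · exact memY hz
  · rintro z ((hz | hz) | hz)
    · exact L1.sub (memY hz).1
    · exact L1.sub (memY hz)
    · exact (memY hz).1
  · intro z hz; exact (memY hz).1
  · rintro z (((hz | hz) | hz) | hz)
    · exact big _ (by omega) (dA z hz)
    · exact big _ (by omega) (dB z hz)
    · exact big _ (by omega) (dD z hz)
    · exact big _ (by omega) (dE z hz)
  · rintro z ((hz | hz) | hz)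
    · exact big _ (by omega) (dA z hz)
    · exact big _ (by omega) (dB z hz)
    · exact big _ (by omega) (dC z hz)
  · intro z hz
    exact NN_mono (Set.subset_univ _) (by omega) hz
  · rw [hR1, hR2]
    rintro z (((hz | hz) | hz) | hz)
    · have h5 := memY hz
      have := L1.lo z h5.1
      have := h5.2.1
      exact ⟨fun h => by have := h.2; omega, fun h => by have := h.2; omega⟩
    · have := L1.lo z (memY hz)
      have := eB z hz
      exact ⟨fun h => by have := h.2; omega, fun h => by have := h.2; omega⟩
    · have h5 := memY hz
      have h6 := h5.2.1
      have h7 := h5.2.2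
      exact ⟨fun h => by have := h.2; omega, fun h => by have := L1.lo z h.1; omega⟩
    · have h6 := eE1 z hz
      have h7 := eE2 z hz
      exact ⟨fun h => by have := h.2; omega, fun h => by have := L1.lo z h.1; omega⟩
  · rw [hR2]
    rintro z ((hz | hz) | hz) h
    · have := (memY hz).2.1
      have := h.2
      omega
    · have := eB z hz
      have := h.2
      omega
    · have h7 := (memY hz).2.2
      have := L1.lo z h.1
      omega

theorem three_far {τ : ℕ} (hw : ∀ s, 0 < w s ∧ w s < τ) {U0 U1 U2 U3 : Set X} {x0 x1 x2 : X}
    {a0 a1 a2 : ℕ} (L0 : Lev H w τ U0 U1 x0 a0) (L1 : Lev H w τ U1 U2 x1 a1)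
    (L2 : Lev H w τ U2 U3 x2 a2) (h0 : 9 * τ ≤ a0) (h1 : 9 * τ ≤ a1) (h2 : 9 * τ ≤ a2)
    (hτ : 0 < τ) (v : Fin 3 → X) (hv : ∀ j, v j ∈ U3)
    (hfar : ∀ j l, j ≠ l → v l ∉ H.NN w Set.univ (v j) (60 * τ)) : False := by
  obtain ⟨R0, hR0⟩ : ∃ R : Set X, R = {z | z ∈ U0 ∧ H.FF w U0 x0 z < a0} := ⟨_, rfl⟩
  obtain ⟨R1, hR1⟩ : ∃ R : Set X, R = {z | z ∈ U1 ∧ H.FF w U1 x1 z < a1 - 8 * τ} := ⟨_, rfl⟩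
  obtain ⟨R2, hR2⟩ : ∃ R : Set X, R = {z | z ∈ U2 ∧ H.FF w U2 x2 z < a2 - 8 * τ} := ⟨_, rfl⟩
  have T := fun j => tentacle hw L0 L1 L2 h0 h1 h2 hτ (hv j) R0 R1 R2 hR0 hR1 hR2
  choose A0 A1 A2 hT using T
  have nU0 : ∀ z ∈ R0, z ∉ U1 := by
    rw [hR0]; intro z hz hz'
    have := hz.2; have := L0.lo z hz'; omega
  have nU1 : ∀ z ∈ R1, z ∉ U2 := by
    rw [hR1]; intro z hz hz'
    have := hz.2; have := L1.lo z hz'; omega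
  have sR1 : ∀ z ∈ R1, z ∈ U1 := by rw [hR1]; intro z hz; exact hz.1
  have sR2 : ∀ z ∈ R2, z ∈ U2 := by rw [hR2]; intro z hz; exact hz.1
  have far : ∀ j l, j ≠ l → ∀ z, z ∈ H.NN w Set.univ (v j) (20 * τ) → z ∈ H.NN w Set.univ (v l) (20 * τ) → False := by
    intro j l hjl z hz1 hz2
    exact hfar j l hjl (NN_mono le_rfl (by omega) (NN_trans hz1 (NN_symm hz2)))
  have d01 : ∀ j l, j ≠ l → ∀ z, z ∈ A0 j ∪ R0 → z ∈ A1 l ∪ R1 → False := by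
    intro j l hjl z hz hz'
    obtain ⟨-, ⟨hj1, hj2, hj3⟩, ⟨hj4, hj5, hj6⟩, hj7, hj8⟩ := hT j
    obtain ⟨-, ⟨hl1, hl2, hl3⟩, ⟨hl4, hl5, hl6⟩, hl7, hl8⟩ := hT l
    rcases hz with hz | hz <;> rcases hz' with hz' | hz'
    · exact far j l hjl z (hj4 hz) (hl5 hz')
    · exact (hj7 z hz).1 hz'
    · exact nU0 z hz (hl2 hz')
    · exact nU0 z hz (sR1 z hz')
  have d02 : ∀ j l, j ≠ l → ∀ z, z ∈ A0 j ∪ R0 → z ∈ A2 l ∪ R2 → False := by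
    intro j l hjl z hz hz'
    obtain ⟨-, ⟨hj1, hj2, hj3⟩, ⟨hj4, hj5, hj6⟩, hj7, hj8⟩ := hT j
    obtain ⟨-, ⟨hl1, hl2, hl3⟩, ⟨hl4, hl5, hl6⟩, hl7, hl8⟩ := hT l
    rcases hz with hz | hz <;> rcases hz' with hz' | hz'
    · exact far j l hjl z (hj4 hz) (hl6 hz')
    · exact (hj7 z hz).2 hz'
    · exact nU0 z hz (L1.sub (hl3 hz'))
    · exact nU0 z hz (L1.sub (sR2 z hz'))
  have d12 : ∀ j l, j ≠ l → ∀ z, z ∈ A1 j ∪ R1 → z ∈ A2 l ∪ R2 → False := by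
    intro j l hjl z hz hz'
    obtain ⟨-, ⟨hj1, hj2, hj3⟩, ⟨hj4, hj5, hj6⟩, hj7, hj8⟩ := hT j
    obtain ⟨-, ⟨hl1, hl2, hl3⟩, ⟨hl4, hl5, hl6⟩, hl7, hl8⟩ := hT l
    rcases hz with hz | hz <;> rcases hz' with hz' | hz'
    · exact far j l hjl z (hj5 hz) (hl6 hz')
    · exact hj8 z hz hz'
    · exact nU1 z hz (hl3 hz')
    · exact nU1 z hz (sR2 z hz')
  obtain ⟨i, j, k, l, hik, hjl, z, hz1, hz2⟩ := H.h33 ![x0, x1, x2] v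
    (fun i j => ![A0 j ∪ R0, A1 j ∪ R1, A2 j ∪ R2] i) (by
      intro i j
      obtain ⟨⟨r0, r1, r2⟩, -⟩ := hT j
      fin_cases i
      · exact r0
      · exact r1
      · exact r2)
  fin_cases i <;> fin_cases k
  · exact hik rfl
  · exact d01 j l hjl z hz1 hz2
  · exact d02 j l hjl z hz1 hz2
  · exact d01 l j hjl.symm z hz2 hz1
  · exact hik rfl
  · exact d12 j l hjl z hz1 hz2
  · exact d02 l j hjl.symm z hz2 hz1
  · exact d12 l j hjl.symm z hz2 hz1
  · exact hik rfl

theorem diam_bound {τ : ℕ} (hw : ∀ s, 0 < w s ∧ w s < τ) {U0 U1 U2 U3 : Set X} {x0 x1 x2 : X}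
    {a0 a1 a2 : ℕ} (L0 : Lev H w τ U0 U1 x0 a0) (L1 : Lev H w τ U1 U2 x1 a1)
    (L2 : Lev H w τ U2 U3 x2 a2) (hτ : 0 < τ) (p q : X) (hp : p ∈ U3) (hpq : H.Rch U3 p q) :
    q ∈ H.NN w Set.univ p (200 * τ) := by
  by_contra hcon
  have small : ∀ {U U' : Set X} {x : X} {a : ℕ}, Lev H w τ U U' x a → p ∈ U' → q ∈ U' →
      9 * τ ≤ a := by
    intro U U' x a L hp hq
    by_contra ha
    apply hcon
    have h1 := FF_spec (w := w) (L.conn p (L.sub hp))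
    have h2 := FF_spec (w := w) (L.conn q (L.sub hq))
    have := L.hi p hp
    have := L.hi q hq
    exact ⟨_, by omega, (h1.symm.trans h2).mono (Set.subset_univ _)⟩
  have hq := hpq.target
  have h2 := small L2 hp hq
  have h1 := small L1 (L2.sub hp) (L2.sub hq)
  have h0 := small L0 (L1.sub (L2.sub hp)) (L1.sub (L2.sub hq))
  obtain ⟨m', m, hm1, hm2, hm3, hm4⟩ := first_hit (fun z => z ∈ H.NN w Set.univ p (60 * τ)) hpq.2
    ⟨0, by omega, Cst.refl trivial⟩ (fun h => hcon (NN_mono le_rfl (by omega) h))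
  obtain ⟨hmU, s, hs⟩ := hm3
  have hm5 : m ∈ H.NN w Set.univ p (60 * τ + τ) := NN_trans hm2 (adjN hw hs)
  have hm6 : q ∉ H.NN w Set.univ m (60 * τ) := fun h =>
    hcon (NN_mono le_rfl (by omega) (NN_trans hm5 h))
  have hm7 : q ∉ H.NN w Set.univ p (60 * τ) := fun h => hcon (NN_mono le_rfl (by omega) h)
  refine three_far hw L0 L1 L2 h0 h1 h2 hτ ![p, m, q] ?_ ?_
  · intro j; fin_cases j
    · exact hp
    · exact hmU
    · exact hq
  · intro j l hjl
    fin_cases j <;> fin_cases l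
    · exact absurd rfl hjl
    · exact hm4
    · exact hm7
    · exact fun h => hm4 (NN_symm h)
    · exact absurd rfl hjl
    · exact hm6
    · exact fun h => hm7 (NN_symm h)
    · exact fun h => hm6 (NN_symm h)
    · exact absurd rfl hjl

end Host
end PCR

set_option linter.all false
open scoped BigOperators

namespace PCR
open Relation
namespace Host
variable {X ι : Type} {H : Host X ι} {w : ι → ℕ}

structure Part (H : Host X ι) where
  cls : X → Set X
  self : ∀ p, p ∈ cls p
  eq : ∀ p q, q ∈ cls p → cls q = cls p
  conn : ∀ p q, q ∈ cls p → H.Rch (cls p) p q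

def part0 (H : Host X ι) : Part H where
  cls p := {q | H.Rch Set.univ p q}
  self p := Rch.refl trivial
  eq p q h := by
    ext z
    exact ⟨fun hz => Rch.trans h hz, fun hz => Rch.trans (Rch.symm h) hz⟩
  conn p q h := by
    have : ∀ b, ReflTransGen (fun x y => y ∈ Set.univ ∧ ∃ s, H.adj s x y) p b →
        H.Rch {q | H.Rch Set.univ p q} p b := by
      intro b hb
      induction hb with
      | refl => exact Rch.refl (Rch.refl trivial)
      | tail h1 h2 ih =>
        obtain ⟨_, s, hs⟩ := h2
        exact ih.tail (Rch.tail ⟨trivial, h1⟩ trivial s hs) s hs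
    exact this q h.2

/-- components of a set-valued labelling -/
def refine (P : Part H) (blk : X → ℕ) : Part H where
  cls p := {q | H.Rch {z | z ∈ P.cls p ∧ blk z = blk p} p q}
  self p := Rch.refl ⟨P.self p, rfl⟩
  eq p q h := by
    have h1 : q ∈ {z | z ∈ P.cls p ∧ blk z = blk p} := Rch.target h
    have h2 : {z | z ∈ P.cls q ∧ blk z = blk q} = {z | z ∈ P.cls p ∧ blk z = blk p} := by
      rw [P.eq p q h1.1, h1.2]
    ext z
    show H.Rch _ q z ↔ H.Rch _ p z
    rw [h2]
    exact ⟨fun hz => Rch.trans h hz, fun hz => Rch.trans (Rch.symm h) hz⟩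
  conn p q h := by
    have : ∀ b, ReflTransGen (fun x y => y ∈ {z | z ∈ P.cls p ∧ blk z = blk p} ∧ ∃ s, H.adj s x y) p b →
        H.Rch {q | H.Rch {z | z ∈ P.cls p ∧ blk z = blk p} p q} p b := by
      intro b hb
      induction hb with
      | refl => exact Rch.refl (Rch.refl ⟨P.self p, rfl⟩)
      | tail h1 h2 ih =>
        obtain ⟨h3, s, hs⟩ := h2
        exact ih.tail (Rch.tail ⟨⟨P.self p, rfl⟩, h1⟩ h3 s hs) s hs
    exact this q h.2

theorem refine_sub (P : Part H) (blk : X → ℕ) (p : X) : ∀ z ∈ (refine P blk).cls p,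
    z ∈ P.cls p ∧ blk z = blk p := fun z hz =>
  Rch.target (Y := {z | z ∈ P.cls p ∧ blk z = blk p}) hz

open Classical in
noncomputable def rt (x0 : X) (U : Set X) : X := if h : U.Nonempty then h.choose else x0

theorem rt_mem (x0 : X) {U : Set X} (h : U.Nonempty) : rt x0 U ∈ U := by
  unfold rt; rw [dif_pos h]; exact h.choose_spec

noncomputable def PF (w : ι → ℕ) (P : Part H) (z : X) : ℕ := H.FF w (P.cls z) (rt z (P.cls z)) z

theorem rt_indep (x0 x1 : X) {U : Set X} (h : U.Nonempty) : rt x0 U = rt x1 U := by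
  unfold rt; rw [dif_pos h, dif_pos h]

theorem PF_eq (w : ι → ℕ) (P : Part H) (p z : X) (h : z ∈ P.cls p) :
    PF w P z = H.FF w (P.cls p) (rt p (P.cls p)) z := by
  unfold PF
  rw [P.eq p z h, rt_indep z p ⟨z, h⟩]

theorem root_conn (P : Part H) (p z : X) (h : z ∈ P.cls p) : H.Rch (P.cls p) (rt p (P.cls p)) z :=
  (P.conn p _ (rt_mem p ⟨z, h⟩)).symm.trans (P.conn p z h)

noncomputable def blk (w : ι → ℕ) (τ θ : ℕ) (P : Part H) (z : X) : ℕ := (PF w P z + θ) / τ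

theorem lev_refine {τ : ℕ} (hτ : 0 < τ) (θ : ℕ) (P : Part H) (p : X) :
    ∃ a, Lev H w τ (P.cls p) ((refine P (blk w τ θ P)).cls p) (rt p (P.cls p)) a := by
  have sub := refine_sub P (blk w τ θ P) p
  have key : ∀ z ∈ P.cls p, (blk w τ θ P z = blk w τ θ P p ↔
      blk w τ θ P p * τ ≤ H.FF w (P.cls p) (rt p (P.cls p)) z + θ ∧
       H.FF w (P.cls p) (rt p (P.cls p)) z + θ < (blk w τ θ P p + 1) * τ) := by
    intro z hz
    have e : blk w τ θ P z = (H.FF w (P.cls p) (rt p (P.cls p)) z + θ) / τ := by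
      unfold blk; rw [PF_eq w P p z hz]
    rw [e]
    constructor
    · intro h
      rw [← h]
      exact ⟨Nat.div_mul_le_self _ _, Nat.lt_mul_of_div_lt (Nat.lt_succ_self _) hτ⟩
    · rintro ⟨h1, h2⟩
      exact le_antisymm (Nat.lt_succ_iff.1 ((Nat.div_lt_iff_lt_mul hτ).2 h2))
        ((Nat.le_div_iff_mul_le hτ).2 h1)
  set B := blk w τ θ P p with hB
  have hB1 : (B + 1) * τ = B * τ + τ := by ring
  refine ⟨B * τ - θ, ⟨fun z hz => root_conn P p z hz, fun z hz => (sub z hz).1, ?_, ?_, ?_⟩⟩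
  · intro z hz
    have := (key z (sub z hz).1).1 (sub z hz).2
    omega
  · intro z hz
    have := (key z (sub z hz).1).1 (sub z hz).2
    omega
  · intro ha z hz s z' hs hz' h1 h2
    have hb : blk w τ θ P z' = B := (key z' hz').2 (by omega)
    exact Rch.tail hz ⟨hz', hb⟩ s hs

/-- a string lying in a single class -/
def Inn (P : Part H) (s : ι) : Prop := ∀ p ∈ H.reg s, ∀ q ∈ H.reg s, q ∈ P.cls p

theorem reg_mv (s : ι) {Y : Set X} (hY : H.reg s ⊆ Y) (p q : X) (hp : p ∈ H.reg s) (hq : q ∈ H.reg s) :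
    H.Mv s Y p q :=
  rtg_mono (fun x y h => ⟨hY (H.mem s _ _ h), hY (H.mem' s _ _ h), h⟩) (H.conn s p q hp hq)

theorem inn_refine (P : Part H) (b : X → ℕ) (s : ι) (h : Inn P s)
    (hb : ∀ p ∈ H.reg s, ∀ q ∈ H.reg s, b q = b p) : Inn (refine P b) s := by
  intro p hp q hq
  refine (reg_mv s (fun z hz => ?_) p q hp hq).rch ⟨P.self p, rfl⟩
  exact ⟨h p hp z hz, hb p hp z hz⟩

theorem PF_reg (P : Part H) (s : ι) (h : Inn P s) (p q : X) (hp : p ∈ H.reg s) (hq : q ∈ H.reg s) :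
    PF w P q ≤ PF w P p + w s := by
  rw [PF_eq w P p q (h p hp q hq), PF_eq w P p p (P.self p)]
  exact FF_lip (root_conn P p p (P.self p)) (Cst.single (P.self p)
    (reg_mv s (fun z hz => h p hp z hz) p q hp hq))

theorem count_bad (τ m k : ℕ) (hk : k < τ) :
    ((Finset.range τ).filter (fun θ => (m + θ) / τ ≠ (m + k + θ) / τ)).card ≤ k := by
  have hτ : 0 < τ := by omega
  have : ((Finset.range τ).filter (fun θ => (m + θ) / τ ≠ (m + k + θ) / τ)).card
      ≤ (Finset.Ico (τ - k) τ).card := by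
    apply Finset.card_le_card_of_injOn (fun θ => (m + θ) % τ)
    · intro θ hθ
      simp only [Finset.coe_filter, Finset.mem_range, Set.mem_ofPred_eq] at hθ
      simp only [Finset.coe_Ico, Set.mem_Ico]
      have h1 := Nat.mod_lt (m + θ) hτ
      refine ⟨?_, h1⟩
      by_contra hlt
      apply hθ.2
      have h2 := Nat.div_add_mod (m + θ) τ
      have h3 : m + k + θ = (m + θ) % τ + k + τ * ((m + θ) / τ) := by omega
      have h4 : ((m + θ) % τ + k) / τ = 0 := Nat.div_eq_of_lt (by omega)
      have h5 : (m + k + θ) / τ = ((m + θ) % τ + k + τ * ((m + θ) / τ)) / τ := by rw [← h3]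
      rw [h5, Nat.add_mul_div_left _ _ hτ, h4, zero_add]
    · intro θ hθ θ' hθ' he
      simp only [Finset.coe_filter, Finset.mem_range, Set.mem_ofPred_eq] at hθ hθ'
      have : (m + θ) ≡ (m + θ') [MOD τ] := he
      have := Nat.ModEq.add_left_cancel' m this
      exact Nat.ModEq.eq_of_lt_of_lt this hθ.1 hθ'.1
  rw [Nat.card_Ico] at this
  omega

open Classical in
theorem refine_step [Fintype ι] {τ : ℕ} (hτ : 0 < τ) (hw : ∀ s, 0 < w s ∧ w s < τ) (P : Part H)
    (Z : Finset ι) (hZ : ∀ s ∉ Z, Inn P s) :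
    ∃ θ, ∃ Z' : Finset ι, τ * Z'.card ≤ τ * Z.card + ∑ s, w s ∧
      ∀ s ∉ Z', Inn (refine P (blk w τ θ P)) s := by
  let bad : ℕ → ι → Prop := fun θ s => Inn P s ∧ ¬ ∀ p ∈ H.reg s, ∀ q ∈ H.reg s,
    blk w τ θ P q = blk w τ θ P p
  have hbad : ∀ s, ((Finset.range τ).filter (fun θ => bad θ s)).card ≤ w s := by
    intro s
    by_cases hs : Inn P s ∧ (H.reg s).Nonempty
    · obtain ⟨hs, hne⟩ := hs
      have : ∃ p0 ∈ H.reg s, ∀ q ∈ H.reg s, PF w P p0 ≤ PF w P q := by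
        have hne' : (PF w P '' H.reg s).Nonempty := hne.image _
        obtain ⟨p0, hp0, he⟩ := Nat.sInf_mem hne'
        exact ⟨p0, hp0, fun q hq => he ▸ Nat.sInf_le ⟨q, hq, rfl⟩⟩
      obtain ⟨p0, hp0, hmin⟩ := this
      refine le_trans (Finset.card_le_card ?_) (count_bad τ (PF w P p0) (w s) (hw s).2)
      intro θ hθ
      simp only [Finset.mem_filter] at hθ ⊢
      refine ⟨hθ.1, fun he => hθ.2.2 ?_⟩
      have : ∀ p ∈ H.reg s, blk w τ θ P p = (PF w P p0 + θ) / τ := by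
        intro p hp
        apply le_antisymm
        · rw [he]
          exact Nat.div_le_div_right (by have := PF_reg (w := w) P s hs p0 p hp0 hp; omega)
        · exact Nat.div_le_div_right (by have := hmin p hp; omega)
      intro p hp q hq
      rw [this p hp, this q hq]
    · rw [Finset.filter_false_of_mem]
      · simp
      · intro θ _ hb
        apply hs
        refine ⟨hb.1, ?_⟩
        by_contra hne
        apply hb.2
        intro p hp
        exact absurd ⟨p, hp⟩ hne
  have hsum : ∑ θ ∈ Finset.range τ, (Finset.univ.filter (fun s => bad θ s)).card ≤ ∑ s, w s := by
    have : ∑ θ ∈ Finset.range τ, (Finset.univ.filter (fun s => bad θ s)).card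
        = ∑ s, ((Finset.range τ).filter (fun θ => bad θ s)).card := by
      simp_rw [Finset.card_filter]
      exact Finset.sum_comm
    rw [this]
    exact Finset.sum_le_sum fun s _ => hbad s
  have : ∃ θ ∈ Finset.range τ, τ * (Finset.univ.filter (fun s => bad θ s)).card ≤ ∑ s, w s := by
    by_contra hcon
    push Not at hcon
    have h1 : ∑ θ ∈ Finset.range τ, ∑ s, w s < ∑ θ ∈ Finset.range τ,
        τ * (Finset.univ.filter (fun s => bad θ s)).card :=
      Finset.sum_lt_sum_of_nonempty ⟨0, by simpa using hτ⟩ hcon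
    rw [Finset.sum_const, Finset.card_range, ← Finset.mul_sum, smul_eq_mul] at h1
    have := Nat.mul_le_mul_left τ hsum
    omega
  obtain ⟨θ, _, hθ⟩ := this
  refine ⟨θ, Z ∪ Finset.univ.filter (fun s => bad θ s), ?_, ?_⟩
  · have := Finset.card_union_le Z (Finset.univ.filter (fun s => bad θ s))
    have := Nat.mul_le_mul_left τ this
    rw [mul_add] at this
    omega
  · intro s hs
    simp only [Finset.mem_union, Finset.mem_filter, Finset.mem_univ, true_and, not_or] at hs
    have h1 := hZ s hs.1
    apply inn_refine P _ s h1
    by_contra hb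
    exact hs.2 ⟨h1, hb⟩

theorem KPR [Fintype ι] {τ : ℕ} (hτ : 0 < τ) (hw : ∀ s, 0 < w s ∧ w s < τ) :
    ∃ (P : Part H) (Z : Finset ι), τ * Z.card ≤ 3 * ∑ s, w s ∧ (∀ s ∉ Z, Inn P s) ∧
      ∀ p q, q ∈ P.cls p → q ∈ H.NN w Set.univ p (200 * τ) := by
  obtain ⟨θ0, Z1, hZ1, hI1⟩ := refine_step hτ hw (part0 H) ∅ (by
    intro s _ p hp q hq
    exact (reg_mv s (Set.subset_univ _) p q hp hq).rch trivial)
  set P1 := refine (part0 H) (blk w τ θ0 (part0 H)) with hP1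
  obtain ⟨θ1, Z2, hZ2, hI2⟩ := refine_step hτ hw P1 Z1 hI1
  set P2 := refine P1 (blk w τ θ1 P1) with hP2
  obtain ⟨θ2, Z3, hZ3, hI3⟩ := refine_step hτ hw P2 Z2 hI2
  refine ⟨_, Z3, ?_, hI3, ?_⟩
  · simp only [Finset.card_empty] at hZ1
    omega
  · intro p q hq
    obtain ⟨a0, L0⟩ := lev_refine (w := w) hτ θ0 (part0 H) p
    obtain ⟨a1, L1⟩ := lev_refine (w := w) hτ θ1 P1 p
    obtain ⟨a2, L2⟩ := lev_refine (w := w) hτ θ2 P2 p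
    exact diam_bound hw L0 L1 L2 hτ p q (Part.self _ p) (Part.conn _ p q hq)

end Host
end PCR

set_option linter.all false
open scoped BigOperators

namespace PCR
open Relation

theorem pair_marginal {κ α : Type} [Fintype κ] [DecidableEq κ] [Fintype α] (w : α → ℝ) (hw : ∑ x, w x = 1)
    (a b : κ) (hab : a ≠ b) (g : α → α → ℝ) :
    ∑ f : κ → α, (∏ k, w (f k)) * g (f a) (f b) = ∑ x, ∑ y, w x * w y * g x y := by
  classical
  have key : ∀ x y, ∑ f : κ → α, (∏ k, w (f k)) * ((if f a = x then 1 else 0) * (if f b = y then 1 else 0))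
      = w x * w y := by
    intro x y
    let φ : κ → α → ℝ := fun k z => w z * ((if k = a then (if z = x then 1 else 0) else 1) *
      (if k = b then (if z = y then 1 else 0) else 1))
    have h1 : ∀ f : κ → α, (∏ k, w (f k)) * ((if f a = x then 1 else 0) * (if f b = y then 1 else 0))
        = ∏ k, φ k (f k) := by
      intro f
      simp only [φ, Finset.prod_mul_distrib, Finset.prod_ite_eq', Finset.mem_univ, if_true]
    simp_rw [h1]
    rw [← Fintype.piFinset_univ, ← Finset.prod_univ_sum]
    have h2 : ∀ k, ∑ z, φ k z = (if k = a then w x else 1) * (if k = b then w y else 1) := by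
      intro k
      by_cases ha : k = a
      · subst ha; simp [φ, hab]
      · by_cases hb : k = b
        · subst hb; simp [φ, ha]
        · simp [φ, ha, hb, hw]
    simp_rw [h2]
    rw [Finset.prod_mul_distrib]; simp
  have h3 : ∀ f : κ → α, (∏ k, w (f k)) * g (f a) (f b) = ∑ x, ∑ y,
      ((∏ k, w (f k)) * ((if f a = x then 1 else 0) * (if f b = y then 1 else 0))) * g x y := by
    intro f
    simp
  simp_rw [h3]
  rw [Finset.sum_comm]
  refine Finset.sum_congr rfl fun x _ => ?_
  rw [Finset.sum_comm]
  refine Finset.sum_congr rfl fun y _ => ?_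
  rw [← Finset.sum_mul, key]

theorem sum_prod_one {κ α : Type} [Fintype κ] [Fintype α] [DecidableEq κ] (w : α → ℝ) (hw : ∑ x, w x = 1) :
    ∑ f : κ → α, (∏ k, w (f k)) = 1 := by
  rw [← Fintype.piFinset_univ, ← Finset.prod_univ_sum (fun _ => Finset.univ) (fun _ x => w x)]
  simp [hw]

namespace Host
variable {X ι : Type} (H : Host X ι)

def Conn (S : Finset ι) (p q : X) : Prop := ReflTransGen (fun x y => ∃ s ∈ S, H.adj s x y) p q

def Tch (e f : ι) : Prop := (H.reg e ∩ H.reg f).Nonempty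

theorem Conn.rch {H : Host X ι} {S : Finset ι} {p q : X} (h : H.Conn S p q) (hne : p ≠ q) :
    RchAdj H.adj {z | ∃ s ∈ S, z ∈ H.reg s} p q := by
  constructor
  · rcases h.cases_head with h1 | ⟨c, ⟨s, hs, hc⟩, _⟩
    · exact absurd h1 hne
    · exact ⟨s, hs, H.mem s _ _ hc⟩
  · refine rtg_mono ?_ h
    rintro x y ⟨s, hs, hxy⟩
    exact ⟨⟨s, hs, H.mem' s _ _ hxy⟩, s, hxy⟩

open Classical in
/-- K33 sampling -/
theorem sampling [Fintype ι] {V R : Type} [Fintype V] [Fintype R] (pt : V → X) (hpt : Function.Injective pt)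
    (μ : V → ℝ) (hμ0 : ∀ v, 0 ≤ μ v) (hμ1 : ∑ v, μ v = 1) (hμ : ∀ v, μ v ≤ 1 / 18)
    (σ : R → V → V → Finset ι) (hσ : ∀ r x y, H.Conn (σ r x y) (pt x) (pt y))
    (la : R → ℝ) (hl0 : ∀ r, 0 ≤ la r) (hl1 : ∑ r, la r = 1) (y : ι → ℝ)
    (hy : ∀ e, y e = ∑ r, la r * ∑ u, ∑ v, μ u * μ v * (if e ∈ σ r u v then 1 else 0)) :
    1 / 72 ≤ ∑ e, ∑ f, if H.Tch e f then y e * y f else 0 := by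
  -- indicator functions
  let J : V → V → R → ι → ℝ := fun u v r e => if e ∈ σ r u v then 1 else 0
  let T : ι → ι → ℝ := fun e f => if H.Tch e f then 1 else 0
  have hJ0 : ∀ u v r e, 0 ≤ J u v r e := by intro u v r e; simp only [J]; split_ifs <;> norm_num
  have hT0 : ∀ e f, 0 ≤ T e f := by intro e f; simp only [T]; split_ifs <;> norm_num
  let Q : ℝ := ∑ e, ∑ f, T e f * (y e * y f)
  have hQ : ∑ e, ∑ f, (if H.Tch e f then y e * y f else 0) = Q := by
    refine Finset.sum_congr rfl fun e _ => Finset.sum_congr rfl fun f _ => ?_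
    simp only [T]; split_ifs <;> simp
  rw [hQ]
  let N : (V × V × R) → (V × V × R) → ℝ := fun p q => ∑ e, ∑ f, T e f * (J p.1 p.2.1 p.2.2 e * J q.1 q.2.1 q.2.2 f)
  have hN0 : ∀ p q, 0 ≤ N p q := fun p q => Finset.sum_nonneg fun e _ => Finset.sum_nonneg fun f _ =>
    mul_nonneg (hT0 e f) (mul_nonneg (hJ0 _ _ _ _) (hJ0 _ _ _ _))
  let wt : (Fin 3 → V) → (Fin 3 → V) → (Fin 3 × Fin 3 → R) → ℝ := fun a b r =>
    (∏ k, μ (a k)) * ((∏ k, μ (b k)) * (∏ k, la (r k)))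
  have hwt0 : ∀ a b r, 0 ≤ wt a b r := fun a b r =>
    mul_nonneg (Finset.prod_nonneg fun _ _ => hμ0 _) (mul_nonneg (Finset.prod_nonneg fun _ _ => hμ0 _)
      (Finset.prod_nonneg fun _ _ => hl0 _))
  let I : Finset ((Fin 3 × Fin 3) × (Fin 3 × Fin 3)) := Finset.univ.filter (fun x => x.1.1 ≠ x.2.1 ∧ x.1.2 ≠ x.2.2)
  have hI : I.card = 36 := by simp only [I]; decide
  have hIm : ∀ i j k l, ((i,j),(k,l)) ∈ I ↔ i ≠ k ∧ j ≠ l := by intro i j k l; simp [I]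
  have hN : ∀ p q, N p q = ∑ e, ∑ f, T e f * (J p.1 p.2.1 p.2.2 e * J q.1 q.2.1 q.2.2 f) := fun _ _ => rfl
  have hwt : ∀ a b r, wt a b r = (∏ k, μ (a k)) * ((∏ k, μ (b k)) * (∏ k, la (r k))) := fun _ _ _ => rfl
  have hJ : ∀ u v r e, J u v r e = if e ∈ σ r u v then 1 else 0 := fun _ _ _ _ => rfl
  have hT : ∀ e f, T e f = if H.Tch e f then 1 else 0 := fun _ _ => rfl
  have hQd : Q = ∑ e, ∑ f, T e f * (y e * y f) := rfl
  clear_value I N wt J T Q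
  -- pointwise
  have hpt' : ∀ (a b : Fin 3 → V) (r : Fin 3 × Fin 3 → R), 1 - (∑ x : Fin 3 × Fin 3, if a x.1 = b x.2 then (1:ℝ) else 0) ≤
      ∑ x ∈ I, N (a x.1.1, b x.1.2, r x.1) (a x.2.1, b x.2.2, r x.2) := by
    intro a b r
    by_cases hd : ∀ i j, a i ≠ b j
    · have h0 : (∑ x : Fin 3 × Fin 3, if a x.1 = b x.2 then (1:ℝ) else 0) = 0 := by
        apply Finset.sum_eq_zero; intro x _; rw [if_neg (hd _ _)]
      rw [h0, sub_zero]
      obtain ⟨i, j, k, l, hik, hjl, z, ⟨e, he, hez⟩, ⟨f, hf, hfz⟩⟩ := H.h33 (fun i => pt (a i)) (fun j => pt (b j))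
        (fun i j => {z | ∃ s ∈ σ (r (i,j)) (a i) (b j), z ∈ H.reg s})
        (fun i j => (hσ (r (i,j)) (a i) (b j)).rch (fun h => hd i j (hpt h)))
      have h1 : N (a i, b j, r (i,j)) (a k, b l, r (k,l)) ≤
          ∑ x ∈ I, N (a x.1.1, b x.1.2, r x.1) (a x.2.1, b x.2.2, r x.2) :=
        Finset.single_le_sum (f := fun x : (Fin 3 × Fin 3) × (Fin 3 × Fin 3) =>
          N (a x.1.1, b x.1.2, r x.1) (a x.2.1, b x.2.2, r x.2)) (fun x _ => hN0 _ _)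
          (show ((i,j),(k,l)) ∈ I from (hIm _ _ _ _).2 ⟨hik, hjl⟩)
      refine le_trans ?_ h1
      rw [hN]
      dsimp only
      have h2 : T e f * (J (a i) (b j) (r (i,j)) e * J (a k) (b l) (r (k,l)) f) = 1 := by
        rw [hT, hJ, hJ]
        rw [if_pos he, if_pos hf, if_pos ⟨z, hez, hfz⟩]; norm_num
      rw [← h2]
      refine le_trans (Finset.single_le_sum (f := fun f => T e f * (J (a i) (b j) (r (i,j)) e *
        J (a k) (b l) (r (k,l)) f)) (fun f _ => mul_nonneg (hT0 e f) (mul_nonneg (hJ0 _ _ _ _) (hJ0 _ _ _ _)))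
        (Finset.mem_univ f)) ?_
      exact Finset.single_le_sum (f := fun e => ∑ f, T e f * (J (a i) (b j) (r (i,j)) e *
        J (a k) (b l) (r (k,l)) f)) (fun e _ => Finset.sum_nonneg fun f _ =>
          mul_nonneg (hT0 e f) (mul_nonneg (hJ0 _ _ _ _) (hJ0 _ _ _ _))) (Finset.mem_univ e)
    · push Not at hd
      obtain ⟨i, j, hij⟩ := hd
      have h1 : (1:ℝ) ≤ ∑ x : Fin 3 × Fin 3, if a x.1 = b x.2 then (1:ℝ) else 0 := by
        refine le_trans ?_ (Finset.single_le_sum (f := fun x : Fin 3 × Fin 3 => if a x.1 = b x.2 then (1:ℝ) else 0)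
          (fun x _ => by split_ifs <;> norm_num) (Finset.mem_univ (i,j)))
        simp [hij]
      have h2 : 0 ≤ ∑ x ∈ I, N (a x.1.1, b x.1.2, r x.1) (a x.2.1, b x.2.2, r x.2) :=
        Finset.sum_nonneg fun x _ => hN0 _ _
      linarith
  -- expectation of N
  have hEN : ∀ x ∈ I, ∑ a : Fin 3 → V, ∑ b : Fin 3 → V, ∑ r : Fin 3 × Fin 3 → R, wt a b r * N (a x.1.1, b x.1.2, r x.1) (a x.2.1, b x.2.2, r x.2) = Q := by
    rintro ⟨⟨i, j⟩, ⟨k, l⟩⟩ hx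
    rw [hIm] at hx
    obtain ⟨hik, hjl⟩ := hx
    have s1 : ∀ (a b : Fin 3 → V), ∑ r : Fin 3 × Fin 3 → R, wt a b r * N (a i, b j, r (i,j)) (a k, b l, r (k,l))
        = (∏ k, μ (a k)) * ((∏ k, μ (b k)) * ∑ r1, ∑ r2, la r1 * la r2 * N (a i, b j, r1) (a k, b l, r2)) := by
      intro a b
      rw [← pair_marginal la hl1 (i,j) (k,l) (by simp [hik]) (fun r1 r2 => N (a i, b j, r1) (a k, b l, r2)),
        Finset.mul_sum, Finset.mul_sum]
      refine Finset.sum_congr rfl fun r _ => ?_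
      simp only [hwt]; ring
    simp only [s1]
    have s2 : ∀ a : Fin 3 → V, ∑ b : Fin 3 → V, (∏ k, μ (a k)) * ((∏ k, μ (b k)) * ∑ r1, ∑ r2, la r1 * la r2 * N (a i, b j, r1) (a k, b l, r2))
      = (∏ k, μ (a k)) * ∑ v1, ∑ v2, μ v1 * μ v2 * ∑ r1, ∑ r2, la r1 * la r2 * N (a i, v1, r1) (a k, v2, r2) := by
      intro a
      rw [← Finset.mul_sum, pair_marginal μ hμ1 j l hjl
        (fun v1 v2 => ∑ r1, ∑ r2, la r1 * la r2 * N (a i, v1, r1) (a k, v2, r2))]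
    simp only [s2]
    rw [pair_marginal μ hμ1 i k hik
        (fun u1 u2 => ∑ v1, ∑ v2, μ v1 * μ v2 * ∑ r1, ∑ r2, la r1 * la r2 * N (u1, v1, r1) (u2, v2, r2))]
    -- reorganize
    have hyy : ∀ e, y e = ∑ u, ∑ v, ∑ r, μ u * μ v * la r * J u v r e := by
      intro e
      rw [hy e]
      simp_rw [Finset.mul_sum]
      rw [Finset.sum_comm]
      refine Finset.sum_congr rfl fun u _ => ?_
      rw [Finset.sum_comm]
      refine Finset.sum_congr rfl fun v _ => Finset.sum_congr rfl fun r _ => ?_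
      simp only [hJ]; ring
    let z : (V × V × R) → ι → ℝ := fun p e => μ p.1 * μ p.2.1 * la p.2.2 * J p.1 p.2.1 p.2.2 e
    have hyz : ∀ e, y e = ∑ p, z p e := by
      intro e; rw [hyy e]; simp only [Fintype.sum_prod_type, z]
    have r1 : Q = ∑ p, ∑ q, ∑ e, ∑ f, T e f * (z p e * z q f) := by
      simp only [hQd, hyz]
      simp_rw [Finset.sum_mul_sum, Finset.mul_sum]
      have : ∀ e, ∑ f, ∑ p, ∑ q, T e f * (z p e * z q f) = ∑ p, ∑ q, ∑ f, T e f * (z p e * z q f) := by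
        intro e
        rw [Finset.sum_comm]
        exact Finset.sum_congr rfl fun p _ => Finset.sum_comm
      simp_rw [this]
      rw [Finset.sum_comm]
      exact Finset.sum_congr rfl fun p _ => Finset.sum_comm
    rw [r1]
    simp only [Fintype.sum_prod_type, z, hN]
    refine Finset.sum_congr rfl fun u1 _ => ?_
    have : ∀ u2, μ u1 * μ u2 * ∑ v1, ∑ v2, μ v1 * μ v2 * ∑ r1, ∑ r2, la r1 * la r2 * ∑ e, ∑ f, T e f * (J u1 v1 r1 e * J u2 v2 r2 f)
      = ∑ v1, ∑ r1, ∑ v2, ∑ r2, ∑ e, ∑ f, T e f * (μ u1 * μ v1 * la r1 * J u1 v1 r1 e * (μ u2 * μ v2 * la r2 * J u2 v2 r2 f)) := by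
      intro u2
      rw [Finset.mul_sum]
      refine Finset.sum_congr rfl fun v1 _ => ?_
      rw [Finset.mul_sum, Finset.sum_comm]
      refine Finset.sum_congr rfl fun v2 _ => ?_
      simp_rw [Finset.mul_sum]
      refine Finset.sum_congr rfl fun r1 _ => Finset.sum_congr rfl fun r2 _ => Finset.sum_congr rfl fun e _ => Finset.sum_congr rfl fun f _ => ?_
      ring
    simp_rw [this]
    rw [Finset.sum_comm]
    refine Finset.sum_congr rfl fun v1 _ => ?_
    rw [Finset.sum_comm]
  -- expectation of coincidence
  have hEc : ∀ i j : Fin 3, ∑ a : Fin 3 → V, ∑ b : Fin 3 → V, ∑ r : Fin 3 × Fin 3 → R, wt a b r * (if a i = b j then (1:ℝ) else 0) ≤ 1 / 18 := by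
    intro i j
    obtain ⟨k, hk⟩ := exists_ne i
    obtain ⟨l, hl⟩ := exists_ne j
    have s1 : ∀ (a b : Fin 3 → V), ∑ r : Fin 3 × Fin 3 → R, wt a b r * (if a i = b j then (1:ℝ) else 0) =
        (∏ k, μ (a k)) * ((∏ k, μ (b k)) * (if a i = b j then (1:ℝ) else 0)) := by
      intro a b
      rw [← Finset.sum_mul]
      simp only [hwt]
      rw [← Finset.mul_sum, ← Finset.mul_sum, sum_prod_one la hl1]
      ring
    simp only [s1]
    have s2 : ∀ a : Fin 3 → V, ∑ b : Fin 3 → V, (∏ k, μ (a k)) * ((∏ k, μ (b k)) * (if a i = b j then (1:ℝ) else 0))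
        ≤ (∏ k, μ (a k)) * (1 / 18) := by
      intro a
      rw [← Finset.mul_sum, pair_marginal μ hμ1 j l hl.symm (fun v1 _ => if a i = v1 then (1:ℝ) else 0)]
      refine mul_le_mul_of_nonneg_left ?_ (Finset.prod_nonneg fun _ _ => hμ0 _)
      have : ∀ x, ∑ z, μ x * μ z * (if a i = x then (1:ℝ) else 0) = if a i = x then μ x else 0 := by
        intro x
        rw [← Finset.sum_mul, ← Finset.mul_sum, hμ1]
        split_ifs <;> simp
      simp_rw [this]
      rw [Finset.sum_ite_eq]
      simpa using hμ (a i)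
    refine (Finset.sum_le_sum fun a _ => s2 a).trans ?_
    rw [← Finset.sum_mul, sum_prod_one μ hμ1]; norm_num
  have hE1 : ∑ a : Fin 3 → V, ∑ b : Fin 3 → V, ∑ r : Fin 3 × Fin 3 → R, wt a b r = 1 := by
    simp only [hwt]
    simp_rw [← Finset.mul_sum, sum_prod_one la hl1, mul_one, sum_prod_one μ hμ1, mul_one, sum_prod_one μ hμ1]
  have main : ∑ a : Fin 3 → V, ∑ b : Fin 3 → V, ∑ r : Fin 3 × Fin 3 → R, wt a b r * (1 - (∑ x : Fin 3 × Fin 3, if a x.1 = b x.2 then (1:ℝ) else 0)) ≤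
      ∑ a : Fin 3 → V, ∑ b : Fin 3 → V, ∑ r : Fin 3 × Fin 3 → R, wt a b r * ∑ x ∈ I, N (a x.1.1, b x.1.2, r x.1) (a x.2.1, b x.2.2, r x.2) :=
    Finset.sum_le_sum fun a _ => Finset.sum_le_sum fun b _ => Finset.sum_le_sum fun r _ =>
      mul_le_mul_of_nonneg_left (hpt' a b r) (hwt0 a b r)
  have rhs : ∑ a : Fin 3 → V, ∑ b : Fin 3 → V, ∑ r : Fin 3 × Fin 3 → R, wt a b r * ∑ x ∈ I, N (a x.1.1, b x.1.2, r x.1) (a x.2.1, b x.2.2, r x.2) = 36 * Q := by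
    have : ∑ x ∈ I, ∑ a : Fin 3 → V, ∑ b : Fin 3 → V, ∑ r : Fin 3 × Fin 3 → R, wt a b r * N (a x.1.1, b x.1.2, r x.1) (a x.2.1, b x.2.2, r x.2) = 36 * Q := by
      rw [Finset.sum_congr rfl hEN, Finset.sum_const, hI]; simp
    rw [← this]
    simp_rw [Finset.mul_sum]
    symm
    rw [Finset.sum_comm]
    refine Finset.sum_congr rfl fun a _ => ?_
    rw [Finset.sum_comm]
    refine Finset.sum_congr rfl fun b _ => ?_
    rw [Finset.sum_comm]
  have lhs : 1 / 2 ≤ ∑ a : Fin 3 → V, ∑ b : Fin 3 → V, ∑ r : Fin 3 × Fin 3 → R, wt a b r * (1 - (∑ x : Fin 3 × Fin 3, if a x.1 = b x.2 then (1:ℝ) else 0)) := by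
    simp_rw [mul_sub, mul_one, Finset.sum_sub_distrib]
    rw [hE1]
    have : ∑ a : Fin 3 → V, ∑ b : Fin 3 → V, ∑ r : Fin 3 × Fin 3 → R, wt a b r * (∑ x : Fin 3 × Fin 3, if a x.1 = b x.2 then (1:ℝ) else 0) ≤ ∑ x : Fin 3 × Fin 3, (1/18 : ℝ) := by
      refine le_trans (le_of_eq ?_) (Finset.sum_le_sum fun x (_ : x ∈ Finset.univ) => hEc x.1 x.2)
      simp_rw [Finset.mul_sum]
      symm
      rw [Finset.sum_comm]
      refine Finset.sum_congr rfl fun a _ => ?_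
      rw [Finset.sum_comm]
      refine Finset.sum_congr rfl fun b _ => ?_
      rw [Finset.sum_comm]
    have h9 : ∑ x : Fin 3 × Fin 3, (1/18 : ℝ) = 1 / 2 := by simp; norm_num
    linarith
  linarith

end Host
end PCR

set_option linter.all false
open scoped BigOperators

namespace PCR
open Relation

theorem min_first_order {R ι : Type} [Fintype R] [Nonempty R] [Fintype ι] (load : R → ι → ℝ) (D : ι → ℝ) :
    ∃ la : R → ℝ, (∀ r, 0 ≤ la r) ∧ ∑ r, la r = 1 ∧ ∀ r0, ∑ e, D e * (∑ r, la r * load r e) ^ 2 ≤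
      ∑ e, D e * (∑ r, la r * load r e) * load r0 e := by
  classical
  let Q : (R → ℝ) → ℝ := fun la => ∑ e, D e * (∑ r, la r * load r e) ^ 2
  have hc : Continuous Q := by
    simp only [Q]; fun_prop
  obtain ⟨la, hla, hmin⟩ := (isCompact_stdSimplex ℝ R).exists_isMinOn
    ⟨Pi.single (Classical.arbitrary R) 1, single_mem_stdSimplex ℝ _⟩ hc.continuousOn
  refine ⟨la, hla.1, hla.2, fun r0 => ?_⟩
  by_contra hlt
  push Not at hlt
  set y : ι → ℝ := fun e => ∑ r, la r * load r e with hy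
  let a : ℝ := ∑ e, D e * y e * load r0 e - ∑ e, D e * y e ^ 2
  let b : ℝ := ∑ e, D e * (load r0 e - y e) ^ 2
  have ha : a < 0 := by simp only [a]; linarith
  have hkey : ∀ t : ℝ, 0 ≤ t → t ≤ 1 → 0 ≤ 2 * t * a + t ^ 2 * b := by
    intro t ht0 ht1
    let la' : R → ℝ := fun r => (1 - t) * la r + t * (Pi.single r0 1 : R → ℝ) r
    have hla' : la' ∈ stdSimplex ℝ R := by
      have := (convex_stdSimplex ℝ R) hla (single_mem_stdSimplex ℝ r0) (a := 1 - t) (b := t) (by linarith) ht0 (by ring)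
      convert this using 1
      ext r; rfl
    have h1 : Q la ≤ Q la' := hmin hla'
    have h2 : ∀ e, ∑ r, la' r * load r e = y e + t * (load r0 e - y e) := by
      intro e
      simp only [la', add_mul, Finset.sum_add_distrib]
      have : ∑ r, t * (Pi.single r0 1 : R → ℝ) r * load r e = t * load r0 e := by
        rw [Finset.sum_eq_single r0]
        · simp
        · intro r _ hr; simp [Pi.single_apply, hr]
        · simp
      rw [this]
      have : ∑ r, (1 - t) * la r * load r e = (1 - t) * y e := by
        rw [hy, Finset.mul_sum]; exact Finset.sum_congr rfl fun r _ => by ring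
      rw [this]; ring
    have h3 : Q la' - Q la = 2 * t * a + t ^ 2 * b := by
      simp only [Q, h2, a, b]
      rw [← Finset.sum_sub_distrib, ← Finset.sum_sub_distrib, Finset.mul_sum, Finset.mul_sum, ← Finset.sum_add_distrib]
      refine Finset.sum_congr rfl fun e _ => ?_
      have : ∑ r, la r * load r e = y e := rfl
      rw [this]; ring
    linarith
  have hb : 0 ≤ |b| := abs_nonneg b
  let t : ℝ := min 1 (-a / (|b| + 1))
  have ht0 : 0 < t := lt_min one_pos (div_pos (by linarith) (by linarith))
  have ht1 : t ≤ 1 := min_le_left _ _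
  have ht2 : t * (|b| + 1) ≤ -a := by
    have : t ≤ -a / (|b| + 1) := min_le_right _ _
    rwa [le_div_iff₀ (by linarith)] at this
  have := hkey t ht0.le ht1
  have h5 : t * b ≤ -a := by nlinarith [le_abs_self b]
  nlinarith

namespace Host
variable {X ι : Type} {H : Host X ι}

open Classical in
theorem metric_exists [Fintype ι] {V : Type} [Fintype V] (pt : V → X) (hpt : Function.Injective pt)
    (μ : V → ℝ) (hμ0 : ∀ v, 0 ≤ μ v) (hμ1 : ∑ v, μ v = 1) (hμ : ∀ v, μ v ≤ 1 / 18)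
    (hconn : ∀ u v, ∃ S, H.Conn S (pt u) (pt v))
    (D : ι → ℝ) (hD : ∀ e, ((Finset.univ.filter fun f => H.Tch e f).card : ℝ) ≤ D e) :
    ∃ om : ι → ℝ, (∀ e, 0 ≤ om e) ∧ ∑ e, om e ≤ 9 * Real.sqrt (∑ e, D e) ∧
      ∀ σ : V → V → Finset ι, (∀ u v, H.Conn (σ u v) (pt u) (pt v)) →
        1 ≤ ∑ u, ∑ v, μ u * μ v * ∑ e ∈ σ u v, om e := by
  let R := {σ : V → V → Finset ι // ∀ u v, H.Conn (σ u v) (pt u) (pt v)}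
  haveI : Fintype R := Fintype.ofFinite R
  choose σ0 hσ0 using hconn
  haveI : Nonempty R := ⟨⟨σ0, hσ0⟩⟩
  let load : R → ι → ℝ := fun r e => ∑ u, ∑ v, μ u * μ v * (if e ∈ r.1 u v then 1 else 0)
  have hload0 : ∀ r e, 0 ≤ load r e := fun r e => Finset.sum_nonneg fun u _ => Finset.sum_nonneg fun v _ =>
    mul_nonneg (mul_nonneg (hμ0 _) (hμ0 _)) (by split_ifs <;> norm_num)
  have hD0 : ∀ e, 0 ≤ D e := fun e => (Nat.cast_nonneg _).trans (hD e)
  obtain ⟨la, hl0, hl1, hmin⟩ := min_first_order load D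
  set y : ι → ℝ := fun e => ∑ r, la r * load r e with hy
  have hy0 : ∀ e, 0 ≤ y e := fun e => Finset.sum_nonneg fun r _ => mul_nonneg (hl0 _) (hload0 _ _)
  have hs := H.sampling pt hpt μ hμ0 hμ1 hμ (fun r : R => r.1) (fun r => r.2) la hl0 hl1 y (fun e => rfl)
  set Q := ∑ e, D e * y e ^ 2 with hQ
  have hQ1 : 1 / 72 ≤ Q := by
    refine hs.trans ?_
    have h1 : ∀ e f, (if H.Tch e f then y e * y f else 0) ≤
        (if H.Tch e f then y e ^ 2 / 2 else 0) + (if H.Tch f e then y f ^ 2 / 2 else 0) := by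
      intro e f
      by_cases h : H.Tch e f
      · have h' : H.Tch f e := by obtain ⟨z, h1, h2⟩ := h; exact ⟨z, h2, h1⟩
        rw [if_pos h, if_pos h, if_pos h']; nlinarith [sq_nonneg (y e - y f)]
      · have h' : ¬ H.Tch f e := by rintro ⟨z, h1, h2⟩; exact h ⟨z, h2, h1⟩
        rw [if_neg h, if_neg h, if_neg h']; simp
    refine (Finset.sum_le_sum fun e _ => Finset.sum_le_sum fun f _ => h1 e f).trans ?_
    simp_rw [Finset.sum_add_distrib]
    rw [Finset.sum_comm (f := fun e f => if H.Tch f e then y f ^ 2 / 2 else 0)]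
    rw [← Finset.sum_add_distrib]
    refine Finset.sum_le_sum fun e _ => ?_
    rw [← Finset.sum_filter, Finset.sum_const, nsmul_eq_mul]
    have := mul_le_mul_of_nonneg_right (hD e) (sq_nonneg (y e))
    linarith
  have hQpos : 0 < Q := by linarith
  refine ⟨fun e => D e * y e / Q, fun e => div_nonneg (mul_nonneg (hD0 e) (hy0 e)) hQpos.le, ?_, ?_⟩
  · rw [← Finset.sum_div]
    set A := ∑ e, D e * y e with hA
    set L := ∑ e, D e with hL
    have hL0 : 0 ≤ L := Finset.sum_nonneg fun e _ => hD0 e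
    have hCS : A ^ 2 ≤ L * Q := by
      have := Finset.sum_mul_sq_le_sq_mul_sq Finset.univ (fun e => Real.sqrt (D e)) (fun e => Real.sqrt (D e) * y e)
      have e1 : ∀ e, Real.sqrt (D e) * (Real.sqrt (D e) * y e) = D e * y e := fun e => by
        rw [← mul_assoc, Real.mul_self_sqrt (hD0 e)]
      have e2 : ∀ e, (Real.sqrt (D e) * y e) ^ 2 = D e * y e ^ 2 := fun e => by
        rw [mul_pow, Real.sq_sqrt (hD0 e)]
      simp only [e1, e2, Real.sq_sqrt (hD0 _)] at this
      exact this
    rw [div_le_iff₀ hQpos]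
    apply le_of_sq_le_sq
    · rw [mul_pow, mul_pow, Real.sq_sqrt hL0]
      nlinarith [mul_nonneg hL0 hQpos.le, mul_nonneg (mul_nonneg hL0 hQpos.le) (sub_nonneg.2 hQ1)]
    · positivity
  · intro σ hσ
    have h := hmin ⟨σ, hσ⟩
    have e1 : ∑ u, ∑ v, μ u * μ v * ∑ e ∈ σ u v, D e * y e / Q = (∑ e, D e * y e * load ⟨σ, hσ⟩ e) / Q := by
      have a1 : ∀ u v, μ u * μ v * ∑ e ∈ σ u v, D e * y e / Q =
          ∑ e, μ u * μ v * (if e ∈ σ u v then 1 else 0) * (D e * y e / Q) := by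
        intro u v
        rw [Finset.mul_sum]
        simp only [mul_ite, mul_one, mul_zero, ite_mul, zero_mul]
        rw [Finset.sum_ite_mem, Finset.univ_inter]
      simp_rw [a1]
      rw [Finset.sum_div]
      have : ∀ u, ∑ v, ∑ e, μ u * μ v * (if e ∈ σ u v then 1 else 0) * (D e * y e / Q) =
        ∑ e, ∑ v, μ u * μ v * (if e ∈ σ u v then 1 else 0) * (D e * y e / Q) := fun u => Finset.sum_comm
      simp_rw [this]
      rw [Finset.sum_comm]
      refine Finset.sum_congr rfl fun e _ => ?_
      simp only [load]
      rw [mul_div_right_comm (D e * y e) _ Q]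
      generalize D e * y e / Q = c
      rw [Finset.mul_sum]
      refine Finset.sum_congr rfl fun u _ => ?_
      rw [Finset.mul_sum]
      refine Finset.sum_congr rfl fun v _ => ?_
      ring
    rw [e1, le_div_iff₀ hQpos, one_mul]
    exact h

theorem Cst.routing {w : ι → ℕ} {Y : Set X} {p q : X} {n : ℕ} (h : H.Cst w Y p q n) :
    ∃ S : Finset ι, H.Conn S p q ∧ ∑ e ∈ S, w e ≤ n := by
  classical
  induction h with
  | refl _ => exact ⟨∅, ReflTransGen.refl, by simp⟩
  | step q r n s _ hm ih =>
    obtain ⟨S, hS, hn⟩ := ih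
    refine ⟨insert s S, ?_, ?_⟩
    · refine ReflTransGen.trans (rtg_mono (fun x y ⟨e, he, h⟩ => ⟨e, Finset.mem_insert_of_mem he, h⟩) hS)
        (rtg_mono (fun x y h => ⟨s, Finset.mem_insert_self _ _, h.2.2⟩) hm)
    · by_cases hs : s ∈ S
      · rw [Finset.insert_eq_of_mem hs]; omega
      · rw [Finset.sum_insert hs]; omega

end Host
end PCR

set_option linter.all false
open scoped BigOperators

namespace PCR
open Relation
namespace Host
variable {X ι : Type} {H : Host X ι}

theorem Cst.comap {κ : Type} (f : κ → ι) {w : ι → ℕ} {Y : Set X} {p q : X} {n : ℕ}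
    (h : (H.comap f).Cst (fun k => w (f k)) Y p q n) : H.Cst w Y p q n := by
  induction h with
  | refl h => exact Cst.refl h
  | step q r n s _ hm ih => exact Cst.step q r n (f s) ih hm

theorem KPR' [Fintype ι] (w : ι → ℕ) {τ : ℕ} (hτ : 0 < τ) (hw : ∀ s, 0 < w s) :
    ∃ (cls : X → Set X) (Z : Finset ι), (∀ p, p ∈ cls p) ∧ (∀ p q, q ∈ cls p → cls q = cls p) ∧
      τ * Z.card ≤ 4 * ∑ s, w s ∧
      (∀ s ∉ Z, ∀ p ∈ H.reg s, ∀ q ∈ H.reg s, q ∈ cls p) ∧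
      ∀ p q, q ∈ cls p → q ∈ H.NN w Set.univ p (200 * τ) := by
  classical
  let κ := {s : ι // w s < τ}
  let f : κ → ι := Subtype.val
  obtain ⟨P, Z, hZ, hI, hd⟩ := KPR (H := H.comap f) (w := fun k => w (f k)) hτ (fun k => ⟨hw k.1, k.2⟩)
  refine ⟨P.cls, (Finset.univ.filter fun s => ¬ w s < τ) ∪ Z.image f, P.self, P.eq, ?_, ?_, ?_⟩
  · have h1 : τ * (Finset.univ.filter fun s => ¬ w s < τ).card ≤ ∑ s, w s := by
      have : ∑ s ∈ Finset.univ.filter (fun s => ¬ w s < τ), τ ≤ ∑ s, w s :=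
        (Finset.sum_le_sum fun s hs => not_lt.1 (Finset.mem_filter.1 hs).2).trans
          (Finset.sum_le_univ_sum_of_nonneg fun _ => Nat.zero_le _)
      simpa [mul_comm] using this
    have h2 : ∑ k : κ, w (f k) ≤ ∑ s, w s := by
      rw [← Finset.sum_image (s := Finset.univ) (f := w) (g := f) (fun a _ b _ h => Subtype.val_injective h)]
      exact Finset.sum_le_univ_sum_of_nonneg fun _ => Nat.zero_le _
    have h3 := Finset.card_union_le (Finset.univ.filter fun s => ¬ w s < τ) (Z.image f)
    have h4 : (Z.image f).card ≤ Z.card := Finset.card_image_le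
    nlinarith
  · intro s hs p hp q hq
    simp only [Finset.mem_union, Finset.mem_filter, Finset.mem_univ, true_and, Finset.mem_image, not_or, not_not] at hs
    exact hI ⟨s, hs.1⟩ (fun h => hs.2 ⟨⟨s, hs.1⟩, h, rfl⟩) p hp q hq
  · intro p q hq
    obtain ⟨m, hm, h⟩ := hd p q hq
    exact ⟨m, hm, h.comap⟩

open Classical in
noncomputable def cut {ι V : Type} [Fintype ι] (inc : ι → V → Prop) (A : Finset V) : Finset ι :=
  Finset.univ.filter fun e => (∃ u ∈ A, inc e u) ∧ ∃ v ∉ A, inc e v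

theorem mem_cut {ι V : Type} [Fintype ι] {inc : ι → V → Prop} {A : Finset V} {e : ι} :
    e ∈ cut inc A ↔ (∃ u ∈ A, inc e u) ∧ ∃ v ∉ A, inc e v := by simp [cut]

/-- sparse cut from a metric -/
theorem cut_of_metric [Fintype ι] {V : Type} [Fintype V] [DecidableEq V] (pt : V → X) (inc : ι → V → Prop)
    (hinc : ∀ e v, inc e v → pt v ∈ H.reg e)
    (μ : V → ℝ) (hμ0 : ∀ v, 0 < μ v) (hμ1 : ∑ v, μ v = 1)
    (hconn : ∀ u v, H.Rch Set.univ (pt u) (pt v))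
    (w : ι → ℕ) (hw : ∀ e, 0 < w e) (τ : ℕ) (hτ : 0 < τ) (B : ℝ) (hB : 0 < B) (hwB : (∑ e, w e : ℝ) ≤ 9001 * τ * B)
    (hd : 1000 * τ ≤ ∑ u, ∑ v, μ u * μ v * (H.FF w Set.univ (pt u) (pt v) : ℝ)) :
    ∃ A : Finset V, A.Nonempty ∧ A ≠ Finset.univ ∧ ((cut inc A).card : ℝ) ≤ 10 ^ 6 * B * ∑ v ∈ A, μ v ∧
      ((cut inc A).card : ℝ) ≤ 10 ^ 6 * B * ∑ v ∈ Aᶜ, μ v := by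
  classical
  have hτ' : (0:ℝ) < τ := by exact_mod_cast hτ
  obtain ⟨cls, Z, hself, heq, hZ, hin, hdist⟩ := H.KPR' w hτ hw
  have hZ' : (Z.card : ℝ) ≤ 36004 * B := by
    have : (τ * Z.card : ℝ) ≤ 4 * ∑ s, (w s : ℝ) := by exact_mod_cast hZ
    have h2 : (τ * Z.card : ℝ) ≤ τ * (36004 * B) := by linarith
    exact le_of_mul_le_mul_left h2 hτ'
  have hcompl : ∀ A : Finset V, ∑ v ∈ Aᶜ, μ v = 1 - ∑ v ∈ A, μ v := by
    intro A; rw [← hμ1, ← Finset.sum_add_sum_compl A]; ring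
  let C : V → Finset V := fun v => Finset.univ.filter fun u => pt u ∈ cls (pt v)
  by_cases hc : ∀ v, ∑ u ∈ C v, μ u ≤ 9 / 10
  · let Sat : Finset V → Prop := fun A => ∀ v ∈ A, C v ⊆ A
    have hcutZ : ∀ A, Sat A → cut inc A ⊆ Z := by
      intro A hA e he
      rw [mem_cut] at he
      obtain ⟨⟨u, hu, hu'⟩, v, hv, hv'⟩ := he
      by_contra hZe
      have := hin e hZe _ (hinc e u hu') _ (hinc e v hv')
      exact hv (hA u hu (by simp [C, this]))
    have fin : ∀ A, Sat A → 1 / 20 ≤ ∑ v ∈ A, μ v → ∑ v ∈ A, μ v ≤ 19 / 20 →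
      ∃ A : Finset V, A.Nonempty ∧ A ≠ Finset.univ ∧ ((cut inc A).card : ℝ) ≤ 10 ^ 6 * B * ∑ v ∈ A, μ v ∧
      ((cut inc A).card : ℝ) ≤ 10 ^ 6 * B * ∑ v ∈ Aᶜ, μ v := by
      intro A hA h1 h2
      have h3 : ((cut inc A).card : ℝ) ≤ 36004 * B :=
        le_trans (by exact_mod_cast Finset.card_le_card (hcutZ A hA)) hZ'
      refine ⟨A, ?_, ?_, ?_, ?_⟩
      · rw [Finset.nonempty_iff_ne_empty]; rintro rfl; simp at h1; linarith
      · rintro rfl; rw [hμ1] at h2; linarith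
      · nlinarith
      · rw [hcompl]; nlinarith
    obtain ⟨A, hA, hmax⟩ := Finset.exists_max_image
      (Finset.univ.filter fun A : Finset V => Sat A ∧ ∑ v ∈ A, μ v ≤ 1 / 2) (fun A => ∑ v ∈ A, μ v)
      ⟨∅, by simp [Sat]⟩
    simp only [Finset.mem_filter, Finset.mem_univ, true_and] at hA hmax
    have hne : A ≠ Finset.univ := by rintro rfl; rw [hμ1] at hA; linarith [hA.2]
    obtain ⟨v, hv⟩ : ∃ v, v ∉ A := by
      by_contra h; push Not at h; exact hne (Finset.eq_univ_iff_forall.2 h)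
    by_cases h20 : 1 / 20 ≤ ∑ v ∈ A, μ v
    · exact fin A hA.1 h20 (by linarith [hA.2])
    · have hS : Sat (A ∪ C v) := by
        intro x hx y hy
        rcases Finset.mem_union.1 hx with h | h
        · exact Finset.mem_union_left _ (hA.1 x h hy)
        · refine Finset.mem_union_right _ ?_
          simp only [C, Finset.mem_filter, Finset.mem_univ, true_and] at h hy ⊢
          rw [heq _ _ h] at hy; exact hy
      have hgt : ∑ u ∈ A, μ u < ∑ u ∈ A ∪ C v, μ u := by
        apply Finset.sum_lt_sum_of_subset (Finset.subset_union_left) (i := v) _ hv (hμ0 v) (fun j _ _ => (hμ0 j).le)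
        exact Finset.mem_union_right _ (by simp [C, hself])
      have h12 : 1 / 2 < ∑ u ∈ A ∪ C v, μ u := by
        by_contra h
        exact absurd (hmax _ ⟨hS, not_lt.1 h⟩) (not_le.2 hgt)
      have hle : ∑ u ∈ A ∪ C v, μ u ≤ ∑ u ∈ A, μ u + ∑ u ∈ C v, μ u := by
        rw [← Finset.sum_union_inter]
        have : 0 ≤ ∑ u ∈ A ∩ C v, μ u := Finset.sum_nonneg fun i _ => (hμ0 i).le
        linarith
      exact fin _ hS (by linarith) (by linarith [hc v])
  · push Not at hc
    obtain ⟨v0, hv0⟩ := hc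
    let F : V → ℕ := fun v => H.FF w Set.univ (pt v0) (pt v)
    have hFC : ∀ v ∈ C v0, F v ≤ 200 * τ := by
      intro v hv
      simp only [C, Finset.mem_filter, Finset.mem_univ, true_and] at hv
      obtain ⟨m, hm, h⟩ := hdist _ _ hv
      exact (FF_le h).trans hm
    have hFs : ∀ u v, H.FF w Set.univ (pt u) (pt v) ≤ F u + F v := by
      intro u v
      exact FF_le ((FF_spec (w := w) (hconn v0 u)).symm.trans (FF_spec (w := w) (hconn v0 v)))
    have hFl : ∀ e u v, inc e u → inc e v → F v ≤ F u + w e := fun e u v hu hv =>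
      FF_lip (hconn v0 u) (Cst.single trivial (reg_mv e (Set.subset_univ _) _ _ (hinc _ _ hu) (hinc _ _ hv)))
    have hsumF : (500 * τ : ℝ) ≤ ∑ v, μ v * F v := by
      have : ∑ u, ∑ v, μ u * μ v * (H.FF w Set.univ (pt u) (pt v) : ℝ) ≤ ∑ u, ∑ v, μ u * μ v * ((F u : ℝ) + F v) := by
        refine Finset.sum_le_sum fun u _ => Finset.sum_le_sum fun v _ => ?_
        refine mul_le_mul_of_nonneg_left ?_ (mul_nonneg (hμ0 _).le (hμ0 _).le)
        exact_mod_cast hFs u v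
      have e : ∑ u, ∑ v, μ u * μ v * ((F u : ℝ) + F v) = 2 * ∑ v, μ v * F v := by
        have : ∀ u v, μ u * μ v * ((F u : ℝ) + F v) = (μ u * F u) * μ v + μ u * (μ v * F v) := fun u v => by ring
        simp_rw [this, Finset.sum_add_distrib, ← Finset.mul_sum, hμ1, ← Finset.sum_mul, hμ1]; ring
      linarith
    let M : ℕ := Finset.univ.sup F
    have hM : ∀ v, F v ≤ M := fun v => Finset.le_sup (Finset.mem_univ v)
    let A : ℕ → Finset V := fun ρ => Finset.univ.filter fun v => ρ ≤ F v
    by_contra hno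
    push Not at hno
    have hA : ∀ ρ ∈ Finset.Ioc (200 * τ) M, 10 ^ 6 * B * ∑ v ∈ A ρ, μ v ≤ ((cut inc (A ρ)).card : ℝ) := by
      intro ρ hρ
      rw [Finset.mem_Ioc] at hρ
      by_cases hne : (A ρ).Nonempty
      · have hdis : C v0 ⊆ (A ρ)ᶜ := by
          intro v hv
          have := hFC v hv
          simp only [A, Finset.mem_compl, Finset.mem_filter, Finset.mem_univ, true_and]
          omega
        have hmu : 9 / 10 ≤ ∑ v ∈ (A ρ)ᶜ, μ v :=
          hv0.le.trans (Finset.sum_le_sum_of_subset_of_nonneg hdis fun i _ _ => (hμ0 i).le)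
        have hmu' := hcompl (A ρ)
        have hnu : A ρ ≠ Finset.univ := by
          intro h; rw [h] at hmu; simp at hmu; linarith
        by_contra hlt
        have := hno (A ρ) hne hnu (not_le.1 hlt).le
        nlinarith
      · rw [Finset.not_nonempty_iff_eq_empty.1 hne]; simp
    have hsum := Finset.sum_le_sum hA
    have hub : ∑ ρ ∈ Finset.Ioc (200 * τ) M, ((cut inc (A ρ)).card : ℝ) ≤ ∑ e, (w e : ℝ) := by
      have : ∑ ρ ∈ Finset.Ioc (200 * τ) M, (cut inc (A ρ)).card ≤ ∑ e, w e := by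
        have hc : ∀ A, (cut inc A).card = ∑ e, if e ∈ cut inc A then 1 else 0 := by
          intro A; rw [Finset.sum_ite_mem]; simp
        simp only [hc]
        rw [Finset.sum_comm]
        refine Finset.sum_le_sum fun e _ => ?_
        refine (Finset.card_filter _ _).symm.le.trans ?_
        by_cases hex : ∃ v, inc e v
        · obtain ⟨v, hv, hvm⟩ := Finset.exists_min_image (Finset.univ.filter fun v => inc e v) F
            (by obtain ⟨v, hv⟩ := hex; exact ⟨v, by simp [hv]⟩)
          simp only [Finset.mem_filter, Finset.mem_univ, true_and] at hv hvm
          calc _ ≤ (Finset.Ioc (F v) (F v + w e)).card := Finset.card_le_card ?_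
            _ = w e := by simp
          intro ρ hρ
          simp only [Finset.mem_filter, mem_cut, A, Finset.mem_univ, true_and, Finset.mem_Ioc] at hρ ⊢
          obtain ⟨_, ⟨u, hu, hu'⟩, u', hu2, hu2'⟩ := hρ
          have := hvm u' hu2'
          have := hFl e v u hv hu'
          omega
        · rw [Finset.filter_false_of_mem]
          · simp
          · intro ρ _ h; rw [mem_cut] at h; obtain ⟨⟨u, _, hu⟩, _⟩ := h; exact hex ⟨u, hu⟩
      exact_mod_cast this
    have hlb : (300 * τ : ℝ) ≤ ∑ ρ ∈ Finset.Ioc (200 * τ) M, ∑ v ∈ A ρ, μ v := by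
      have e1 : ∑ ρ ∈ Finset.Ioc (200 * τ) M, ∑ v ∈ A ρ, μ v = ∑ v, μ v * ((F v - 200 * τ : ℕ) : ℝ) := by
        simp only [A, Finset.sum_filter]
        rw [Finset.sum_comm]
        refine Finset.sum_congr rfl fun v _ => ?_
        rw [← Finset.sum_filter, Finset.sum_const, nsmul_eq_mul, mul_comm]
        congr 2
        have : (Finset.Ioc (200 * τ) M).filter (fun ρ => ρ ≤ F v) = Finset.Ioc (200 * τ) (F v) := by
          ext ρ; simp only [Finset.mem_filter, Finset.mem_Ioc]; have := hM v; omega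
        rw [this]; simp
      rw [e1]
      have e2 : ∑ v, μ v * ((F v : ℝ) - 200 * τ) ≤ ∑ v, μ v * ((F v - 200 * τ : ℕ) : ℝ) := by
        refine Finset.sum_le_sum fun v _ => mul_le_mul_of_nonneg_left ?_ (hμ0 v).le
        have : (F v : ℝ) ≤ ((F v - 200 * τ : ℕ) : ℝ) + 200 * τ := by
          have : F v ≤ (F v - 200 * τ) + 200 * τ := by omega
          exact_mod_cast this
        linarith
      have e3 : ∑ v, μ v * ((F v : ℝ) - 200 * τ) = ∑ v, μ v * F v - 200 * τ := by
        simp_rw [mul_sub, Finset.sum_sub_distrib, ← Finset.sum_mul, hμ1, one_mul]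
      linarith
    rw [← Finset.mul_sum] at hsum
    have h1 : 10 ^ 6 * B * (300 * τ) ≤ 9001 * τ * B :=
      (mul_le_mul_of_nonneg_left hlb (by positivity)).trans (hsum.trans (hub.trans hwB))
    nlinarith [mul_pos hB hτ']

open Classical in
theorem SC [Fintype ι] {V : Type} [Fintype V] [DecidableEq V] (pt : V → X) (hpt : Function.Injective pt) (inc : ι → V → Prop)
    (hinc : ∀ e v, inc e v → pt v ∈ H.reg e)
    (μ : V → ℝ) (hμ0 : ∀ v, 0 < μ v) (hμ1 : ∑ v, μ v = 1) (hμ : ∀ v, μ v ≤ 1 / 18)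
    (D : ι → ℝ) (hD1 : ∀ e, 1 ≤ D e) (hD : ∀ e, ((Finset.univ.filter fun f => H.Tch e f).card : ℝ) ≤ D e) :
    ∃ A : Finset V, A.Nonempty ∧ A ≠ Finset.univ ∧
      ((cut inc A).card : ℝ) ≤ 10 ^ 6 * Real.sqrt (∑ e, D e) * ∑ v ∈ A, μ v ∧
      ((cut inc A).card : ℝ) ≤ 10 ^ 6 * Real.sqrt (∑ e, D e) * ∑ v ∈ Aᶜ, μ v := by
  by_cases hconn : ∀ u v, H.Rch Set.univ (pt u) (pt v)
  · obtain ⟨om, hom0, homL, hom⟩ := metric_exists pt hpt μ (fun v => (hμ0 v).le) hμ1 hμ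
      (fun u v => by
        obtain ⟨n, hn⟩ := (hconn u v).cst (w := fun _ => 1)
        obtain ⟨S, hS, _⟩ := hn.routing
        exact ⟨S, hS⟩) D hD
    have hne : Nonempty ι := by
      by_contra hemp
      rw [not_nonempty_iff] at hemp
      choose σ hσ using fun u v => (FF_spec (w := fun _ : ι => 1) (hconn u v)).routing
      have := hom σ (fun u v => (hσ u v).1)
      have h0 : ∀ u v, ∑ e ∈ σ u v, om e = 0 := fun u v => Finset.sum_eq_zero fun e _ => (hemp.false e).elim
      simp [h0] at this
      linarith
    set τ : ℕ := Fintype.card ι + 1 with hτ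
    set B := Real.sqrt (∑ e, D e) with hBd
    have hB1 : 1 ≤ B := by
      rw [hBd, Real.one_le_sqrt]
      obtain ⟨e⟩ := hne
      exact (hD1 e).trans (Finset.single_le_sum (f := D) (fun e _ => zero_le_one.trans (hD1 e)) (Finset.mem_univ e))
    let w : ι → ℕ := fun e => ⌊1000 * τ * om e⌋₊ + 1
    have hτ0 : (0:ℝ) < τ := by rw [hτ]; positivity
    have hwub : ∀ e, (w e : ℝ) ≤ 1000 * τ * om e + 1 := by
      intro e
      simp only [w]; push_cast
      have := Nat.floor_le (show 0 ≤ 1000 * τ * om e from mul_nonneg (by positivity) (hom0 e))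
      linarith
    have hwlb : ∀ e, 1000 * τ * om e ≤ (w e : ℝ) := by
      intro e
      simp only [w]; push_cast
      exact (Nat.lt_floor_add_one _).le
    refine cut_of_metric pt inc hinc μ hμ0 hμ1 hconn w (fun e => Nat.succ_pos _) τ (Nat.succ_pos _) B (by linarith) ?_ ?_
    · refine (Finset.sum_le_sum fun e _ => hwub e).trans ?_
      rw [Finset.sum_add_distrib, ← Finset.mul_sum]
      simp only [Finset.sum_const, Finset.card_univ, nsmul_eq_mul, mul_one]
      have : (Fintype.card ι : ℝ) ≤ τ := by rw [hτ]; push_cast; linarith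
      have h2 : 1000 * τ * ∑ e, om e ≤ 1000 * τ * (9 * B) := mul_le_mul_of_nonneg_left homL (by positivity)
      nlinarith
    · choose σ hσ hσ2 using fun u v => (FF_spec (w := w) (hconn u v)).routing
      have h1 := hom σ hσ
      have h2 : 1000 * τ * ∑ u, ∑ v, μ u * μ v * ∑ e ∈ σ u v, om e ≤
          ∑ u, ∑ v, μ u * μ v * (H.FF w Set.univ (pt u) (pt v) : ℝ) := by
        rw [Finset.mul_sum]
        refine Finset.sum_le_sum fun u _ => ?_
        rw [Finset.mul_sum]
        refine Finset.sum_le_sum fun v _ => ?_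
        have h3 : 1000 * τ * ∑ e ∈ σ u v, om e ≤ (H.FF w Set.univ (pt u) (pt v) : ℝ) := by
          rw [Finset.mul_sum]
          refine (Finset.sum_le_sum fun e _ => hwlb e).trans ?_
          exact_mod_cast hσ2 u v
        have := mul_le_mul_of_nonneg_left h3 (mul_nonneg (hμ0 u).le (hμ0 v).le)
        linarith
      have := mul_le_mul_of_nonneg_left h1 (show (0:ℝ) ≤ 1000 * τ by positivity)
      linarith
  · push Not at hconn
    obtain ⟨x, y, hxy⟩ := hconn
    refine ⟨Finset.univ.filter fun v => H.Rch Set.univ (pt x) (pt v), ⟨x, by simpa using Rch.refl (Set.mem_univ _)⟩, ?_, ?_⟩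
    · intro h
      have := Finset.mem_univ y
      rw [← h, Finset.mem_filter] at this
      exact hxy this.2
    · have : cut inc (Finset.univ.filter fun v => H.Rch Set.univ (pt x) (pt v)) = ∅ := by
        rw [Finset.eq_empty_iff_forall_notMem]
        intro e he
        rw [mem_cut] at he
        obtain ⟨⟨u, hu, hu'⟩, v, hv, hv'⟩ := he
        simp only [Finset.mem_filter, Finset.mem_univ, true_and] at hu hv
        exact hv (hu.trans ((reg_mv e (Set.subset_univ _) _ _ (hinc _ _ hu') (hinc _ _ hv')).rch trivial))
      rw [this]
      simp only [Finset.card_empty, Nat.cast_zero]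
      exact ⟨mul_nonneg (by positivity) (Finset.sum_nonneg fun i _ => (hμ0 i).le),
        mul_nonneg (by positivity) (Finset.sum_nonneg fun i _ => (hμ0 i).le)⟩

end Host
end PCR

set_option linter.all false
open scoped BigOperators

namespace PCR
open Relation
namespace Host
variable {X ι : Type} {H : Host X ι}

open Classical in
noncomputable def ec {ι V : Type} [Fintype ι] (inc : ι → V → Prop) (A B : Finset V) : Finset ι :=
  Finset.univ.filter fun e => (∃ u ∈ A, inc e u) ∧ ∃ v ∈ B, inc e v

theorem mem_ec {ι V : Type} [Fintype ι] {inc : ι → V → Prop} {A B : Finset V} {e : ι} :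
    e ∈ ec inc A B ↔ (∃ u ∈ A, inc e u) ∧ ∃ v ∈ B, inc e v := by simp [ec]

open Classical in
noncomputable def ins {ι V : Type} [Fintype ι] (inc : ι → V → Prop) (A : Finset V) : Finset ι :=
  Finset.univ.filter fun e => ∀ u, inc e u → u ∈ A

theorem mem_ins {ι V : Type} [Fintype ι] {inc : ι → V → Prop} {A : Finset V} {e : ι} :
    e ∈ ins inc A ↔ ∀ u, inc e u → u ∈ A := by simp [ins]

open Classical in
theorem SCW [Fintype ι] {V : Type} [Fintype V] [DecidableEq V] (pt : V → X) (hpt : Function.Injective pt) (inc : ι → V → Prop)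
    (hinc : ∀ e v, inc e v → pt v ∈ H.reg e) (h2 : ∀ e u v x, inc e u → inc e v → u ≠ v → inc e x → x = u ∨ x = v)
    (p : V → ℝ) (hp0 : ∀ v, 0 < p v)
    (D : ι → ℝ) (hD1 : ∀ e, 1 ≤ D e) (hD : ∀ e, ((Finset.univ.filter fun f => H.Tch e f).card : ℝ) ≤ D e)
    (W : Finset V) (hW : W.Nonempty) (hpW : ∀ v ∈ W, 18 * p v ≤ ∑ u ∈ W, p u) :
    ∃ A ⊆ W, A.Nonempty ∧ A ≠ W ∧
      ((ec inc A (W \ A)).card : ℝ) * (∑ v ∈ W, p v) ≤ 10 ^ 6 * Real.sqrt (∑ e ∈ ins inc W, D e) * ∑ v ∈ A, p v ∧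
      ((ec inc A (W \ A)).card : ℝ) * (∑ v ∈ W, p v) ≤ 10 ^ 6 * Real.sqrt (∑ e ∈ ins inc W, D e) * ∑ v ∈ W \ A, p v := by
  set P := ∑ v ∈ W, p v with hP
  have hP0 : 0 < P := Finset.sum_pos (fun v _ => hp0 v) hW
  let κ := {e : ι // e ∈ ins inc W}
  let V' := {v : V // v ∈ W}
  obtain ⟨A, hA1, hA2, hA3, hA4⟩ := SC (H := H.comap (Subtype.val : κ → ι)) (V := V') (fun v => pt v.1)
    (fun a b h => Subtype.ext (hpt h)) (fun e v => inc e.1 v.1) (fun e v h => hinc _ _ h)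
    (fun v => p v.1 / P) (fun v => div_pos (hp0 _) hP0)
    (by rw [← Finset.sum_div, Finset.sum_coe_sort W p]; exact div_self hP0.ne')
    (fun v => by rw [div_le_iff₀ hP0]; linarith [hpW v.1 v.2]) (fun e => D e.1) (fun e => hD1 _)
    (fun e => by
      refine le_trans ?_ (hD e.1)
      have : ((Finset.univ.filter fun f : κ => (H.comap (Subtype.val : κ → ι)).Tch e f).image Subtype.val).card ≤
        (Finset.univ.filter fun f => H.Tch e.1 f).card := by
        apply Finset.card_le_card
        intro f hf
        obtain ⟨f', hf', rfl⟩ := Finset.mem_image.1 hf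
        exact Finset.mem_filter.2 ⟨Finset.mem_univ _, (Finset.mem_filter.1 hf').2⟩
      rw [Finset.card_image_of_injective _ Subtype.val_injective] at this
      exact_mod_cast this)
  have hsub : A.image Subtype.val ⊆ W := by
    intro x hx; obtain ⟨y, _, rfl⟩ := Finset.mem_image.1 hx; exact y.2
  have hmem : ∀ x : V', x.1 ∈ A.image Subtype.val ↔ x ∈ A := by
    intro x
    rw [Finset.mem_image]
    constructor
    · rintro ⟨y, hy, h⟩; rwa [← Subtype.ext h]
    · intro h; exact ⟨x, h, rfl⟩
  have hcard : (ec inc (A.image Subtype.val) (W \ A.image Subtype.val)).card ≤ (cut (fun (e : κ) (v : V') => inc e.1 v.1) A).card := by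
    rw [← Finset.card_image_of_injective (cut (fun (e : κ) (v : V') => inc e.1 v.1) A) Subtype.val_injective]
    apply Finset.card_le_card
    intro e he
    rw [mem_ec] at he
    obtain ⟨⟨u, hu, hu'⟩, v, hv, hv'⟩ := he
    have huW := hsub hu
    obtain ⟨hvW, hvA⟩ := Finset.mem_sdiff.1 hv
    have hne : u ≠ v := by rintro rfl; exact hvA hu
    have hei : e ∈ ins inc W := by
      rw [mem_ins]; intro x hx
      rcases h2 e u v x hu' hv' hne hx with rfl | rfl <;> assumption
    refine Finset.mem_image.2 ⟨⟨e, hei⟩, ?_, rfl⟩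
    rw [mem_cut]
    exact ⟨⟨⟨u, huW⟩, (hmem _).1 hu, hu'⟩, ⟨⟨v, hvW⟩, fun h => hvA ((hmem ⟨v, hvW⟩).2 h), hv'⟩⟩
  have hL : ∑ e : κ, D e.1 = ∑ e ∈ ins inc W, D e := Finset.sum_coe_sort (ins inc W) D
  rw [hL] at hA3 hA4
  have hsA : ∑ v ∈ A, p v.1 / P = (∑ v ∈ A.image Subtype.val, p v) / P := by
    rw [← Finset.sum_div, Finset.sum_image (fun a _ b _ h => Subtype.ext h)]
  have hsA' : ∑ v ∈ Aᶜ, p v.1 / P = (∑ v ∈ W \ A.image Subtype.val, p v) / P := by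
    have h3 : W \ A.image Subtype.val = Aᶜ.image Subtype.val := by
      ext x
      rw [Finset.mem_sdiff]
      constructor
      · rintro ⟨h1, h2⟩
        exact Finset.mem_image.2 ⟨⟨x, h1⟩, Finset.mem_compl.2 fun h => h2 ((hmem ⟨x, h1⟩).2 h), rfl⟩
      · intro hx
        obtain ⟨y, hy, rfl⟩ := Finset.mem_image.1 hx
        exact ⟨y.2, fun h => Finset.mem_compl.1 hy ((hmem y).1 h)⟩
    rw [h3, ← Finset.sum_div, Finset.sum_image (fun a _ b _ h => Subtype.ext h)]
  rw [hsA, mul_div_assoc', le_div_iff₀ hP0] at hA3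
  rw [hsA', mul_div_assoc', le_div_iff₀ hP0] at hA4
  have hc' := mul_le_mul_of_nonneg_right (Nat.cast_le (α := ℝ).2 hcard) hP0.le
  refine ⟨A.image Subtype.val, hsub, hA1.image _, ?_, hc'.trans hA3, hc'.trans hA4⟩
  intro h
  apply hA2
  rw [Finset.eq_univ_iff_forall]
  intro x
  rw [← hmem, h]; exact x.2

open Classical in
theorem SEP [Fintype ι] {V : Type} [Fintype V] [DecidableEq V] (pt : V → X) (hpt : Function.Injective pt) (inc : ι → V → Prop)
    (hinc : ∀ e v, inc e v → pt v ∈ H.reg e) (h2 : ∀ e u v x, inc e u → inc e v → u ≠ v → inc e x → x = u ∨ x = v)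
    (p : V → ℝ) (hp0 : ∀ v, 0 < p v)
    (D : ι → ℝ) (hD1 : ∀ e, 1 ≤ D e) (hD : ∀ e, ((Finset.univ.filter fun f => H.Tch e f).card : ℝ) ≤ D e)
    (W : Finset V) (hW : W.Nonempty) (hpW : ∀ v ∈ W, 36 * p v ≤ ∑ u ∈ W, p u) :
    ∃ B ⊆ W, ∑ v ∈ B, p v ≤ 3 / 4 * ∑ v ∈ W, p v ∧ ∑ v ∈ W \ B, p v ≤ 3 / 4 * ∑ v ∈ W, p v ∧
      ((ec inc B (W \ B)).card : ℝ) ≤ 2 * 10 ^ 6 * Real.sqrt (∑ e ∈ ins inc W, D e) := by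
  set P := ∑ v ∈ W, p v with hP
  set L := Real.sqrt (∑ e ∈ ins inc W, D e) with hL
  have hL0 : 0 ≤ L := Real.sqrt_nonneg _
  have hP0 : 0 < P := Finset.sum_pos (fun v _ => hp0 v) hW
  have hsd : ∀ A ⊆ W, ∑ v ∈ W \ A, p v = P - ∑ v ∈ A, p v := by
    intro A hA; rw [hP, ← Finset.sum_sdiff hA]; ring
  have hnn : ∀ A : Finset V, 0 ≤ ∑ v ∈ A, p v := fun A => Finset.sum_nonneg fun v _ => (hp0 v).le
  obtain ⟨W', hW', hmin⟩ := Finset.exists_min_image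
    (W.powerset.filter fun A => P ≤ 2 * ∑ v ∈ A, p v ∧ ((ec inc A (W \ A)).card : ℝ) * P ≤ 2 * 10 ^ 6 * L * ∑ v ∈ W \ A, p v)
    Finset.card ⟨W, by
      have : ec inc W ∅ = ∅ := by
        rw [Finset.eq_empty_iff_forall_notMem]; intro e he; rw [mem_ec] at he; simp at he
      simp [this]; linarith⟩
  simp only [Finset.mem_filter, Finset.mem_powerset] at hW' hmin
  obtain ⟨hsub, hbig, hec⟩ := hW'
  have hdW' := hsd W' hsub
  by_cases h34 : ∑ v ∈ W', p v ≤ 3 / 4 * P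
  · refine ⟨W', hsub, h34, by linarith, ?_⟩
    refine le_of_mul_le_mul_right (hec.trans ?_) hP0
    exact mul_le_mul_of_nonneg_left (by linarith [hnn W']) (by positivity)
  · have hne : W'.Nonempty := by
      rw [Finset.nonempty_iff_ne_empty]; rintro rfl; simp at hbig; linarith
    obtain ⟨A0, hA0, hA1, hA2, hA3, hA4⟩ := SCW pt hpt inc hinc h2 p hp0 D hD1 hD W' hne (by
      intro v hv; have := hpW v (hsub hv); linarith)
    set P' := ∑ v ∈ W', p v with hP'
    have hLL : Real.sqrt (∑ e ∈ ins inc W', D e) ≤ L := by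
      apply Real.sqrt_le_sqrt
      apply Finset.sum_le_sum_of_subset_of_nonneg
      · intro e he; rw [mem_ins] at he ⊢; exact fun u hu => hsub (he u hu)
      · intro e _ _; linarith [hD1 e]
    -- choose the larger side
    obtain ⟨A, hA, hAne, hlarge, hcut⟩ : ∃ A ⊆ W', A ≠ W' ∧ P' ≤ 2 * ∑ v ∈ A, p v ∧
        ((ec inc A (W' \ A)).card : ℝ) * P' ≤ 10 ^ 6 * L * ∑ v ∈ W' \ A, p v := by
      have hs : ∑ v ∈ W' \ A0, p v = P' - ∑ v ∈ A0, p v := by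
        rw [hP', ← Finset.sum_sdiff hA0]; ring
      by_cases hl : P' ≤ 2 * ∑ v ∈ A0, p v
      · exact ⟨A0, hA0, hA2, hl, hA4.trans (mul_le_mul_of_nonneg_right (by linarith) (hnn _))⟩
      · refine ⟨W' \ A0, Finset.sdiff_subset, ?_, by linarith, ?_⟩
        · intro h
          obtain ⟨x, hx⟩ := hA1
          have := hA0 hx
          rw [← h, Finset.mem_sdiff] at this
          exact this.2 hx
        · have e1 : W' \ (W' \ A0) = A0 := by rw [Finset.sdiff_sdiff_eq_self hA0]
          have e2 : ec inc (W' \ A0) A0 = ec inc A0 (W' \ A0) := by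
            ext e; rw [mem_ec, mem_ec, and_comm]
          rw [e1, e2]
          exact hA3.trans (mul_le_mul_of_nonneg_right (by linarith) (hnn _))
    have hAW := hA.trans hsub
    have hsA := hsd A hAW
    have hs' : ∑ v ∈ W' \ A, p v = P' - ∑ v ∈ A, p v := by
      rw [hP', ← Finset.sum_sdiff hA]; ring
    have hcc : (ec inc A (W \ A)).card ≤ (ec inc W' (W \ W')).card + (ec inc A (W' \ A)).card := by
      refine le_trans (Finset.card_le_card ?_) (Finset.card_union_le _ _)
      intro e he
      rw [mem_ec] at he
      obtain ⟨⟨u, hu, hu'⟩, v, hv, hv'⟩ := he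
      rw [Finset.mem_sdiff] at hv
      rw [Finset.mem_union, mem_ec, mem_ec]
      by_cases hvW : v ∈ W'
      · exact Or.inr ⟨⟨u, hu, hu'⟩, v, Finset.mem_sdiff.2 ⟨hvW, hv.2⟩, hv'⟩
      · exact Or.inl ⟨⟨u, hA hu, hu'⟩, v, Finset.mem_sdiff.2 ⟨hv.1, hvW⟩, hv'⟩
    have hcc' : ((ec inc A (W \ A)).card : ℝ) ≤ (ec inc W' (W \ W')).card + (ec inc A (W' \ A)).card := by
      exact_mod_cast hcc
    have hnew : ((ec inc A (W \ A)).card : ℝ) * P ≤ 2 * 10 ^ 6 * L * ∑ v ∈ W \ A, p v := by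
      have h1 : ((ec inc A (W' \ A)).card : ℝ) * P ≤ 2 * (10 ^ 6 * L * ∑ v ∈ W' \ A, p v) := by
        refine le_trans ?_ (mul_le_mul_of_nonneg_left hcut zero_le_two)
        have := mul_le_mul_of_nonneg_left hbig (Nat.cast_nonneg (α := ℝ) (ec inc A (W' \ A)).card)
        linarith
      have h2 := mul_le_mul_of_nonneg_right hcc' hP0.le
      rw [hsA]; rw [hs'] at h1; rw [hdW'] at hec
      nlinarith
    have hlt : ∑ v ∈ A, p v < P / 2 := by
      by_contra h
      have h3 := hmin A ⟨hAW, by linarith, hnew⟩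
      exact absurd (Finset.card_lt_card (Finset.ssubset_iff_subset_ne.2 ⟨hA, hAne⟩)) (not_lt.2 h3)
    refine ⟨A, hAW, by linarith, by linarith, ?_⟩
    refine le_of_mul_le_mul_right (hnew.trans ?_) hP0
    exact mul_le_mul_of_nonneg_left (by linarith [hnn A]) (by positivity)

end Host
end PCR

set_option linter.all false
open scoped BigOperators

namespace PCR

inductive Tr (V : Type) : Type
  | leaf (v : V) : Tr V
  | node (l r : Tr V) : Tr V

namespace Tr
variable {V : Type} [DecidableEq V]

def verts : Tr V → Finset V
  | leaf v => {v}
  | node l r => l.verts ∪ r.verts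

def dep {V : Type} : Tr V → ℕ
  | leaf _ => 0
  | node l r => max l.dep r.dep + 1

def isLeaf {V : Type} : Tr V → Prop
  | leaf _ => True
  | node _ _ => False

theorem verts_nonempty : ∀ t : Tr V, t.verts.Nonempty
  | leaf v => ⟨v, by simp [verts]⟩
  | node l r => by
    obtain ⟨x, hx⟩ := verts_nonempty l
    exact ⟨x, Finset.mem_union_left _ hx⟩

def Good {ι : Type} [Fintype ι] (inc : ι → V → Prop) (p : V → ℝ) (K : ℝ) : Tr V → Prop
  | leaf _ => True
  | node l r => Disjoint l.verts r.verts ∧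
      ((Host.ec inc l.verts r.verts).card : ℝ) ≤ K * Real.sqrt (∑ v ∈ l.verts ∪ r.verts, p v) ∧
      (l.isLeaf ∨ ∑ v ∈ l.verts, p v ≤ 35 / 36 * ∑ v ∈ l.verts ∪ r.verts, p v) ∧
      (r.isLeaf ∨ ∑ v ∈ r.verts, p v ≤ 35 / 36 * ∑ v ∈ l.verts ∪ r.verts, p v) ∧ Good inc p K l ∧ Good inc p K r

open Classical in
theorem exists_tree {X ι : Type} {H : Host X ι} [Fintype ι] [Fintype V] (pt : V → X) (hpt : Function.Injective pt) (inc : ι → V → Prop)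
    (hinc : ∀ e v, inc e v → pt v ∈ H.reg e) (h2 : ∀ e u v x, inc e u → inc e v → u ≠ v → inc e x → x = u ∨ x = v)
    (p : V → ℝ) (hp0 : ∀ v, 0 < p v)
    (D : ι → ℝ) (hD1 : ∀ e, 1 ≤ D e) (hD : ∀ e, ((Finset.univ.filter fun f => H.Tch e f).card : ℝ) ≤ D e)
    (hpD : ∀ W : Finset V, ∑ e ∈ Host.ins inc W, D e ≤ ∑ v ∈ W, p v)
    (hdeg : ∀ v, ((Finset.univ.filter fun e => inc e v).card : ℝ) ^ 2 ≤ p v) :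
    ∀ (n : ℕ) (W : Finset V), W.card = n → W.Nonempty → ∃ t : Tr V, t.verts = W ∧ t.Good inc p (2 * 10 ^ 6) := by
  intro n
  induction n using Nat.strong_induction_on with
  | _ n ih =>
    intro W hn hW
    by_cases h1 : W.card = 1
    · obtain ⟨v, rfl⟩ := Finset.card_eq_one.1 h1
      exact ⟨leaf v, rfl, trivial⟩
    have hcard : 1 < W.card := by have := hW.card_pos; omega
    have hP0 : 0 < ∑ v ∈ W, p v := Finset.sum_pos (fun v _ => hp0 v) hW
    by_cases hb : ∀ v ∈ W, 36 * p v ≤ ∑ u ∈ W, p u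
    · obtain ⟨B, hB, hB1, hB2, hB3⟩ := Host.SEP pt hpt inc hinc h2 p hp0 D hD1 hD W hW hb
      have hs : ∑ v ∈ W \ B, p v = ∑ v ∈ W, p v - ∑ v ∈ B, p v := by
        rw [← Finset.sum_sdiff hB]; ring
      have hBne : B.Nonempty := by
        rw [Finset.nonempty_iff_ne_empty]; rintro rfl; simp at hs hB2; linarith
      have hBne' : (W \ B).Nonempty := by
        rw [Finset.nonempty_iff_ne_empty]; intro h; rw [h] at hs; simp at hs; linarith
      have hc := Finset.card_sdiff_add_card_eq_card hB
      have c1 := hBne.card_pos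
      have c2 := hBne'.card_pos
      obtain ⟨l, hl, hlg⟩ := ih B.card (by omega) B rfl hBne
      obtain ⟨r, hr, hrg⟩ := ih (W \ B).card (by omega) (W \ B) rfl hBne'
      have hu : B ∪ W \ B = W := Finset.union_sdiff_of_subset hB
      refine ⟨node l r, by rw [verts, hl, hr, hu], ?_⟩
      simp only [Good, hl, hr, hu]
      refine ⟨Finset.disjoint_sdiff, ?_, Or.inr (by linarith), Or.inr (by linarith), hlg, hrg⟩
      exact hB3.trans (mul_le_mul_of_nonneg_left (Real.sqrt_le_sqrt (hpD W)) (by norm_num))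
    · push Not at hb
      obtain ⟨v, hv, hvb⟩ := hb
      have hs := Finset.sum_erase_eq_sub (f := p) hv
      have hc := Finset.card_erase_of_mem hv
      obtain ⟨r, hr, hrg⟩ := ih (W.erase v).card (by omega) (W.erase v) rfl (Finset.card_pos.1 (by omega))
      have hu : {v} ∪ W.erase v = W := by rw [← Finset.insert_eq, Finset.insert_erase hv]
      refine ⟨node (leaf v) r, by rw [verts, hr]; exact hu, ?_⟩
      simp only [Good, verts, hr, hu]
      refine ⟨by simp, ?_, Or.inl trivial, Or.inr (by linarith), trivial, hrg⟩
      have h3 : (Host.ec inc {v} (W.erase v)).card ≤ (Finset.univ.filter fun e => inc e v).card := by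
        apply Finset.card_le_card
        intro e he
        rw [Host.mem_ec] at he
        obtain ⟨⟨u, hu, h⟩, _⟩ := he
        rw [Finset.mem_singleton] at hu
        subst hu
        simpa using h
      have h4 : ((Finset.univ.filter fun e => inc e v).card : ℝ) ≤ Real.sqrt (∑ v ∈ W, p v) := by
        apply Real.le_sqrt_of_sq_le
        exact (hdeg v).trans (Finset.single_le_sum (f := p) (fun i _ => (hp0 i).le) hv)
      have h5 : ((Host.ec inc {v} (W.erase v)).card : ℝ) ≤ (Finset.univ.filter fun e => inc e v).card := by exact_mod_cast h3
      have := Real.sqrt_nonneg (∑ v ∈ W, p v)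
      linarith

theorem dep_le {ι : Type} [Fintype ι] {inc : ι → V → Prop} {p : V → ℝ} {K : ℝ} {m : ℝ} (hm : 0 < m) (hp : ∀ v, m ≤ p v) :
    ∀ t : Tr V, t.Good inc p K → (t.dep : ℝ) ≤ 1 + 36 * Real.log ((∑ v ∈ t.verts, p v) / m) := by
  have hpos : ∀ t : Tr V, m ≤ ∑ v ∈ t.verts, p v := by
    intro t
    obtain ⟨x, hx⟩ := t.verts_nonempty
    exact (hp x).trans (Finset.single_le_sum (f := p) (fun i _ => hm.le.trans (hp i)) hx)
  have hlog : ∀ t : Tr V, 0 ≤ Real.log ((∑ v ∈ t.verts, p v) / m) := by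
    intro t
    apply Real.log_nonneg
    rw [le_div_iff₀ hm, one_mul]; exact hpos t
  have hg : Real.log (35 / 36) ≤ - 1 / 36 := by
    have := Real.log_le_sub_one_of_pos (show (0:ℝ) < 35 / 36 by norm_num)
    linarith
  intro t
  induction t with
  | leaf v => intro _; have := hlog (leaf v); simp only [dep, Nat.cast_zero]; linarith
  | node l r ihl ihr =>
    rintro ⟨hd, hec, h1, h2, hl, hr⟩
    have key : ∀ s : Tr V, (s.isLeaf ∨ ∑ v ∈ s.verts, p v ≤ 35 / 36 * ∑ v ∈ l.verts ∪ r.verts, p v) →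
        ((s.dep : ℝ) ≤ 1 + 36 * Real.log ((∑ v ∈ s.verts, p v) / m)) →
        (s.dep : ℝ) ≤ 36 * Real.log ((∑ v ∈ (node l r).verts, p v) / m) := by
      intro s hs hs2
      rcases hs with hs | hs
      · cases s with
        | leaf v => have := hlog (node l r); simp only [dep, Nat.cast_zero]; linarith
        | node _ _ => exact hs.elim
      · have h0 := hpos s
        have h0' := hpos (node l r)
        have e1 : Real.log ((∑ v ∈ s.verts, p v) / m) ≤ Real.log (35 / 36 * ((∑ v ∈ (node l r).verts, p v) / m)) := by
          apply Real.log_le_log (div_pos (by linarith) hm)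
          rw [mul_div_assoc']
          exact div_le_div_of_nonneg_right hs hm.le
        rw [Real.log_mul (by norm_num) (div_pos (by linarith) hm).ne'] at e1
        linarith
    have k1 := key l h1 (ihl hl)
    have k2 := key r h2 (ihr hr)
    simp only [dep]
    push_cast
    have := max_le k1 k2
    linarith

end Tr
end PCR

set_option linter.all false
open scoped BigOperators

namespace PCR

def ori (a b c : ℝ × ℝ) : ℝ := (b.1 - a.1) * (c.2 - a.2) - (b.2 - a.2) * (c.1 - a.1)

theorem ori_swap (a b c : ℝ × ℝ) : ori b a c = - ori a b c := by simp only [ori]; ring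

theorem ori_comb (a b x y : ℝ × ℝ) (s t : ℝ) (h : s + t = 1) :
    ori a b (s • x + t • y) = s * ori a b x + t * ori a b y := by
  have : s = 1 - t := by linarith
  subst this
  simp only [ori, Prod.fst_add, Prod.snd_add, Prod.smul_fst, Prod.smul_snd, smul_eq_mul]; ring

def OneSide (a b : ℝ × ℝ) (T : Set (ℝ × ℝ)) : Prop := (∀ c ∈ T, 0 < ori a b c) ∨ (∀ c ∈ T, ori a b c < 0)

def Sep (A B : Set (ℝ × ℝ)) : Prop :=
  ∃ α β k : ℝ, (∀ x ∈ A, α * x.1 + β * x.2 < k) ∧ ∀ y ∈ B, k < α * y.1 + β * y.2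

theorem Sep.symm {A B : Set (ℝ × ℝ)} (h : Sep A B) : Sep B A := by
  obtain ⟨α, β, k, h1, h2⟩ := h
  exact ⟨-α, -β, -k, fun x hx => by have := h2 x hx; linarith, fun x hx => by have := h1 x hx; linarith⟩

theorem Sep.disj {A B : Set (ℝ × ℝ)} (h : Sep A B) {x : ℝ × ℝ} (hA : x ∈ A) (hB : x ∈ B) : False := by
  obtain ⟨α, β, k, h1, h2⟩ := h
  linarith [h1 x hA, h2 x hB]

theorem Sep.mono {A B A' B' : Set (ℝ × ℝ)} (h : Sep A B) (hA : A' ⊆ A) (hB : B' ⊆ B) : Sep A' B' := by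
  obtain ⟨α, β, k, h1, h2⟩ := h
  exact ⟨α, β, k, fun x hx => h1 x (hA hx), fun x hx => h2 x (hB hx)⟩

theorem convex_lin (α β : ℝ) (T : Set ℝ) (hT : Convex ℝ T) : Convex ℝ {x : ℝ × ℝ | α * x.1 + β * x.2 ∈ T} := by
  intro x hx y hy s t hs ht hst
  have := hT hx hy hs ht hst
  simp only [Set.mem_setOf_eq, smul_eq_mul, Prod.fst_add, Prod.snd_add, Prod.smul_fst, Prod.smul_snd] at this ⊢
  convert this using 1; ring

theorem convex_ori (a b : ℝ × ℝ) (T : Set ℝ) (hT : Convex ℝ T) : Convex ℝ {x : ℝ × ℝ | ori a b x ∈ T} := by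
  intro x hx y hy s t hs ht hst
  have := hT hx hy hs ht hst
  show ori a b (s • x + t • y) ∈ T
  rw [ori_comb _ _ _ _ _ _ hst]
  exact this

theorem Sep.hull {A B : Set (ℝ × ℝ)} (h : Sep A B) : ¬ (convexHull ℝ A ∩ convexHull ℝ B).Nonempty := by
  obtain ⟨α, β, k, h1, h2⟩ := h
  rintro ⟨x, hA, hB⟩
  have a1 := convexHull_min (t := {x : ℝ × ℝ | α * x.1 + β * x.2 ∈ Set.Iio k}) h1 (convex_lin α β _ (convex_Iio k)) hA
  have a2 := convexHull_min (t := {x : ℝ × ℝ | α * x.1 + β * x.2 ∈ Set.Ioi k}) h2 (convex_lin α β _ (convex_Ioi k)) hB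
  have a1' : α * x.1 + β * x.2 < k := a1
  have a2' : k < α * x.1 + β * x.2 := a2
  linarith

theorem OneSide.hull {a b : ℝ × ℝ} {B : Set (ℝ × ℝ)} (h : OneSide a b B) :
    ¬ (convexHull ℝ {a, b} ∩ convexHull ℝ B).Nonempty := by
  rintro ⟨x, hA, hB⟩
  have a1 := convexHull_min (t := {x : ℝ × ℝ | ori a b x ∈ ({0} : Set ℝ)}) (by
    intro y hy
    rcases hy with rfl | rfl
    · show ori _ _ _ = 0; simp [ori]
    · show ori _ _ _ = 0; simp only [ori]; ring) (convex_ori a b _ (convex_singleton 0)) hA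
  replace a1 : ori a b x = 0 := a1
  rcases h with h | h
  · have a2 : 0 < ori a b x := convexHull_min (t := {x : ℝ × ℝ | ori a b x ∈ Set.Ioi 0}) h (convex_ori a b _ (convex_Ioi 0)) hB
    linarith
  · have a2 : ori a b x < 0 := convexHull_min (t := {x : ℝ × ℝ | ori a b x ∈ Set.Iio 0}) h (convex_ori a b _ (convex_Iio 0)) hB
    linarith

theorem OneSide.mono {a b : ℝ × ℝ} {A B : Set (ℝ × ℝ)} (h : OneSide a b B) (hA : A ⊆ B) : OneSide a b A :=
  h.imp (fun h c hc => h c (hA hc)) (fun h c hc => h c (hA hc))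

theorem OneSide.swap {a b : ℝ × ℝ} {A : Set (ℝ × ℝ)} (h : OneSide a b A) : OneSide b a A :=
  h.symm.imp (fun h c hc => by rw [ori_swap]; linarith [h c hc]) (fun h c hc => by rw [ori_swap]; linarith [h c hc])

inductive CT : Type
  | pt (x : ℝ × ℝ) : CT
  | br (c : Fin 3 → CT) : CT

namespace CT

def pts : CT → Set (ℝ × ℝ)
  | pt x => {x}
  | br c => ⋃ i, (c i).pts

def rep : CT → ℝ × ℝ
  | pt x => x
  | br c => (c 0).rep

theorem rep_mem : ∀ c : CT, c.rep ∈ c.pts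
  | pt x => rfl
  | br c => Set.mem_iUnion.2 ⟨0, rep_mem (c 0)⟩

def good : CT → Prop
  | pt _ => True
  | br c => (∀ i, (c i).good) ∧ (∀ i j, i ≠ j → Sep (c i).pts (c j).pts) ∧
      ∀ a b, a ≠ b → ∃ i, OneSide a b (c i).pts

def full : ℕ → CT → Prop
  | 0, _ => True
  | _ + 1, pt _ => False
  | d + 1, br c => ∀ i, full d (c i)

theorem full_mono : ∀ {d d' : ℕ} {c : CT}, d' ≤ d → full d c → full d' c
  | _, 0, _, _, _ => trivial
  | d + 1, d' + 1, pt _, _, h => h.elim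
  | d + 1, d' + 1, br c, hd, h => fun i => full_mono (Nat.le_of_succ_le_succ hd) (h i)

end CT

def Q6 : Finset (Fin 3 × Fin 3) := Finset.univ.filter fun x => x.1 ≠ x.2

theorem Q6_card : Q6.card = 6 := by decide

section
variable {V : Type} [DecidableEq V]

def comb (l : Tr V) (f g : V → ℝ × ℝ) : V → ℝ × ℝ := fun x => if x ∈ l.verts then f x else g x

noncomputable def EE : Tr V → CT → ((V → ℝ × ℝ) → ℝ) → ℝ
  | Tr.leaf _, c, φ => φ (fun _ => c.rep)
  | Tr.node _ _, CT.pt x, φ => φ (fun _ => x)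
  | Tr.node l r, CT.br c, φ => (1 / 6) * ∑ ij ∈ Q6, EE l (c ij.1) (fun f => EE r (c ij.2) (fun g => φ (comb l f g)))

theorem EE_add : ∀ (t : Tr V) (c : CT) (φ ψ : (V → ℝ × ℝ) → ℝ), EE t c (fun f => φ f + ψ f) = EE t c φ + EE t c ψ
  | Tr.leaf _, c, φ, ψ => rfl
  | Tr.node _ _, CT.pt x, φ, ψ => rfl
  | Tr.node l r, CT.br c, φ, ψ => by
    simp only [EE]
    rw [← mul_add, ← Finset.sum_add_distrib]
    congr 1
    refine Finset.sum_congr rfl fun ij _ => ?_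
    rw [← EE_add l]
    congr 1
    ext f
    rw [← EE_add r]

theorem EE_mul : ∀ (t : Tr V) (c : CT) (k : ℝ) (φ : (V → ℝ × ℝ) → ℝ), EE t c (fun f => k * φ f) = k * EE t c φ
  | Tr.leaf _, c, k, φ => rfl
  | Tr.node _ _, CT.pt x, k, φ => rfl
  | Tr.node l r, CT.br c, k, φ => by
    have : ∀ ij : Fin 3 × Fin 3, EE l (c ij.1) (fun f => EE r (c ij.2) (fun g => k * φ (comb l f g))) =
        k * EE l (c ij.1) (fun f => EE r (c ij.2) (fun g => φ (comb l f g))) := by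
      intro ij
      rw [← EE_mul l]
      congr 1
      ext f
      rw [← EE_mul r]
    simp only [EE, this, ← Finset.mul_sum]
    ring

theorem EE_const : ∀ (t : Tr V) (c : CT) (k : ℝ), EE t c (fun _ => k) = k
  | Tr.leaf _, c, k => rfl
  | Tr.node _ _, CT.pt x, k => rfl
  | Tr.node l r, CT.br c, k => by
    simp only [EE, EE_const l, EE_const r]
    rw [Finset.sum_const, Q6_card]; simp

theorem EE_sum {α : Type} (t : Tr V) (c : CT) (s : Finset α) (φ : α → (V → ℝ × ℝ) → ℝ) :
    EE t c (fun f => ∑ a ∈ s, φ a f) = ∑ a ∈ s, EE t c (φ a) := by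
  classical
  induction s using Finset.induction_on with
  | empty => simp [EE_const]
  | insert a s ha ih =>
    rw [Finset.sum_insert ha, ← ih, ← EE_add]
    congr 1; ext f; rw [Finset.sum_insert ha]

theorem EE_comm (t : Tr V) (c : CT) : ∀ (s : Tr V) (d : CT) (φ : (V → ℝ × ℝ) → (V → ℝ × ℝ) → ℝ),
    EE t c (fun f => EE s d (fun g => φ f g)) = EE s d (fun g => EE t c (fun f => φ f g))
  | Tr.leaf _, d, φ => rfl
  | Tr.node _ _, CT.pt x, φ => rfl
  | Tr.node l r, CT.br d, φ => by
    simp only [EE]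
    rw [EE_mul, EE_sum]
    congr 1
    refine Finset.sum_congr rfl fun ij _ => ?_
    rw [EE_comm t c l]
    congr 1
    ext f
    rw [EE_comm t c r]

def Adm (t : Tr V) (c : CT) (f : V → ℝ × ℝ) : Prop := (∀ x ∈ t.verts, f x ∈ c.pts) ∧ Set.InjOn f t.verts

theorem comb_left {l : Tr V} {f g : V → ℝ × ℝ} {x : V} (hx : x ∈ l.verts) : comb l f g x = f x := if_pos hx

theorem comb_right {l r : Tr V} (hd : Disjoint l.verts r.verts) {f g : V → ℝ × ℝ} {x : V} (hx : x ∈ r.verts) :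
    comb l f g x = g x := if_neg fun h => (Finset.disjoint_left.1 hd h hx)

theorem Adm_comb {l r : Tr V} {c : Fin 3 → CT} (hd : Disjoint l.verts r.verts) (hg : (CT.br c).good) {i j : Fin 3} (hij : i ≠ j)
    {f g : V → ℝ × ℝ} (hf : Adm l (c i) f) (hg' : Adm r (c j) g) : Adm (Tr.node l r) (CT.br c) (comb l f g) := by
  constructor
  · intro x hx
    rcases Finset.mem_union.1 hx with h | h
    · rw [comb_left h]; exact Set.mem_iUnion.2 ⟨i, hf.1 x h⟩
    · rw [comb_right hd h]; exact Set.mem_iUnion.2 ⟨j, hg'.1 x h⟩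
  · intro x hx y hy hxy
    rcases Finset.mem_union.1 (Finset.mem_coe.1 hx) with h | h <;> rcases Finset.mem_union.1 (Finset.mem_coe.1 hy) with h' | h'
    · rw [comb_left h, comb_left h'] at hxy; exact hf.2 h h' hxy
    · rw [comb_left h, comb_right hd h'] at hxy
      exact ((hg.2.1 i j hij).disj (hf.1 x h) (hxy ▸ hg'.1 y h')).elim
    · rw [comb_right hd h, comb_left h'] at hxy
      exact ((hg.2.1 i j hij).disj (hf.1 y h') (hxy ▸ hg'.1 x h)).elim
    · rw [comb_right hd h, comb_right hd h'] at hxy; exact hg'.2 h h' hxy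

variable {ι : Type} [Fintype ι] {inc : ι → V → Prop} {p : V → ℝ} {K : ℝ}

theorem full_left {l r : Tr V} {c : Fin 3 → CT} (h : (CT.br c).full (Tr.node l r).dep) (i : Fin 3) : (c i).full l.dep :=
  CT.full_mono (le_max_left _ _) (h i)

theorem full_right {l r : Tr V} {c : Fin 3 → CT} (h : (CT.br c).full (Tr.node l r).dep) (i : Fin 3) : (c i).full r.dep :=
  CT.full_mono (le_max_right _ _) (h i)

theorem EE_mono : ∀ (t : Tr V) (c : CT), t.Good inc p K → c.good → c.full t.dep → ∀ (φ ψ : (V → ℝ × ℝ) → ℝ),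
    (∀ f, Adm t c f → φ f ≤ ψ f) → EE t c φ ≤ EE t c ψ
  | Tr.leaf v, c, _, _, _, φ, ψ, h => h _ ⟨fun _ _ => c.rep_mem, by simp [Tr.verts]⟩
  | Tr.node _ _, CT.pt x, _, _, hf, φ, ψ, h => hf.elim
  | Tr.node l r, CT.br c, hG, hg, hf, φ, ψ, h => by
    simp only [EE]
    refine mul_le_mul_of_nonneg_left (Finset.sum_le_sum fun ij hij => ?_) (by norm_num)
    obtain ⟨hd, _, _, _, hGl, hGr⟩ := hG
    refine EE_mono l _ hGl (hg.1 _) (full_left hf _) _ _ fun f hf' => ?_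
    refine EE_mono r _ hGr (hg.1 _) (full_right hf _) _ _ fun g hg' => ?_
    exact h _ (Adm_comb hd hg (Finset.mem_filter.1 hij).2 hf' hg')

theorem EE_exists (t : Tr V) (c : CT) (hG : t.Good inc p K) (hg : c.good) (hf : c.full t.dep) (φ : (V → ℝ × ℝ) → ℝ) :
    ∃ f, Adm t c f ∧ φ f ≤ EE t c φ := by
  by_contra hno
  push Not at hno
  have hfin : ∃ f, Adm t c f := by
    by_contra h; push Not at h
    have := EE_mono t c hG hg hf (fun _ => 1) (fun _ => 0) (fun f hf => (h f hf).elim)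
    rw [EE_const, EE_const] at this; linarith
  -- use the truncated function
  have h1 : ∀ (t : Tr V) (c : CT), t.Good inc p K → c.good → c.full t.dep → ∀ (φ : (V → ℝ × ℝ) → ℝ) (k : ℝ),
      (∀ f, Adm t c f → k < φ f) → k < EE t c φ := by
    intro t
    induction t with
    | leaf v => intro c _ _ _ φ k h; exact h _ ⟨fun _ _ => c.rep_mem, by simp [Tr.verts]⟩
    | node l r ihl ihr =>
      intro c hG hg hf φ k h
      cases c with
      | pt x => exact hf.elim
      | br c =>
        obtain ⟨hd, _, _, _, hGl, hGr⟩ := hG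
        have : ∑ ij ∈ Q6, k < ∑ ij ∈ Q6, EE l (c ij.1) (fun f => EE r (c ij.2) (fun g => φ (comb l f g))) := by
          refine Finset.sum_lt_sum_of_nonempty (Finset.card_pos.1 (by rw [Q6_card]; norm_num)) fun ij hij => ?_
          refine ihl _ hGl (hg.1 _) (full_left hf _) _ _ fun f hf' => ?_
          refine ihr _ hGr (hg.1 _) (full_right hf _) _ _ fun g hg' => ?_
          exact h _ (Adm_comb hd hg (Finset.mem_filter.1 hij).2 hf' hg')
        rw [Finset.sum_const, Q6_card] at this
        simp only [EE]
        simp only [nsmul_eq_mul, Nat.cast_ofNat] at this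
        linarith
  exact lt_irrefl _ (h1 t c hG hg hf φ _ hno)

end
end PCR

set_option linter.all false
open scoped BigOperators

namespace PCR
section
variable {V : Type} [DecidableEq V] {ι : Type} [Fintype ι]

open Classical in
noncomputable def stab (inc : ι → V → Prop) (t : Tr V) (f : V → ℝ × ℝ) (a b : ℝ × ℝ) : ℝ :=
  ∑ e ∈ Host.ins inc t.verts, if OneSide a b (f '' {v | inc e v}) then 0 else 1

open Classical in
noncomputable def mt (inc : ι → V → Prop) (f : V → ℝ × ℝ) (e e' : ι) : ℝ :=
  if (convexHull ℝ (f '' {v | inc e v}) ∩ convexHull ℝ (f '' {v | inc e' v})).Nonempty then 1 else 0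

noncomputable def TT (inc : ι → V → Prop) (t : Tr V) (f : V → ℝ × ℝ) : ℝ :=
  ∑ e ∈ Host.ins inc t.verts, ∑ e' ∈ Host.ins inc t.verts, mt inc f e e'

noncomputable def PP (p : V → ℝ) (t : Tr V) : ℝ := ∑ v ∈ t.verts, p v

variable {inc : ι → V → Prop} {p : V → ℝ} {K : ℝ}

theorem mt_nonneg (f : V → ℝ × ℝ) (e e' : ι) : 0 ≤ mt inc f e e' := by unfold mt; split_ifs <;> norm_num
theorem mt_le (f : V → ℝ × ℝ) (e e' : ι) : mt inc f e e' ≤ 1 := by unfold mt; split_ifs <;> norm_num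
theorem mt_comm (f : V → ℝ × ℝ) (e e' : ι) : mt inc f e e' = mt inc f e' e := by unfold mt; rw [Set.inter_comm]

theorem ins_leaf (hinc2 : ∀ e, ∃ u v, u ≠ v ∧ inc e u ∧ inc e v) (v : V) : Host.ins inc (Tr.leaf v).verts = ∅ := by
  ext e
  rw [Host.mem_ins]
  constructor
  · intro h
    obtain ⟨a, b, hab, ha, hb⟩ := hinc2 e
    have h1 := h a ha; have h2 := h b hb
    simp only [Tr.verts, Finset.mem_singleton] at h1 h2
    exact (hab (h1.trans h2.symm)).elim
  · intro h; simp at h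

theorem ins_sum_le (l r : Tr V) (F : ι → ℝ) (hF : ∀ e, 0 ≤ F e) :
    ∑ e ∈ Host.ins inc (Tr.node l r).verts, F e ≤ ∑ e ∈ Host.ins inc l.verts, F e + ∑ e ∈ Host.ins inc r.verts, F e +
      ∑ e ∈ Host.ec inc l.verts r.verts, F e := by
  classical
  have hsub : Host.ins inc (Tr.node l r).verts ⊆ (Host.ins inc l.verts ∪ Host.ins inc r.verts) ∪ Host.ec inc l.verts r.verts := by
    intro e he
    rw [Host.mem_ins] at he
    rw [Finset.mem_union, Finset.mem_union, Host.mem_ins, Host.mem_ins, Host.mem_ec]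
    by_cases h1 : ∀ u, inc e u → u ∈ l.verts
    · exact Or.inl (Or.inl h1)
    by_cases h2 : ∀ u, inc e u → u ∈ r.verts
    · exact Or.inl (Or.inr h2)
    push Not at h1 h2
    obtain ⟨u, hu, hu'⟩ := h1
    obtain ⟨v, hv, hv'⟩ := h2
    refine Or.inr ⟨⟨v, ?_, hv⟩, ⟨u, ?_, hu⟩⟩
    · exact (Finset.mem_union.1 (he v hv)).resolve_right hv'
    · exact (Finset.mem_union.1 (he u hu)).resolve_left hu'
  have hun : ∀ A B : Finset ι, ∑ e ∈ A ∪ B, F e ≤ ∑ e ∈ A, F e + ∑ e ∈ B, F e := by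
    intro A B
    rw [← Finset.sum_union_inter]
    linarith [Finset.sum_nonneg (s := A ∩ B) fun e _ => hF e]
  calc _ ≤ _ := Finset.sum_le_sum_of_subset_of_nonneg hsub fun e _ _ => hF e
    _ ≤ _ := hun _ _
    _ ≤ _ := by linarith [hun (Host.ins inc l.verts) (Host.ins inc r.verts)]

theorem img_left {l : Tr V} {f g : V → ℝ × ℝ} {e : ι} (he : e ∈ Host.ins inc l.verts) :
    comb l f g '' {v | inc e v} = f '' {v | inc e v} :=
  Set.image_congr fun v hv => comb_left (Host.mem_ins.1 he v hv)

theorem img_right {l r : Tr V} (hd : Disjoint l.verts r.verts) {f g : V → ℝ × ℝ} {e : ι} (he : e ∈ Host.ins inc r.verts) :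
    comb l f g '' {v | inc e v} = g '' {v | inc e v} :=
  Set.image_congr fun v hv => comb_right hd (Host.mem_ins.1 he v hv)

theorem img_sub {t : Tr V} {c : CT} {f : V → ℝ × ℝ} (hf : Adm t c f) {e : ι} (he : e ∈ Host.ins inc t.verts) :
    f '' {v | inc e v} ⊆ c.pts := by
  rintro _ ⟨v, hv, rfl⟩
  exact hf.1 v (Host.mem_ins.1 he v hv)

theorem stab_node {l r : Tr V} (hd : Disjoint l.verts r.verts) (f g : V → ℝ × ℝ) (a b : ℝ × ℝ) :
    stab inc (Tr.node l r) (comb l f g) a b ≤ stab inc l f a b + stab inc r g a b + (Host.ec inc l.verts r.verts).card := by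
  classical
  unfold stab
  refine (ins_sum_le l r _ fun e => by split_ifs <;> norm_num).trans ?_
  refine add_le_add (add_le_add (le_of_eq ?_) (le_of_eq ?_)) ?_
  · exact Finset.sum_congr rfl fun e he => by rw [img_left he]
  · exact Finset.sum_congr rfl fun e he => by rw [img_right hd he]
  · calc _ ≤ ∑ e ∈ Host.ec inc l.verts r.verts, (1 : ℝ) := Finset.sum_le_sum fun e _ => by split_ifs <;> norm_num
      _ = _ := by simp

theorem stab_zero {t : Tr V} {c : CT} {f : V → ℝ × ℝ} (hf : Adm t c f) {a b : ℝ × ℝ} (h : OneSide a b c.pts) :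
    stab inc t f a b = 0 := by
  unfold stab
  exact Finset.sum_eq_zero fun e he => if_pos (h.mono (img_sub hf he))

theorem stab_swap (t : Tr V) (f : V → ℝ × ℝ) (a b : ℝ × ℝ) : stab inc t f a b = stab inc t f b a := by
  unfold stab
  refine Finset.sum_congr rfl fun e he => ?_
  have : OneSide a b (f '' {v | inc e v}) ↔ OneSide b a (f '' {v | inc e v}) := ⟨OneSide.swap, OneSide.swap⟩
  by_cases h : OneSide a b (f '' {v | inc e v})
  · rw [if_pos h, if_pos (this.1 h)]
  · rw [if_neg h, if_neg (fun h' => h (this.2 h'))]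

theorem stab_leaf (hinc2 : ∀ e, ∃ u v, u ≠ v ∧ inc e u ∧ inc e v) (v : V) (f : V → ℝ × ℝ) (a b : ℝ × ℝ) :
    stab inc (Tr.leaf v) f a b = 0 := by
  unfold stab; rw [ins_leaf hinc2]; simp

theorem PP_nonneg (hp0 : ∀ v, 0 ≤ p v) (t : Tr V) : 0 ≤ PP p t := Finset.sum_nonneg fun v _ => hp0 v

theorem PP_node {l r : Tr V} (hd : Disjoint l.verts r.verts) : PP p (Tr.node l r) = PP p l + PP p r := Finset.sum_union hd

theorem EE_node_le (l r : Tr V) (c : Fin 3 → CT) (φ : (V → ℝ × ℝ) → ℝ) (B : ℝ)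
    (h : ∀ i j, i ≠ j → EE l (c i) (fun f => EE r (c j) (fun g => φ (comb l f g))) ≤ B) :
    EE (Tr.node l r) (CT.br c) φ ≤ B := by
  simp only [EE]
  have : ∑ ij ∈ Q6, EE l (c ij.1) (fun f => EE r (c ij.2) (fun g => φ (comb l f g))) ≤ ∑ ij ∈ Q6, B :=
    Finset.sum_le_sum fun ij hij => h _ _ (Finset.mem_filter.1 hij).2
  rw [Finset.sum_const, Q6_card, nsmul_eq_mul] at this
  push_cast at this
  linarith

theorem Q6_sum (F : Fin 3 → Fin 3 → ℝ) : ∑ ij ∈ Q6, F ij.1 ij.2 = F 0 1 + F 0 2 + F 1 0 + F 1 2 + F 2 0 + F 2 1 := by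
  have : Q6 = {(0,1),(0,2),(1,0),(1,2),(2,0),(2,1)} := by decide
  rw [this]
  rw [Finset.sum_insert (by decide), Finset.sum_insert (by decide), Finset.sum_insert (by decide), Finset.sum_insert (by decide),
    Finset.sum_insert (by decide), Finset.sum_singleton]
  ring

theorem EX (hK : 0 ≤ K) (hp0 : ∀ v, 0 ≤ p v) (hinc2 : ∀ e, ∃ u v, u ≠ v ∧ inc e u ∧ inc e v) {a b : ℝ × ℝ} (hab : a ≠ b) :
    ∀ (t : Tr V) (c : CT), t.Good inc p K → c.good → c.full t.dep →
    EE t c (fun f => stab inc t f a b) ≤ 20 * K * Real.sqrt (PP p t)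
  | Tr.leaf v, c, _, _, _ => by
    simp only [EE, stab_leaf hinc2]; positivity
  | Tr.node _ _, CT.pt x, _, _, hf => hf.elim
  | Tr.node l r, CT.br c, hG, hg, hf => by
    have hG0 := hG
    obtain ⟨hd, hec, _, _, hGl, hGr⟩ := hG
    replace hec : ((Host.ec inc l.verts r.verts).card : ℝ) ≤ K * Real.sqrt (PP p (Tr.node l r)) := hec
    have ihl := fun i => EX hK hp0 hinc2 hab l (c i) hGl (hg.1 i) (full_left hf i)
    have ihr := fun i => EX hK hp0 hinc2 hab r (c i) hGr (hg.1 i) (full_right hf i)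
    obtain ⟨i0, hi0⟩ := hg.2.2 a b hab
    have hx0 : EE l (c i0) (fun f => stab inc l f a b) ≤ 0 := by
      have := EE_mono l (c i0) hGl (hg.1 _) (full_left hf _) (fun f => stab inc l f a b) (fun _ => 0)
        (fun f hf' => (stab_zero hf' hi0).le)
      rwa [EE_const] at this
    have hy0 : EE r (c i0) (fun f => stab inc r f a b) ≤ 0 := by
      have := EE_mono r (c i0) hGr (hg.1 _) (full_right hf _) (fun f => stab inc r f a b) (fun _ => 0)
        (fun f hf' => (stab_zero hf' hi0).le)
      rwa [EE_const] at this
    generalize hx : (fun i => EE l (c i) (fun f => stab inc l f a b)) = x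
    generalize hy : (fun i => EE r (c i) (fun f => stab inc r f a b)) = y
    have hxi : ∀ i, x i ≤ 20 * K * Real.sqrt (PP p l) := fun i => by rw [← hx]; exact ihl i
    have hyi : ∀ i, y i ≤ 20 * K * Real.sqrt (PP p r) := fun i => by rw [← hy]; exact ihr i
    replace hx0 : x i0 ≤ 0 := by rw [← hx]; exact hx0
    replace hy0 : y i0 ≤ 0 := by rw [← hy]; exact hy0
    have hstep : ∀ ij ∈ Q6, EE l (c ij.1) (fun f => EE r (c ij.2) (fun g => stab inc (Tr.node l r) (comb l f g) a b)) ≤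
        (fun i j => x i + y j + (Host.ec inc l.verts r.verts).card) ij.1 ij.2 := by
      intro ij _
      calc _ ≤ EE l (c ij.1) (fun f => EE r (c ij.2) (fun g => stab inc l f a b + stab inc r g a b + (Host.ec inc l.verts r.verts).card)) :=
            EE_mono l _ hGl (hg.1 _) (full_left hf _) _ _ fun f _ => EE_mono r _ hGr (hg.1 _) (full_right hf _) _ _ fun g _ =>
              stab_node hd f g a b
        _ = _ := by simp only [EE_add, EE_const, ← hx, ← hy]
    have hsum := Finset.sum_le_sum hstep
    rw [Q6_sum (fun i j => x i + y j + (Host.ec inc l.verts r.verts).card)] at hsum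
    beta_reduce at hsum
    show (1 / 6 : ℝ) * _ ≤ _
    have hP := PP_node (p := p) hd
    have hl0 := PP_nonneg hp0 l
    have hr0 := PP_nonneg hp0 r
    have hsq : Real.sqrt (PP p l) + Real.sqrt (PP p r) ≤ 1.4143 * Real.sqrt (PP p (Tr.node l r)) := by
      refine abs_le_of_sq_le_sq' ?_ (by positivity) |>.2
      have e1 := Real.sq_sqrt hl0
      have e2 := Real.sq_sqrt hr0
      have e3 := Real.sq_sqrt (PP_nonneg hp0 (Tr.node l r))
      rw [hP] at e3
      rw [hP]
      nlinarith [sq_nonneg (Real.sqrt (PP p l) - Real.sqrt (PP p r))]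
    have hx2 : x 0 + x 1 + x 2 ≤ 2 * (20 * K * Real.sqrt (PP p l)) := by
      have h0 := hxi 0; have h1 := hxi 1; have h2 := hxi 2
      fin_cases i0 <;> simp only [Fin.zero_eta, Fin.mk_one, Fin.reduceFinMk, Fin.isValue] at hx0 <;> linarith
    have hy2 : y 0 + y 1 + y 2 ≤ 2 * (20 * K * Real.sqrt (PP p r)) := by
      have h0 := hyi 0; have h1 := hyi 1; have h2 := hyi 2
      fin_cases i0 <;> simp only [Fin.zero_eta, Fin.mk_one, Fin.reduceFinMk, Fin.isValue] at hy0 <;> linarith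
    have hs2 := mul_le_mul_of_nonneg_left hsq hK
    have hs0 := mul_nonneg hK (Real.sqrt_nonneg (PP p (Tr.node l r)))
    nlinarith

theorem sqrt_child {x P : ℝ} (h : x ≤ 35 / 36 * P) (hP : 0 ≤ P) : Real.sqrt x ≤ 71 / 72 * Real.sqrt P := by
  rw [Real.sqrt_le_left (by positivity), mul_pow, Real.sq_sqrt hP]
  nlinarith

theorem EY (hK : 0 ≤ K) (hp0 : ∀ v, 0 ≤ p v) (hinc2 : ∀ e, ∃ u v, u ≠ v ∧ inc e u ∧ inc e v) {a : ℝ × ℝ} {v : V} :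
    ∀ (t : Tr V) (c : CT), t.Good inc p K → c.good → c.full t.dep → v ∈ t.verts → a ∉ c.pts →
    EE t c (fun f => stab inc t f a (f v)) ≤ 2100 * K * Real.sqrt (PP p t)
  | Tr.leaf v, c, _, _, _, _, _ => by
    simp only [EE, stab_leaf hinc2]; positivity
  | Tr.node _ _, CT.pt x, _, _, hf, _, _ => hf.elim
  | Tr.node l r, CT.br c, hG, hg, hf, hv, ha => by
    obtain ⟨hd, hec, hl, hr, hGl, hGr⟩ := hG
    replace hec : ((Host.ec inc l.verts r.verts).card : ℝ) ≤ K * Real.sqrt (PP p (Tr.node l r)) := hec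
    replace hl : l.isLeaf ∨ PP p l ≤ 35 / 36 * PP p (Tr.node l r) := hl
    replace hr : r.isLeaf ∨ PP p r ≤ 35 / 36 * PP p (Tr.node l r) := hr
    have hl0 := PP_nonneg hp0 l
    have hr0 := PP_nonneg hp0 r
    have hP := PP_node (p := p) hd
    have hc : ∀ i, a ∉ (c i).pts := fun i h => ha (Set.mem_iUnion.2 ⟨i, h⟩)
    have hsl : Real.sqrt (PP p l) ≤ Real.sqrt (PP p (Tr.node l r)) := Real.sqrt_le_sqrt (by linarith)
    have hsr : Real.sqrt (PP p r) ≤ Real.sqrt (PP p (Tr.node l r)) := Real.sqrt_le_sqrt (by linarith)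
    have hs0 := mul_nonneg hK (Real.sqrt_nonneg (PP p (Tr.node l r)))
    have key : ∀ (s : Tr V) (i : Fin 3), (s.isLeaf ∨ PP p s ≤ 35 / 36 * PP p (Tr.node l r)) →
        EE s (c i) (fun f => stab inc s f a (f v)) ≤ 2100 * K * Real.sqrt (PP p s) →
        EE s (c i) (fun f => stab inc s f a (f v)) ≤ 2100 * K * (71 / 72 * Real.sqrt (PP p (Tr.node l r))) := by
      intro s i hs h
      rcases hs with hs | hs
      · cases s with
        | leaf w => simp only [stab_leaf hinc2, EE_const]; positivity
        | node _ _ => exact hs.elim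
      · exact h.trans (mul_le_mul_of_nonneg_left (sqrt_child hs (by linarith)) (by positivity))
    refine EE_node_le l r c _ _ fun i j hij => ?_
    rcases Finset.mem_union.1 hv with hvl | hvr
    · have ih := key l i hl (EY hK hp0 hinc2 l (c i) hGl (hg.1 i) (full_left hf i) hvl (hc i))
      have hX : EE l (c i) (fun f => EE r (c j) (fun g => stab inc r g a (f v))) ≤ 20 * K * Real.sqrt (PP p r) := by
        calc _ ≤ EE l (c i) (fun f => 20 * K * Real.sqrt (PP p r)) :=
              EE_mono l _ hGl (hg.1 _) (full_left hf _) _ _ fun f hf' =>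
                EX (a := a) (b := f v) hK hp0 hinc2 (fun h => hc i (h ▸ hf'.1 v hvl)) r (c j) hGr (hg.1 j) (full_right hf j)
          _ = _ := EE_const _ _ _
      calc _ ≤ EE l (c i) (fun f => EE r (c j) (fun g => stab inc l f a (f v) + stab inc r g a (f v) + (Host.ec inc l.verts r.verts).card)) :=
            EE_mono l _ hGl (hg.1 _) (full_left hf _) _ _ fun f _ => EE_mono r _ hGr (hg.1 _) (full_right hf _) _ _ fun g _ => by
              rw [comb_left hvl]; exact stab_node hd f g a (f v)
        _ = EE l (c i) (fun f => stab inc l f a (f v)) + EE l (c i) (fun f => EE r (c j) (fun g => stab inc r g a (f v))) + (Host.ec inc l.verts r.verts).card := by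
            simp only [EE_add, EE_const]
        _ ≤ _ := by
          have := mul_le_mul_of_nonneg_left hsr hK
          nlinarith
    · have ih := key r j hr (EY hK hp0 hinc2 r (c j) hGr (hg.1 j) (full_right hf j) hvr (hc j))
      have hX : EE l (c i) (fun f => EE r (c j) (fun g => stab inc l f a (g v))) ≤ 20 * K * Real.sqrt (PP p l) := by
        rw [EE_comm]
        calc _ ≤ EE r (c j) (fun f => 20 * K * Real.sqrt (PP p l)) :=
              EE_mono r _ hGr (hg.1 _) (full_right hf _) _ _ fun f hf' =>
                EX (a := a) (b := f v) hK hp0 hinc2 (fun h => hc j (h ▸ hf'.1 v hvr)) l (c i) hGl (hg.1 i) (full_left hf i)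
          _ = _ := EE_const _ _ _
      calc _ ≤ EE l (c i) (fun f => EE r (c j) (fun g => stab inc l f a (g v) + stab inc r g a (g v) + (Host.ec inc l.verts r.verts).card)) :=
            EE_mono l _ hGl (hg.1 _) (full_left hf _) _ _ fun f _ => EE_mono r _ hGr (hg.1 _) (full_right hf _) _ _ fun g _ => by
              rw [comb_right hd hvr]; exact stab_node hd f g a (g v)
        _ = EE l (c i) (fun f => EE r (c j) (fun g => stab inc l f a (g v))) + EE r (c j) (fun f => stab inc r f a (f v)) + (Host.ec inc l.verts r.verts).card := by
            simp only [EE_add, EE_const]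
        _ ≤ _ := by
          have := mul_le_mul_of_nonneg_left hsl hK
          nlinarith

theorem mt_stab {t : Tr V} (f h : V → ℝ × ℝ) (a b : ℝ × ℝ) (e : ι) (himg : ∀ e' ∈ Host.ins inc t.verts, h '' {v | inc e' v} = f '' {v | inc e' v})
    (he : h '' {v | inc e v} = {a, b}) : ∑ e' ∈ Host.ins inc t.verts, mt inc h e e' ≤ stab inc t f a b := by
  unfold stab
  refine Finset.sum_le_sum fun e' he' => ?_
  unfold mt
  rw [he, himg e' he']
  split_ifs with h1 h2
  · exact (h2.hull h1).elim
  all_goals norm_num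

theorem TT_node {l r : Tr V} {c : Fin 3 → CT} (hd : Disjoint l.verts r.verts) (hg : (CT.br c).good) {i j : Fin 3} (hij : i ≠ j)
    {f g : V → ℝ × ℝ} (hf : Adm l (c i) f) (hg' : Adm r (c j) g) (u v : ι → V)
    (huv : ∀ e ∈ Host.ec inc l.verts r.verts, u e ∈ l.verts ∧ v e ∈ r.verts ∧ {x | inc e x} = {u e, v e}) :
    TT inc (Tr.node l r) (comb l f g) ≤ TT inc l f + TT inc r g +
      2 * ∑ e ∈ Host.ec inc l.verts r.verts, (stab inc l f (g (v e)) (f (u e)) + stab inc r g (f (u e)) (g (v e))) +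
      ((Host.ec inc l.verts r.verts).card : ℝ) ^ 2 := by
  set h := comb l f g with hh
  have himg : ∀ e ∈ Host.ec inc l.verts r.verts, h '' {x | inc e x} = {f (u e), g (v e)} := by
    intro e he
    obtain ⟨h1, h2, h3⟩ := huv e he
    rw [h3, Set.image_pair, hh, comb_left h1, comb_right hd h2]
  have hL : ∀ e ∈ Host.ec inc l.verts r.verts, ∑ e' ∈ Host.ins inc l.verts, mt inc h e e' ≤ stab inc l f (g (v e)) (f (u e)) := by
    intro e he
    rw [stab_swap]
    exact mt_stab f h _ _ e (fun e' he' => img_left he') (himg e he)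
  have hR : ∀ e ∈ Host.ec inc l.verts r.verts, ∑ e' ∈ Host.ins inc r.verts, mt inc h e e' ≤ stab inc r g (f (u e)) (g (v e)) := by
    intro e he
    exact mt_stab g h _ _ e (fun e' he' => img_right hd he') (himg e he)
  have hLR : ∀ e ∈ Host.ins inc l.verts, ∀ e' ∈ Host.ins inc r.verts, mt inc h e e' = 0 := by
    intro e he e' he'
    unfold mt
    rw [img_left he, img_right hd he']
    exact if_neg ((hg.2.1 i j hij).mono (img_sub hf he) (img_sub hg' he')).hull
  have hinner : ∀ e, ∑ e' ∈ Host.ins inc (Tr.node l r).verts, mt inc h e e' ≤ _ := fun e => ins_sum_le l r _ (mt_nonneg h e)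
  have h0 : TT inc (Tr.node l r) h ≤ _ := ins_sum_le l r _ fun e => Finset.sum_nonneg fun e' _ => mt_nonneg h e e'
  set A := Host.ins inc l.verts
  set B := Host.ins inc r.verts
  set Ce := Host.ec inc l.verts r.verts
  have a1 : ∑ e ∈ A, ∑ e' ∈ Host.ins inc (Tr.node l r).verts, mt inc h e e' ≤ TT inc l f + ∑ e ∈ Ce, stab inc l f (g (v e)) (f (u e)) := by
    calc _ ≤ ∑ e ∈ A, (∑ e' ∈ A, mt inc f e e' + ∑ e' ∈ Ce, mt inc h e e') := by
          refine Finset.sum_le_sum fun e he => (hinner e).trans ?_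
          rw [Finset.sum_eq_zero (s := B) fun e' he' => hLR e he e' he', add_zero]
          refine add_le_add (le_of_eq ?_) le_rfl
          refine Finset.sum_congr rfl fun e' he' => ?_
          unfold mt; rw [img_left he, img_left he']
      _ = TT inc l f + ∑ e ∈ Ce, ∑ e' ∈ A, mt inc h e e' := by
          rw [Finset.sum_add_distrib, Finset.sum_comm (s := A) (t := Ce)]
          simp only [mt_comm h _]
          rfl
      _ ≤ _ := by
          refine add_le_add le_rfl (Finset.sum_le_sum fun e he => ?_)
          exact hL e he
  have a2 : ∑ e ∈ B, ∑ e' ∈ Host.ins inc (Tr.node l r).verts, mt inc h e e' ≤ TT inc r g + ∑ e ∈ Ce, stab inc r g (f (u e)) (g (v e)) := by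
    calc _ ≤ ∑ e ∈ B, (∑ e' ∈ B, mt inc g e e' + ∑ e' ∈ Ce, mt inc h e e') := by
          refine Finset.sum_le_sum fun e he => (hinner e).trans ?_
          rw [Finset.sum_eq_zero (s := A) fun e' he' => by rw [mt_comm]; exact hLR e' he' e he, zero_add]
          refine add_le_add (le_of_eq ?_) le_rfl
          refine Finset.sum_congr rfl fun e' he' => ?_
          unfold mt; rw [img_right hd he, img_right hd he']
      _ = TT inc r g + ∑ e ∈ Ce, ∑ e' ∈ B, mt inc h e e' := by
          rw [Finset.sum_add_distrib, Finset.sum_comm (s := B) (t := Ce)]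
          simp only [mt_comm h _]
          rfl
      _ ≤ _ := by
          refine add_le_add le_rfl (Finset.sum_le_sum fun e he => ?_)
          exact hR e he
  have a3 : ∑ e ∈ Ce, ∑ e' ∈ Host.ins inc (Tr.node l r).verts, mt inc h e e' ≤
      ∑ e ∈ Ce, (stab inc l f (g (v e)) (f (u e)) + stab inc r g (f (u e)) (g (v e))) + (Ce.card : ℝ) ^ 2 := by
    calc _ ≤ ∑ e ∈ Ce, ((stab inc l f (g (v e)) (f (u e)) + stab inc r g (f (u e)) (g (v e))) + (Ce.card : ℝ)) := by
          refine Finset.sum_le_sum fun e he => (hinner e).trans ?_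
          refine add_le_add (add_le_add (hL e he) (hR e he)) ?_
          calc _ ≤ ∑ e' ∈ Ce, (1 : ℝ) := Finset.sum_le_sum fun e' _ => mt_le h e e'
            _ = _ := by simp
      _ = _ := by rw [Finset.sum_add_distrib]; simp [sq]
  rw [Finset.sum_add_distrib] at a3 ⊢
  linarith

theorem ET (hK : 0 ≤ K) (hp0 : ∀ v, 0 ≤ p v) (hinc2 : ∀ e, ∃ u v, u ≠ v ∧ inc e u ∧ inc e v)
    (h2 : ∀ e u v x, inc e u → inc e v → u ≠ v → inc e x → x = u ∨ x = v) :
    ∀ (t : Tr V) (c : CT), t.Good inc p K → c.good → c.full t.dep →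
    EE t c (fun f => TT inc t f) ≤ 8401 * K ^ 2 * t.dep * PP p t
  | Tr.leaf v, c, _, _, _ => by
    have := PP_nonneg hp0 (Tr.leaf v)
    simp only [TT, EE, ins_leaf hinc2, Finset.sum_empty]; positivity
  | Tr.node _ _, CT.pt x, _, _, hf => hf.elim
  | Tr.node l r, CT.br c, hG, hg, hf => by
    obtain ⟨hd, hec, hl, hr, hGl, hGr⟩ := hG
    replace hec : ((Host.ec inc l.verts r.verts).card : ℝ) ≤ K * Real.sqrt (PP p (Tr.node l r)) := hec
    have hl0 := PP_nonneg hp0 l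
    have hr0 := PP_nonneg hp0 r
    have hP := PP_node (p := p) hd
    have hsl : Real.sqrt (PP p l) ≤ Real.sqrt (PP p (Tr.node l r)) := Real.sqrt_le_sqrt (by linarith)
    have hsr : Real.sqrt (PP p r) ≤ Real.sqrt (PP p (Tr.node l r)) := Real.sqrt_le_sqrt (by linarith)
    have hs0 := Real.sqrt_nonneg (PP p (Tr.node l r))
    have hsq := Real.sq_sqrt (PP_nonneg hp0 (Tr.node l r))
    have hex : ∀ e, ∃ u v, e ∈ Host.ec inc l.verts r.verts → u ∈ l.verts ∧ v ∈ r.verts ∧ {x | inc e x} = {u, v} := by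
      intro e
      by_cases he : e ∈ Host.ec inc l.verts r.verts
      · obtain ⟨⟨u, hu, hu'⟩, v, hv, hv'⟩ := Host.mem_ec.1 he
        refine ⟨u, v, fun _ => ⟨hu, hv, ?_⟩⟩
        have huv : u ≠ v := fun h => Finset.disjoint_left.1 hd hu (h ▸ hv)
        ext x
        constructor
        · intro hx; exact h2 e u v x hu' hv' huv hx
        · rintro (rfl | rfl)
          · exact hu'
          · exact hv'
      · obtain ⟨u, v, _⟩ := hinc2 e
        exact ⟨u, v, fun h => (he h).elim⟩
    choose u v huv using hex
    refine EE_node_le l r c _ _ fun i j hij => ?_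
    have ihl := ET hK hp0 hinc2 h2 l (c i) hGl (hg.1 i) (full_left hf i)
    have ihr := ET hK hp0 hinc2 h2 r (c j) hGr (hg.1 j) (full_right hf j)
    have b1 : ∀ e ∈ Host.ec inc l.verts r.verts,
        EE l (c i) (fun f => EE r (c j) (fun g => stab inc l f (g (v e)) (f (u e)))) ≤ 2100 * K * Real.sqrt (PP p (Tr.node l r)) := by
      intro e he
      obtain ⟨h1, h2, _⟩ := huv e he
      rw [EE_comm]
      calc _ ≤ EE r (c j) (fun _ => 2100 * K * Real.sqrt (PP p l)) :=
            EE_mono r _ hGr (hg.1 _) (full_right hf _) _ _ fun g hg' =>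
              EY hK hp0 hinc2 l (c i) hGl (hg.1 i) (full_left hf i) h1 fun hh => (hg.2.1 i j hij).disj hh (hg'.1 _ h2)
        _ = _ := EE_const _ _ _
        _ ≤ _ := mul_le_mul_of_nonneg_left hsl (by positivity)
    have b2 : ∀ e ∈ Host.ec inc l.verts r.verts,
        EE l (c i) (fun f => EE r (c j) (fun g => stab inc r g (f (u e)) (g (v e)))) ≤ 2100 * K * Real.sqrt (PP p (Tr.node l r)) := by
      intro e he
      obtain ⟨h1, h2, _⟩ := huv e he
      calc _ ≤ EE l (c i) (fun _ => 2100 * K * Real.sqrt (PP p r)) :=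
            EE_mono l _ hGl (hg.1 _) (full_left hf _) _ _ fun g hg' =>
              EY hK hp0 hinc2 r (c j) hGr (hg.1 j) (full_right hf j) h2 fun hh => (hg.2.1 i j hij).disj (hg'.1 _ h1) hh
        _ = _ := EE_const _ _ _
        _ ≤ _ := mul_le_mul_of_nonneg_left hsr (by positivity)
    have hsumb : ∑ e ∈ Host.ec inc l.verts r.verts, (EE l (c i) (fun f => EE r (c j) (fun g => stab inc l f (g (v e)) (f (u e)))) +
        EE l (c i) (fun f => EE r (c j) (fun g => stab inc r g (f (u e)) (g (v e))))) ≤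
        (Host.ec inc l.verts r.verts).card * (4200 * K * Real.sqrt (PP p (Tr.node l r))) := by
      rw [← nsmul_eq_mul]
      exact Finset.sum_le_card_nsmul _ _ _ fun e he => by linarith [b1 e he, b2 e he]
    calc _ ≤ EE l (c i) (fun f => EE r (c j) (fun g => TT inc l f + TT inc r g +
      2 * ∑ e ∈ Host.ec inc l.verts r.verts, (stab inc l f (g (v e)) (f (u e)) + stab inc r g (f (u e)) (g (v e))) +
      ((Host.ec inc l.verts r.verts).card : ℝ) ^ 2)) :=
            EE_mono l _ hGl (hg.1 _) (full_left hf _) _ _ fun f hf' => EE_mono r _ hGr (hg.1 _) (full_right hf _) _ _ fun g hg' =>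
              TT_node hd hg hij hf' hg' u v huv
      _ = EE l (c i) (fun f => TT inc l f) + EE r (c j) (fun f => TT inc r f) +
        2 * ∑ e ∈ Host.ec inc l.verts r.verts, (EE l (c i) (fun f => EE r (c j) (fun g => stab inc l f (g (v e)) (f (u e)))) +
        EE l (c i) (fun f => EE r (c j) (fun g => stab inc r g (f (u e)) (g (v e))))) + ((Host.ec inc l.verts r.verts).card : ℝ) ^ 2 := by
          simp only [EE_add, EE_const, EE_mul, EE_sum]
      _ ≤ _ := by
        have hcc : (0:ℝ) ≤ (Host.ec inc l.verts r.verts).card := by positivity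
        generalize ((Host.ec inc l.verts r.verts).card : ℝ) = m at *
        generalize Real.sqrt (PP p (Tr.node l r)) = s at *
        have m1 : m * (4200 * K * s) ≤ (K * s) * (4200 * K * s) := mul_le_mul_of_nonneg_right hec (by positivity)
        have m2 : m ^ 2 ≤ (K * s) ^ 2 := pow_le_pow_left₀ hcc hec 2
        have d1 : (l.dep : ℝ) ≤ (Tr.node l r).dep - 1 := by
          have : l.dep + 1 ≤ (Tr.node l r).dep := Nat.succ_le_succ (le_max_left _ _)
          have : (l.dep : ℝ) + 1 ≤ (Tr.node l r).dep := by exact_mod_cast this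
          linarith
        have d2 : (r.dep : ℝ) ≤ (Tr.node l r).dep - 1 := by
          have : r.dep + 1 ≤ (Tr.node l r).dep := Nat.succ_le_succ (le_max_right _ _)
          have : (r.dep : ℝ) + 1 ≤ (Tr.node l r).dep := by exact_mod_cast this
          linarith
        generalize ((Tr.node l r).dep : ℝ) = d at *
        have k1 : 8401 * K ^ 2 * l.dep * PP p l ≤ 8401 * K ^ 2 * (d - 1) * PP p l :=
          mul_le_mul_of_nonneg_right (mul_le_mul_of_nonneg_left d1 (by positivity)) hl0
        have k2 : 8401 * K ^ 2 * r.dep * PP p r ≤ 8401 * K ^ 2 * (d - 1) * PP p r :=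
          mul_le_mul_of_nonneg_right (mul_le_mul_of_nonneg_left d2 (by positivity)) hr0
        have e1 : K * s * (4200 * K * s) = 4200 * K ^ 2 * PP p (Tr.node l r) := by rw [← hsq]; ring
        have e2 : (K * s) ^ 2 = K ^ 2 * PP p (Tr.node l r) := by rw [← hsq]; ring
        rw [e1] at m1
        rw [e2] at m2
        rw [hP] at *
        linarith
end
end PCR

set_option linter.all false
open scoped BigOperators

namespace PCR

theorem ostat (T : Finset (ℝ × ℝ)) (φ : ℝ → ℝ × ℝ → ℝ) (hφ : ∀ p, Continuous fun m => φ m p) (k : ℕ) (hk : 1 ≤ k) (hkT : k ≤ T.card) :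
    ∃ F : ℝ → ℝ, Continuous F ∧ ∀ m, k ≤ (T.filter fun p => φ m p ≤ F m).card ∧ (T.filter fun p => φ m p < F m).card < k := by
  classical
  have hne : (T.powersetCard k).Nonempty := Finset.powersetCard_nonempty.2 hkT
  obtain ⟨p0, hp0⟩ := Finset.card_pos.1 (by omega : 0 < T.card)
  let ins' : Finset (ℝ × ℝ) → Finset (ℝ × ℝ) := fun A => if A.Nonempty then A else {p0}
  have hins : ∀ A, (ins' A).Nonempty := fun A => by
    by_cases h : A.Nonempty
    · simp only [ins', if_pos h]; exact h
    · simp only [ins', if_neg h]; exact ⟨p0, by simp⟩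
  have hinsA : ∀ A ∈ T.powersetCard k, ins' A = A := fun A hA => by
    have := (Finset.mem_powersetCard.1 hA).2
    exact if_pos (Finset.card_pos.1 (by omega))
  refine ⟨fun m => (T.powersetCard k).inf' hne fun A => (ins' A).sup' (hins A) fun p => φ m p, ?_, ?_⟩
  · refine Continuous.finset_inf'_apply hne fun A _ => ?_
    exact Continuous.finset_sup'_apply (hins A) fun p _ => hφ p
  · intro m
    constructor
    · obtain ⟨A, hA, hAe⟩ := Finset.exists_mem_eq_inf' hne fun A => (ins' A).sup' (hins A) fun p => φ m p
      refine (Finset.mem_powersetCard.1 hA).2.symm.le.trans (Finset.card_le_card fun p hp => Finset.mem_filter.2 ⟨(Finset.mem_powersetCard.1 hA).1 hp, ?_⟩)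
      beta_reduce
      rw [hAe]
      exact Finset.le_sup' (fun p => φ m p) (by rw [hinsA A hA]; exact hp)
    · by_contra h
      push Not at h
      obtain ⟨A, hA, hAc⟩ := Finset.exists_subset_card_eq h
      have hAm : A ∈ T.powersetCard k := Finset.mem_powersetCard.2 ⟨hA.trans (Finset.filter_subset _ _), hAc⟩
      have h1 := Finset.inf'_le (fun A => (ins' A).sup' (hins A) fun p => φ m p) hAm
      obtain ⟨p, hp, hpe⟩ := Finset.exists_mem_eq_sup' (hins A) fun p => φ m p
      have h2 := (Finset.mem_filter.1 (hA (by rw [hinsA A hAm] at hp; exact hp))).2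
      beta_reduce at h1 hpe h2
      rw [hpe] at h1
      linarith

theorem fib_count (T : Finset (ℝ × ℝ)) (φ : ℝ × ℝ → ℝ) (q : ℝ) (hq : (T.filter fun p => φ p = q).card ≤ 2) (k : ℕ)
    (h1 : k ≤ (T.filter fun p => φ p ≤ q).card) (h2 : (T.filter fun p => φ p < q).card < k) :
    k ≤ (T.filter fun p => φ p < q).card + 2 ∧ T.card ≤ (T.filter fun p => q < φ p).card + k + 1 := by
  classical
  have e1 : (T.filter fun p => φ p ≤ q).card ≤ (T.filter fun p => φ p < q).card + (T.filter fun p => φ p = q).card := by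
    rw [← Finset.card_union_of_disjoint]
    · refine Finset.card_le_card fun p hp => ?_
      simp only [Finset.mem_union, Finset.mem_filter] at hp ⊢
      rcases lt_or_eq_of_le hp.2 with h | h
      · exact Or.inl ⟨hp.1, h⟩
      · exact Or.inr ⟨hp.1, h⟩
    · refine Finset.disjoint_filter.2 fun p _ h h' => by linarith
  have e2 : T.card ≤ (T.filter fun p => φ p < q).card + (T.filter fun p => φ p = q).card + (T.filter fun p => q < φ p).card := by
    calc T.card ≤ (((T.filter fun p => φ p < q) ∪ (T.filter fun p => φ p = q)) ∪ (T.filter fun p => q < φ p)).card := by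
          refine Finset.card_le_card fun p hp => ?_
          simp only [Finset.mem_union, Finset.mem_filter]
          rcases lt_trichotomy (φ p) q with h | h | h
          · exact Or.inl (Or.inl ⟨hp, h⟩)
          · exact Or.inl (Or.inr ⟨hp, h⟩)
          · exact Or.inr ⟨hp, h⟩
      _ ≤ _ := (Finset.card_union_le _ _).trans (Nat.add_le_add_right (Finset.card_union_le _ _) _)
  omega

theorem gp_mono {S T : Set (ℝ × ℝ)} (h : InGeneralPosition T) (hST : S ⊆ T) : InGeneralPosition S :=
  fun p hp q hq r hr => h p (hST hp) q (hST hq) r (hST hr)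

theorem gp_fib {T : Finset (ℝ × ℝ)} (h : InGeneralPosition (T : Set (ℝ × ℝ))) (P : ℝ × ℝ → Prop) [DecidablePred P] (v : ℝ × ℝ)
    (hv : ∀ x y, P x → P y → ∃ s : ℝ, y = s • v + x) : (T.filter P).card ≤ 2 := by
  by_contra hc
  push Not at hc
  obtain ⟨a, ha, b, hb, c, hcc, hab, hac, hbc⟩ := Finset.two_lt_card.1 hc
  rw [Finset.mem_filter] at ha hb hcc
  refine h a ha.1 b hb.1 c hcc.1 hab hac hbc ?_
  rw [collinear_iff_of_mem (p₀ := a) (by simp)]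
  refine ⟨v, fun y hy => ?_⟩
  rcases hy with rfl | rfl | rfl
  · exact hv _ _ ha.2 ha.2
  · exact hv _ _ ha.2 hb.2
  · exact hv _ _ ha.2 hcc.2

theorem gp_x {T : Finset (ℝ × ℝ)} (h : InGeneralPosition (T : Set (ℝ × ℝ))) (q : ℝ) : (T.filter fun p => p.1 = q).card ≤ 2 :=
  gp_fib h _ (0, 1) fun x y hx hy => ⟨y.2 - x.2, by ext <;> simp [hx, hy]⟩

theorem gp_m {T : Finset (ℝ × ℝ)} (h : InGeneralPosition (T : Set (ℝ × ℝ))) (m q : ℝ) : (T.filter fun p => p.2 - m * p.1 = q).card ≤ 2 :=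
  gp_fib h _ (1, m) fun x y hx hy => ⟨y.1 - x.1, by
    ext
    · simp
    · simp only [Prod.snd_add, Prod.smul_snd, smul_eq_mul]; linarith⟩

theorem split_x {T : Finset (ℝ × ℝ)} (h : InGeneralPosition (T : Set (ℝ × ℝ))) (k : ℕ) (hk : 1 ≤ k) (hkT : k ≤ T.card) :
    ∃ q, k ≤ (T.filter fun p => p.1 < q).card + 2 ∧ T.card ≤ (T.filter fun p => q < p.1).card + k + 1 := by
  obtain ⟨F, _, hF⟩ := ostat T (fun _ p => p.1) (fun p => continuous_const) k hk hkT
  exact ⟨F 0, fib_count T _ _ (gp_x h _) k (hF 0).1 (hF 0).2⟩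

theorem ham {L R : Finset (ℝ × ℝ)} (hLR : ∀ l ∈ L, ∀ r ∈ R, l.1 < r.1) (hL : InGeneralPosition (L : Set (ℝ × ℝ)))
    (hR : InGeneralPosition (R : Set (ℝ × ℝ))) (k : ℕ) (hk : 1 ≤ k) (hkL : k ≤ L.card) (hkR : k ≤ R.card) :
    ∃ m q : ℝ, (k ≤ (L.filter fun p => p.2 - m * p.1 < q).card + 2 ∧ L.card ≤ (L.filter fun p => q < p.2 - m * p.1).card + k + 1) ∧
      (k ≤ (R.filter fun p => p.2 - m * p.1 < q).card + 2 ∧ R.card ≤ (R.filter fun p => q < p.2 - m * p.1).card + k + 1) := by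
  classical
  obtain ⟨F, hFc, hF⟩ := ostat L (fun m p => p.2 - m * p.1) (fun p => by fun_prop) k hk hkL
  obtain ⟨F', hFc', hF'⟩ := ostat R (fun m p => p.2 - m * p.1) (fun p => by fun_prop) k hk hkR
  have hlo : ∀ (T : Finset (ℝ × ℝ)) (F : ℝ → ℝ), k ≤ T.card → (∀ m, k ≤ (T.filter fun p => p.2 - m * p.1 ≤ F m).card ∧ (T.filter fun p => p.2 - m * p.1 < F m).card < k) →
      ∀ m, (∃ p ∈ T, p.2 - m * p.1 ≤ F m) ∧ ∃ p ∈ T, F m ≤ p.2 - m * p.1 := by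
    intro T F hkT h m
    obtain ⟨h1, h2⟩ := h m
    constructor
    · obtain ⟨p, hp⟩ := Finset.card_pos.1 (by omega : 0 < (T.filter fun p => p.2 - m * p.1 ≤ F m).card)
      exact ⟨p, (Finset.mem_filter.1 hp).1, (Finset.mem_filter.1 hp).2⟩
    · by_contra hn
      push Not at hn
      rw [Finset.filter_true_of_mem hn] at h2
      omega
  obtain ⟨B, hB⟩ := Finset.exists_le ((L ×ˢ R).image fun x => |x.2.2 - x.1.2| / (x.2.1 - x.1.1))
  have hB' : ∀ l ∈ L, ∀ r ∈ R, |r.2 - l.2| ≤ B * (r.1 - l.1) := by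
    intro l hl r hr
    have := hB _ (Finset.mem_image.2 ⟨(l, r), Finset.mk_mem_product hl hr, rfl⟩)
    have h0 := hLR l hl r hr
    rwa [div_le_iff₀ (by simpa using h0)] at this
  obtain ⟨m, hm⟩ : ∃ m, F m - F' m = 0 := by
    refine mem_range_of_exists_le_of_exists_ge (hFc.sub hFc') ⟨-B, ?_⟩ ⟨B, ?_⟩
    · obtain ⟨l, hl, h1⟩ := (hlo L F hkL hF (-B)).2
      obtain ⟨r, hr, h2⟩ := (hlo R F' hkR hF' (-B)).1
      have := abs_le.1 (hB' l hl r hr)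
      show F (-B) - F' (-B) ≤ 0
      nlinarith
    · obtain ⟨l, hl, h1⟩ := (hlo L F hkL hF B).1
      obtain ⟨r, hr, h2⟩ := (hlo R F' hkR hF' B).2
      have := abs_le.1 (hB' l hl r hr)
      show 0 ≤ F B - F' B
      nlinarith
  have hm' : F' m = F m := by linarith
  refine ⟨m, F m, fib_count L _ _ (gp_m hL _ _) k (hF m).1 (hF m).2, ?_⟩
  have := fib_count R _ _ (gp_m hR m (F' m)) k (hF' m).1 (hF' m).2
  rwa [hm'] at this

theorem notOne {a b : ℝ × ℝ} {T : Set (ℝ × ℝ)} (h : ¬ OneSide a b T) : ∃ z ∈ convexHull ℝ T, ori a b z = 0 := by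
  unfold OneSide at h
  push Not at h
  obtain ⟨⟨c, hc, hc'⟩, d, hd, hd'⟩ := h
  have hcH := subset_convexHull ℝ T hc
  have hdH := subset_convexHull ℝ T hd
  rcases eq_or_lt_of_le hc' with h0 | h0
  · exact ⟨c, hcH, h0⟩
  have hpos : 0 < ori a b d - ori a b c := by linarith
  refine ⟨(ori a b d / (ori a b d - ori a b c)) • c + (-ori a b c / (ori a b d - ori a b c)) • d, ?_, ?_⟩
  · refine convex_convexHull ℝ T hcH hdH (by positivity) (div_nonneg (by linarith) hpos.le) ?_
    rw [← add_div, ← sub_eq_add_neg, div_self hpos.ne']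
  · rw [ori_comb]
    · field_simp; ring
    · rw [← add_div, ← sub_eq_add_neg, div_self hpos.ne']

theorem no_trans {L M R : Set (ℝ × ℝ)} {q1 q2 m q σ : ℝ} (hL1 : ∀ p ∈ L, p.1 < q1) (hM1 : ∀ p ∈ M, q1 < p.1) (hM2 : ∀ p ∈ M, p.1 < q2)
    (hR1 : ∀ p ∈ R, q2 < p.1) (hL : ∀ p ∈ L, σ * (p.2 - m * p.1) < σ * q) (hR : ∀ p ∈ R, σ * (p.2 - m * p.1) < σ * q)
    (hM : ∀ p ∈ M, σ * q < σ * (p.2 - m * p.1)) {a b : ℝ × ℝ} (hab : a ≠ b) : OneSide a b L ∨ OneSide a b M ∨ OneSide a b R := by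
  by_contra hcon
  push Not at hcon
  obtain ⟨h1, h2, h3⟩ := hcon
  obtain ⟨x, hx, hx0⟩ := notOne h1
  obtain ⟨y, hy, hy0⟩ := notOne h2
  obtain ⟨z, hz, hz0⟩ := notOne h3
  have key : ∀ (A : Set (ℝ × ℝ)) (α β k : ℝ), (∀ p ∈ A, α * p.1 + β * p.2 < k) → ∀ w ∈ convexHull ℝ A, α * w.1 + β * w.2 < k := by
    intro A α β k h w hw
    exact convexHull_min (t := {x : ℝ × ℝ | α * x.1 + β * x.2 ∈ Set.Iio k}) h (convex_lin α β _ (convex_Iio k)) hw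
  have x1 := key L 1 0 q1 (fun p hp => by linarith [hL1 p hp]) x hx
  have y1 := key M (-1) 0 (-q1) (fun p hp => by linarith [hM1 p hp]) y hy
  have y2 := key M 1 0 q2 (fun p hp => by linarith [hM2 p hp]) y hy
  have z1 := key R (-1) 0 (-q2) (fun p hp => by linarith [hR1 p hp]) z hz
  have x2 := key L (-σ * m) σ (σ * q) (fun p hp => by linarith [hL p hp]) x hx
  have z2 := key R (-σ * m) σ (σ * q) (fun p hp => by linarith [hR p hp]) z hz
  have y3 := key M (σ * m) (-σ) (-(σ * q)) (fun p hp => by linarith [hM p hp]) y hy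
  have hxy : x.1 < y.1 := by linarith
  have hyz : y.1 < z.1 := by linarith
  simp only [ori] at hx0 hy0 hz0
  by_cases hb : b.1 - a.1 = 0
  · rw [hb] at hx0 hy0
    have hb2 : b.2 - a.2 ≠ 0 := fun h => hab (by ext <;> linarith)
    have e1 : (b.2 - a.2) * (x.1 - a.1) = 0 := by linarith
    have e2 : (b.2 - a.2) * (y.1 - a.1) = 0 := by linarith
    have f1 := (mul_eq_zero.1 e1).resolve_left hb2
    have f2 := (mul_eq_zero.1 e2).resolve_left hb2
    linarith
  · have hcol : (y.2 - x.2) * (z.1 - y.1) = (z.2 - y.2) * (y.1 - x.1) := by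
      apply mul_left_cancel₀ hb
      linear_combination (hy0 - hx0) * (z.1 - y.1) - (hz0 - hy0) * (y.1 - x.1)
    have u1 := mul_pos (sub_pos.2 hyz) (by linarith : 0 < σ * q - (-σ * m * x.1 + σ * x.2))
    have u2 := mul_pos (sub_pos.2 hxy) (by linarith : 0 < σ * q - (-σ * m * z.1 + σ * z.2))
    have u3 := mul_pos (sub_pos.2 (hxy.trans hyz)) (by linarith : 0 < (-σ * m * y.1 + σ * y.2) - σ * q)
    have : σ * ((y.2 - x.2) * (z.1 - y.1)) = σ * ((z.2 - y.2) * (y.1 - x.1)) := by rw [hcol]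
    nlinarith

theorem sep_x {A B : Set (ℝ × ℝ)} {q : ℝ} (hA : ∀ p ∈ A, p.1 < q) (hB : ∀ p ∈ B, q < p.1) : Sep A B :=
  ⟨1, 0, q, fun p hp => by linarith [hA p hp], fun p hp => by linarith [hB p hp]⟩

theorem three_of {S L M R : Finset (ℝ × ℝ)} {N : ℕ} {q1 q2 m q σ : ℝ} (hLS : L ⊆ S) (hMS : M ⊆ S) (hRS : R ⊆ S)
    (hLc : N ≤ L.card) (hMc : N ≤ M.card) (hRc : N ≤ R.card) (hL1 : ∀ p ∈ L, p.1 < q1) (hM1 : ∀ p ∈ M, q1 < p.1) (hM2 : ∀ p ∈ M, p.1 < q2)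
    (hR1 : ∀ p ∈ R, q2 < p.1) (hR0 : ∀ p ∈ R, q1 < p.1) (hL : ∀ p ∈ L, σ * (p.2 - m * p.1) < σ * q) (hR : ∀ p ∈ R, σ * (p.2 - m * p.1) < σ * q)
    (hM : ∀ p ∈ M, σ * q < σ * (p.2 - m * p.1)) :
    ∃ T : Fin 3 → Finset (ℝ × ℝ), (∀ i, T i ⊆ S) ∧ (∀ i, N ≤ (T i).card) ∧ (∀ i j, i ≠ j → Sep (T i : Set (ℝ × ℝ)) (T j)) ∧
      ∀ a b, a ≠ b → ∃ i, OneSide a b (T i : Set (ℝ × ℝ)) := by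
  have s1 : Sep (L : Set (ℝ × ℝ)) M := sep_x hL1 hM1
  have s2 : Sep (M : Set (ℝ × ℝ)) R := sep_x hM2 hR1
  have s3 : Sep (L : Set (ℝ × ℝ)) R := sep_x hL1 hR0
  refine ⟨![L, M, R], ?_, ?_, ?_, ?_⟩
  · intro i; fin_cases i <;> simp [hLS, hMS, hRS]
  · intro i; fin_cases i <;> simp [hLc, hMc, hRc]
  · intro i j hij
    fin_cases i <;> fin_cases j <;> first | exact (hij rfl).elim | exact s1 | exact s2 | exact s3 | exact s1.symm | exact s2.symm | exact s3.symm
  · intro a b hab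
    rcases no_trans (L := (L : Set (ℝ × ℝ))) (M := M) (R := R) hL1 hM1 hM2 hR1 hL hR hM hab with h | h | h
    · exact ⟨0, h⟩
    · exact ⟨1, h⟩
    · exact ⟨2, h⟩

theorem three_cells (S : Finset (ℝ × ℝ)) (hS : InGeneralPosition (S : Set (ℝ × ℝ))) (N : ℕ) (hN : 1 ≤ N) (hc : 21 * N ≤ S.card) :
    ∃ T : Fin 3 → Finset (ℝ × ℝ), (∀ i, T i ⊆ S) ∧ (∀ i, N ≤ (T i).card) ∧ (∀ i j, i ≠ j → Sep (T i : Set (ℝ × ℝ)) (T j)) ∧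
      ∀ a b, a ≠ b → ∃ i, OneSide a b (T i : Set (ℝ × ℝ)) := by
  classical
  obtain ⟨q1, h1, h1'⟩ := split_x hS (2 * N + 5) (by omega) (by omega)
  set L := S.filter fun p => p.1 < q1 with hLd
  set S' := S.filter fun p => q1 < p.1 with hSd
  have hSS : S' ⊆ S := Finset.filter_subset _ _
  have hLS : L ⊆ S := Finset.filter_subset _ _
  obtain ⟨q2, h2, h2'⟩ := split_x (T := S') (gp_mono hS (Finset.coe_subset.2 hSS)) (2 * N + 5) (by omega) (by omega)
  set M := S'.filter fun p => p.1 < q2 with hMd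
  set R := S'.filter fun p => q2 < p.1 with hRd
  have hMS : M ⊆ S' := Finset.filter_subset _ _
  have hRS : R ⊆ S' := Finset.filter_subset _ _
  have hM0 := fun p hp => (Finset.mem_filter.1 (hMS hp : p ∈ S')).2
  have hR0 := fun p hp => (Finset.mem_filter.1 (hRS hp : p ∈ S')).2
  have hL1 := fun p (hp : p ∈ L) => (Finset.mem_filter.1 hp).2
  have hM2 := fun p (hp : p ∈ M) => (Finset.mem_filter.1 hp).2
  have hR1 := fun p (hp : p ∈ R) => (Finset.mem_filter.1 hp).2
  obtain ⟨m, q, ⟨hLl, hLu⟩, hRl, hRu⟩ := ham (L := L) (R := R) (fun l hl r hr => (hL1 l hl).trans (hR0 r hr))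
    (gp_mono hS (Finset.coe_subset.2 hLS)) (gp_mono hS (Finset.coe_subset.2 (hRS.trans hSS))) (N + 2) (by omega) (by omega) (by omega)
  have hMf : M.card ≤ (M.filter fun p => p.2 - m * p.1 < q).card + 2 + (M.filter fun p => q < p.2 - m * p.1).card := by
    have h3 := gp_m (T := M) (gp_mono hS (Finset.coe_subset.2 (hMS.trans hSS))) m q
    calc M.card ≤ (((M.filter fun p => p.2 - m * p.1 < q) ∪ (M.filter fun p => p.2 - m * p.1 = q)) ∪ (M.filter fun p => q < p.2 - m * p.1)).card := by
          refine Finset.card_le_card fun p hp => ?_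
          simp only [Finset.mem_union, Finset.mem_filter]
          rcases lt_trichotomy (p.2 - m * p.1) q with h | h | h
          · exact Or.inl (Or.inl ⟨hp, h⟩)
          · exact Or.inl (Or.inr ⟨hp, h⟩)
          · exact Or.inr ⟨hp, h⟩
      _ ≤ _ := (Finset.card_union_le _ _).trans (Nat.add_le_add_right ((Finset.card_union_le _ _).trans (Nat.add_le_add_left h3 _)) _)
  have fs : ∀ (A : Finset (ℝ × ℝ)) (P : ℝ × ℝ → Prop) [DecidablePred P], A.filter P ⊆ A := fun A P _ => Finset.filter_subset _ _
  by_cases hcase : N ≤ (M.filter fun p => q < p.2 - m * p.1).card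
  · exact three_of (σ := 1) (q := q) (m := m) (q1 := q1) (q2 := q2) ((fs L fun p => p.2 - m * p.1 < q).trans hLS)
      ((fs M fun p => q < p.2 - m * p.1).trans (hMS.trans hSS)) ((fs R fun p => p.2 - m * p.1 < q).trans (hRS.trans hSS))
      (by omega) hcase (by omega) (fun p hp => hL1 p (fs _ _ hp)) (fun p hp => hM0 p (fs _ _ hp)) (fun p hp => hM2 p (fs _ _ hp))
      (fun p hp => hR1 p (fs _ _ hp)) (fun p hp => hR0 p (fs _ _ hp)) (fun p hp => by have := (Finset.mem_filter.1 hp).2; linarith)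
      (fun p hp => by have := (Finset.mem_filter.1 hp).2; linarith) (fun p hp => by have := (Finset.mem_filter.1 hp).2; linarith)
  · exact three_of (σ := -1) (q := q) (m := m) (q1 := q1) (q2 := q2) ((fs L fun p => q < p.2 - m * p.1).trans hLS)
      ((fs M fun p => p.2 - m * p.1 < q).trans (hMS.trans hSS)) ((fs R fun p => q < p.2 - m * p.1).trans (hRS.trans hSS))
      (by omega) (by omega) (by omega) (fun p hp => hL1 p (fs _ _ hp)) (fun p hp => hM0 p (fs _ _ hp)) (fun p hp => hM2 p (fs _ _ hp))
      (fun p hp => hR1 p (fs _ _ hp)) (fun p hp => hR0 p (fs _ _ hp)) (fun p hp => by have := (Finset.mem_filter.1 hp).2; linarith)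
      (fun p hp => by have := (Finset.mem_filter.1 hp).2; linarith) (fun p hp => by have := (Finset.mem_filter.1 hp).2; linarith)

theorem exists_CT : ∀ (d : ℕ) (S : Finset (ℝ × ℝ)), InGeneralPosition (S : Set (ℝ × ℝ)) → 21 ^ d ≤ S.card →
    ∃ c : CT, c.good ∧ c.full d ∧ c.pts ⊆ S
  | 0, S, hS, hc => by
    obtain ⟨x, hx⟩ := Finset.card_pos.1 (by simpa using hc : 0 < S.card)
    exact ⟨CT.pt x, trivial, trivial, by rintro y rfl; exact hx⟩
  | d + 1, S, hS, hc => by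
    obtain ⟨T, h1, h2, h3, h4⟩ := three_cells S hS (21 ^ d) (Nat.one_le_pow _ _ (by norm_num)) (by rw [pow_succ] at hc; omega)
    have := fun i => exists_CT d (T i) (gp_mono hS (Finset.coe_subset.2 (h1 i))) (h2 i)
    choose c hc1 hc2 hc3 using this
    refine ⟨CT.br c, ⟨hc1, fun i j hij => (h3 i j hij).mono (hc3 i) (hc3 j), fun a b hab => ?_⟩, hc2, ?_⟩
    · obtain ⟨i, hi⟩ := h4 a b hab
      exact ⟨i, hi.mono (hc3 i)⟩
    · exact Set.iUnion_subset fun i => (hc3 i).trans (Finset.coe_subset.2 (h1 i))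

end PCR

set_option linter.all false
open scoped BigOperators

namespace PCR

theorem col_of_ori {p q r : ℝ × ℝ} (h : ori p q r = 0) : Collinear ℝ ({p, q, r} : Set (ℝ × ℝ)) := by
  by_cases hpq : p = q
  · subst hpq; simpa using collinear_pair ℝ p r
  rw [collinear_iff_of_mem (p₀ := p) (by simp)]
  refine ⟨q - p, fun y hy => ?_⟩
  simp only [ori] at h
  rcases hy with rfl | rfl | rfl
  · exact ⟨0, by simp⟩
  · exact ⟨1, by simp⟩
  · by_cases h1 : q.1 - p.1 = 0
    · have h2 : q.2 - p.2 ≠ 0 := fun h2 => hpq (by ext <;> linarith)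
      rw [h1] at h
      have h3 : y.1 - p.1 = 0 := (mul_eq_zero.1 (by linarith : (q.2 - p.2) * (y.1 - p.1) = 0)).resolve_left h2
      refine ⟨(y.2 - p.2) / (q.2 - p.2), ?_⟩
      ext
      · simp only [vadd_eq_add, Prod.fst_add, Prod.smul_fst, Prod.fst_sub, smul_eq_mul, h1]; linarith
      · simp only [vadd_eq_add, Prod.snd_add, Prod.smul_snd, Prod.snd_sub, smul_eq_mul]; field_simp; ring
    · refine ⟨(y.1 - p.1) / (q.1 - p.1), ?_⟩
      ext
      · simp only [vadd_eq_add, Prod.fst_add, Prod.smul_fst, Prod.fst_sub, smul_eq_mul]; field_simp; ring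
      · simp only [vadd_eq_add, Prod.snd_add, Prod.smul_snd, Prod.snd_sub, smul_eq_mul]; field_simp; linarith

theorem gp_ori {S : Set (ℝ × ℝ)} (h : InGeneralPosition S) {p q r : ℝ × ℝ} (hp : p ∈ S) (hq : q ∈ S) (hr : r ∈ S)
    (hpq : p ≠ q) (hpr : p ≠ r) (hqr : q ≠ r) : ori p q r ≠ 0 := fun h0 => h p hp q hq r hr hpq hpr hqr (col_of_ori h0)

theorem par {a b c d e f : ℝ} (h1 : a * f = b * e) (h2 : c * f = d * e) (h : ¬ (e = 0 ∧ f = 0)) : a * d = b * c := by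
  by_cases he : e = 0
  · have hf : f ≠ 0 := fun hf => h ⟨he, hf⟩
    subst he
    have ha : a = 0 := by simpa [hf] using h1
    have hc : c = 0 := by simpa [hf] using h2
    rw [ha, hc]; ring
  · apply mul_left_cancel₀ he
    linear_combination c * h1 - a * h2

theorem line_uniq {c d e f p p' : ℝ × ℝ} (hef : e ≠ f) (hcde : ori c d e ≠ 0) (h1 : ori c d p = 0) (h2 : ori c d p' = 0)
    (h3 : ori e f p = 0) (h4 : ori e f p' = 0) : p = p' := by
  by_contra hne
  simp only [ori] at *
  have k1 : (d.1 - c.1) * (p.2 - p'.2) = (d.2 - c.2) * (p.1 - p'.1) := by linarith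
  have k2 : (f.1 - e.1) * (p.2 - p'.2) = (f.2 - e.2) * (p.1 - p'.1) := by linarith
  have k3 := par k1 k2 (fun h => hne (by ext <;> linarith [h.1, h.2]))
  have k4 : (p.1 - e.1) * (f.2 - e.2) = (p.2 - e.2) * (f.1 - e.1) := by linarith
  have k5 := par k3 k4 (fun h => hef (by ext <;> linarith [h.1, h.2]))
  apply hcde
  linarith

def Q (a b c d e f : ℝ × ℝ) : Prop := [a, b, c, d, e, f].Nodup ∧ ∃ p, ori a b p = 0 ∧ ori c d p = 0 ∧ ori e f p = 0

def NoQ (S : Finset (ℝ × ℝ)) : Prop := ∀ a ∈ S, ∀ b ∈ S, ∀ c ∈ S, ∀ d ∈ S, ∀ e ∈ S, ∀ f ∈ S, ¬ Q a b c d e f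

theorem Q_inj {S : Set (ℝ × ℝ)} (hS : InGeneralPosition S) {x x' b c d e f : ℝ × ℝ} (hx : x ∈ S) (hx' : x' ∈ S) (hb : b ∈ S) (hc : c ∈ S)
    (hd : d ∈ S) (he : e ∈ S) (h : Q x b c d e f) (h' : Q x' b c d e f) : x = x' := by
  obtain ⟨hn, p, h1, h2, h3⟩ := h
  obtain ⟨hn', p', h1', h2', h3'⟩ := h'
  simp only [List.nodup_cons, List.mem_cons, List.not_mem_nil, not_or, or_false] at hn hn'
  obtain ⟨⟨xb, xc, xd, xe, xf⟩, ⟨bc, bd, be, bf⟩, ⟨cd, ce, cf⟩, ⟨de, df⟩, ef, -⟩ := hn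
  obtain ⟨⟨xb', -⟩, -⟩ := hn'
  have hp := line_uniq ef (gp_ori hS hc hd he cd ce de) h2 h2' h3 h3'
  subst hp
  by_contra hne
  have hpb : p ≠ b := by rintro rfl; exact gp_ori hS hc hd hb cd (Ne.symm bc) (Ne.symm bd) h2
  apply gp_ori hS hb hx hx' (Ne.symm xb) (Ne.symm xb') hne
  simp only [ori] at *
  have := par (a := x.1 - b.1) (b := x.2 - b.2) (c := x'.1 - b.1) (d := x'.2 - b.2) (e := p.1 - b.1) (f := p.2 - b.2) (by linarith) (by linarith)
    (fun h => hpb (by ext <;> linarith [h.1, h.2]))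
  linarith

theorem exists_NoQ (S : Finset (ℝ × ℝ)) (hS : InGeneralPosition (S : Set (ℝ × ℝ))) :
    ∃ T ⊆ S, NoQ T ∧ S.card ≤ T.card + T.card ^ 5 := by
  classical
  obtain ⟨T, hT, hmax⟩ := Finset.exists_max_image (S.powerset.filter NoQ) Finset.card
    ⟨∅, by simp [NoQ]⟩
  rw [Finset.mem_filter, Finset.mem_powerset] at hT
  refine ⟨T, hT.1, hT.2, ?_⟩
  have key : ∀ x ∈ S \ T, ∃ y ∈ T ×ˢ T ×ˢ T ×ˢ T ×ˢ T, Q x y.1 y.2.1 y.2.2.1 y.2.2.2.1 y.2.2.2.2 := by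
    intro x hx
    rw [Finset.mem_sdiff] at hx
    by_contra hno
    push Not at hno
    have hno' : ∀ b ∈ T, ∀ c ∈ T, ∀ d ∈ T, ∀ e ∈ T, ∀ f ∈ T, ¬ Q x b c d e f := by
      intro b hb c hc d hd e he f hf
      exact hno (b, c, d, e, f) (by simp [hb, hc, hd, he, hf])
    have hcard := hmax (insert x T) (by
      rw [Finset.mem_filter, Finset.mem_powerset]
      refine ⟨Finset.insert_subset hx.1 hT.1, ?_⟩
      intro a ha b hb c hc d hd e he f hf hQ
      have hQ0 := hQ
      obtain ⟨hn, p, h1, h2, h3⟩ := hQ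
      have h1' : ori b a p = 0 := by rw [ori]; simp only [ori] at h1; linarith
      have h2' : ori d c p = 0 := by rw [ori]; simp only [ori] at h2; linarith
      have h3' : ori f e p = 0 := by rw [ori]; simp only [ori] at h3; linarith
      simp only [List.nodup_cons, List.mem_cons, List.not_mem_nil, not_or, or_false] at hn
      obtain ⟨⟨ab, ac, ad, ae, af⟩, ⟨bc, bd, be, bf⟩, ⟨cd, ce, cf⟩, ⟨de, df⟩, ef, -⟩ := hn
      have mk : ∀ y, y ∈ insert x T → y ≠ x → y ∈ T := fun y hy hyx => (Finset.mem_insert.1 hy).resolve_left hyx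
      have nd : ∀ b c d e f, b ≠ x → c ≠ x → d ≠ x → e ≠ x → f ≠ x → b ∈ insert x T → c ∈ insert x T → d ∈ insert x T → e ∈ insert x T →
          f ∈ insert x T → ¬ Q x b c d e f := fun b c d e f b1 c1 d1 e1 f1 b2 c2 d2 e2 f2 =>
        hno' b (mk b b2 b1) c (mk c c2 c1) d (mk d d2 d1) e (mk e e2 e1) f (mk f f2 f1)
      by_cases xa : a = x
      · subst xa; exact nd b c d e f (Ne.symm ab) (Ne.symm ac) (Ne.symm ad) (Ne.symm ae) (Ne.symm af) hb hc hd he hf hQ0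
      by_cases xb : b = x
      · subst xb
        exact nd a c d e f xa (Ne.symm bc) (Ne.symm bd) (Ne.symm be) (Ne.symm bf) ha hc hd he hf ⟨by simp; grind, p, h1', h2, h3⟩
      by_cases xc : c = x
      · subst xc
        exact nd d a b e f (Ne.symm cd) xa xb (Ne.symm ce) (Ne.symm cf) hd ha hb he hf ⟨by simp; grind, p, h2, h1, h3⟩
      by_cases xd : d = x
      · subst xd
        exact nd c a b e f xc xa xb (Ne.symm de) (Ne.symm df) hc ha hb he hf ⟨by simp; grind, p, h2', h1, h3⟩
      by_cases xe : e = x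
      · subst xe
        exact nd f a b c d (Ne.symm ef) xa xb xc xd hf ha hb hc hd ⟨by simp; grind, p, h3, h1, h2⟩
      by_cases xf : f = x
      · subst xf
        exact nd e a b c d xe xa xb xc xd he ha hb hc hd ⟨by simp; grind, p, h3', h1, h2⟩
      exact hT.2 a (mk a ha xa) b (mk b hb xb) c (mk c hc xc) d (mk d hd xd) e (mk e he xe) f (mk f hf xf) hQ0)
    rw [Finset.card_insert_of_notMem hx.2] at hcard
    omega
  choose! y hy hQ using key
  have hle : (S \ T).card ≤ (T ×ˢ T ×ˢ T ×ˢ T ×ˢ T).card := by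
    refine Finset.card_le_card_of_injOn y hy ?_
    intro x hx x' hx' hxx
    have hx1 := hQ x hx
    have hx2 := hQ x' hx'
    rw [← hxx] at hx2
    have hm := hy x hx
    simp only [Finset.mem_product] at hm
    exact Q_inj hS (Finset.mem_sdiff.1 hx).1 (Finset.mem_sdiff.1 hx').1 (hT.1 hm.1) (hT.1 hm.2.1) (hT.1 hm.2.2.1) (hT.1 hm.2.2.2.1) hx1 hx2
  have h5 : (T ×ˢ T ×ˢ T ×ˢ T ×ˢ T).card = T.card ^ 5 := by simp only [Finset.card_product]; ring
  have := Finset.card_sdiff_add_card_eq_card hT.1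
  omega

end PCR

set_option linter.all false
open scoped BigOperators

namespace PCR
section
variable {V : Type} {G : SimpleGraph V}

noncomputable def eu (e : G.edgeSet) : V := (Quot.out (e : Sym2 V)).1
noncomputable def ev (e : G.edgeSet) : V := (Quot.out (e : Sym2 V)).2

theorem euv (e : G.edgeSet) : (e : Sym2 V) = s(eu e, ev e) := (Quot.out_eq (e : Sym2 V)).symm

theorem eu_ne (e : G.edgeSet) : eu e ≠ ev e := by
  have h := e.2
  rw [euv e, SimpleGraph.mem_edgeSet] at h
  exact h.ne

theorem mem_e {e : G.edgeSet} {w : V} : w ∈ (e : Sym2 V) ↔ w = eu e ∨ w = ev e := by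
  conv_lhs => rw [euv e]
  exact Sym2.mem_iff

theorem edge_ne {e f : G.edgeSet} (h : e ≠ f) : eu f ∉ (e : Sym2 V) ∨ ev f ∉ (e : Sym2 V) := by
  by_contra hc
  push Not at hc
  apply h
  apply Subtype.ext
  rw [euv f]
  exact ((Sym2.mem_and_mem_iff (eu_ne f)).1 hc)

noncomputable def scurve (pos : V → ℝ × ℝ) (e : G.edgeSet) (t : ℝ) : ℝ × ℝ := pos (eu e) + t • (pos (ev e) - pos (eu e))

variable {pos : V → ℝ × ℝ}

theorem scurve_ori (e : G.edgeSet) (t : ℝ) : ori (pos (eu e)) (pos (ev e)) (scurve pos e t) = 0 := by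
  simp only [ori, scurve, Prod.fst_add, Prod.snd_add, Prod.smul_fst, Prod.smul_snd, Prod.fst_sub, Prod.snd_sub, smul_eq_mul]; ring

theorem scurve_inj (hpos : Function.Injective pos) (e : G.edgeSet) {s t : ℝ} (h : scurve pos e s = scurve pos e t) : s = t := by
  unfold scurve at h
  have h1 := add_left_cancel h
  have h2 : pos (ev e) - pos (eu e) ≠ 0 := sub_ne_zero.2 fun h => eu_ne e (hpos h).symm
  exact smul_left_injective ℝ h2 h1

theorem scurve_zero (e : G.edgeSet) : scurve pos e 0 = pos (eu e) := by simp [scurve]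
theorem scurve_one (e : G.edgeSet) : scurve pos e 1 = pos (ev e) := by simp [scurve]

variable {T : Finset (ℝ × ℝ)}

theorem mem_ori {e : G.edgeSet} {w : V} (hw : w ∈ (e : Sym2 V)) : ori (pos (eu e)) (pos (ev e)) (pos w) = 0 := by
  rcases mem_e.1 hw with rfl | rfl <;> simp only [ori] <;> ring

theorem notmem_ori (hpos : Function.Injective pos) (hT : ∀ v, pos v ∈ T) (hgp : InGeneralPosition (T : Set (ℝ × ℝ))) {e : G.edgeSet} {w : V}
    (hw : w ∉ (e : Sym2 V)) : ori (pos (eu e)) (pos (ev e)) (pos w) ≠ 0 := by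
  rw [mem_e, not_or] at hw
  exact gp_ori hgp (hT _) (hT _) (hT _) (fun h => eu_ne e (hpos h)) (fun h => hw.1 (hpos h).symm) (fun h => hw.2 (hpos h).symm)

theorem suniq (hpos : Function.Injective pos) (hT : ∀ v, pos v ∈ T) (hgp : InGeneralPosition (T : Set (ℝ × ℝ))) {e f : G.edgeSet} (hef : e ≠ f)
    {p p' : ℝ × ℝ} (h1 : ori (pos (eu e)) (pos (ev e)) p = 0) (h2 : ori (pos (eu e)) (pos (ev e)) p' = 0)
    (h3 : ori (pos (eu f)) (pos (ev f)) p = 0) (h4 : ori (pos (eu f)) (pos (ev f)) p' = 0) : p = p' := by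
  rcases edge_ne hef with h | h
  · exact line_uniq (fun h => eu_ne f (hpos h)) (notmem_ori hpos hT hgp h) h1 h2 h3 h4
  · have sw : ∀ a b c : ℝ × ℝ, ori a b c = 0 → ori b a c = 0 := fun a b c h => by simp only [ori] at *; linarith
    exact line_uniq (fun h => eu_ne f (hpos h).symm) (notmem_ori hpos hT hgp h) h1 h2 (sw _ _ _ h3) (sw _ _ _ h4)

theorem savoid (hpos : Function.Injective pos) (hT : ∀ v, pos v ∈ T) (hgp : InGeneralPosition (T : Set (ℝ × ℝ))) {e : G.edgeSet} {w : V} {t : ℝ}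
    (ht : t ∈ Set.Ioo (0:ℝ) 1) : scurve pos e t ≠ pos w := by
  intro h
  by_cases hw : w ∈ (e : Sym2 V)
  · rcases mem_e.1 hw with rfl | rfl
    · rw [← scurve_zero (pos := pos) e] at h
      have := scurve_inj hpos e h
      linarith [ht.1]
    · rw [← scurve_one (pos := pos) e] at h
      have := scurve_inj hpos e h
      linarith [ht.2]
  · exact notmem_ori hpos hT hgp hw (h ▸ scurve_ori e t)

theorem sdisj (hpos : Function.Injective pos) (hT : ∀ v, pos v ∈ T) (hgp : InGeneralPosition (T : Set (ℝ × ℝ))) {e f : G.edgeSet} (hef : e ≠ f)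
    {p : ℝ × ℝ} (he : p ∈ scurve pos e '' Set.Ioo 0 1) (hf : p ∈ scurve pos f '' Set.Ioo 0 1) {w : V} (hw : w ∈ (e : Sym2 V))
    (hw' : w ∈ (f : Sym2 V)) : False := by
  obtain ⟨t, ht, rfl⟩ := he
  obtain ⟨s, hs, hst⟩ := hf
  exact savoid hpos hT hgp ht (suniq hpos hT hgp hef (scurve_ori e t) (mem_ori hw) (hst ▸ scurve_ori f s) (mem_ori hw'))

noncomputable def sdraw (hpos : Function.Injective pos) (hT : ∀ v, pos v ∈ T) (hgp : InGeneralPosition (T : Set (ℝ × ℝ))) (hQ : NoQ T) :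
    Drawing G where
  pos := pos
  pos_inj := hpos
  curve := scurve pos
  curve_cont e := by unfold scurve; fun_prop
  curve_inj e := fun s _ t _ h => scurve_inj hpos e h
  curve_ends e := ⟨eu e, ev e, euv e, scurve_zero e, scurve_one e⟩
  curve_avoid e t ht := by rintro ⟨w, hw⟩; exact savoid hpos hT hgp ht hw.symm
  curve_finite_inter e f hef := by
    refine Set.Subsingleton.finite ?_
    rintro p ⟨⟨s, _, hs⟩, ⟨t, _, ht⟩⟩ p' ⟨⟨s', _, hs'⟩, ⟨t', _, ht'⟩⟩
    exact suniq hpos hT hgp hef (hs ▸ scurve_ori e s) (hs' ▸ scurve_ori e s') (ht ▸ scurve_ori f t) (ht' ▸ scurve_ori f t')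
  no_triple_point e f g hef hfg heg p := by
    rintro ⟨h1, h2, h3⟩
    have k : ∀ {e f : G.edgeSet} (hef : e ≠ f) (h1 : p ∈ scurve pos e '' Set.Ioo 0 1) (h2 : p ∈ scurve pos f '' Set.Ioo 0 1) {w w' : V},
        w ∈ (e : Sym2 V) → w' ∈ (f : Sym2 V) → pos w ≠ pos w' := by
      intro e f hef h1 h2 w w' hw hw' h
      exact sdisj hpos hT hgp hef h1 h2 hw (hpos h ▸ hw')
    have hu : ∀ e : G.edgeSet, eu e ∈ (e : Sym2 V) := fun e => mem_e.2 (Or.inl rfl)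
    have hv : ∀ e : G.edgeSet, ev e ∈ (e : Sym2 V) := fun e => mem_e.2 (Or.inr rfl)
    have hn : ∀ e : G.edgeSet, pos (eu e) ≠ pos (ev e) := fun e h => eu_ne e (hpos h)
    refine hQ (pos (eu e)) (hT _) (pos (ev e)) (hT _) (pos (eu f)) (hT _) (pos (ev f)) (hT _) (pos (eu g)) (hT _) (pos (ev g)) (hT _)
      ⟨?_, p, ?_, ?_, ?_⟩
    · simp only [List.nodup_cons, List.mem_cons, List.not_mem_nil, not_or, or_false, not_false_eq_true, List.nodup_nil, and_true]
      exact ⟨⟨hn e, k hef h1 h2 (hu e) (hu f), k hef h1 h2 (hu e) (hv f), k heg h1 h3 (hu e) (hu g), k heg h1 h3 (hu e) (hv g)⟩,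
        ⟨k hef h1 h2 (hv e) (hu f), k hef h1 h2 (hv e) (hv f), k heg h1 h3 (hv e) (hu g), k heg h1 h3 (hv e) (hv g)⟩,
        ⟨hn f, k hfg h2 h3 (hu f) (hu g), k hfg h2 h3 (hu f) (hv g)⟩, ⟨k hfg h2 h3 (hv f) (hu g), k hfg h2 h3 (hv f) (hv g)⟩, hn g⟩
    · obtain ⟨t, _, rfl⟩ := h1; exact scurve_ori e t
    · obtain ⟨t, _, rfl⟩ := h2; exact scurve_ori f t
    · obtain ⟨t, _, rfl⟩ := h3; exact scurve_ori g t

theorem straight [Fintype G.edgeSet] (hpos : Function.Injective pos) (hT : ∀ v, pos v ∈ T) (hgp : InGeneralPosition (T : Set (ℝ × ℝ))) (hQ : NoQ T) :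
    ∃ D : Drawing G, D.pos = pos ∧ D.IsStraightLine ∧
      (D.numCrossings : ℝ) ≤ ∑ e, ∑ e', mt (fun (e : G.edgeSet) v => v ∈ (e : Sym2 V)) pos e e' := by
  classical
  refine ⟨sdraw hpos hT hgp hQ, rfl, ?_, ?_⟩
  · intro e t _
    show scurve pos e t = scurve pos e 0 + t • (scurve pos e 1 - scurve pos e 0)
    rw [scurve_zero, scurve_one]; rfl
  · set D := sdraw (G := G) hpos hT hgp hQ
    have hH : ∀ (e : G.edgeSet) (p : ℝ × ℝ), p ∈ scurve pos e '' Set.Ioo 0 1 → p ∈ convexHull ℝ (pos '' {v | v ∈ (e : Sym2 V)}) := by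
      rintro e p ⟨t, ht, rfl⟩
      have h1 : pos (eu e) ∈ convexHull ℝ (pos '' {v | v ∈ (e : Sym2 V)}) := subset_convexHull ℝ _ ⟨_, mem_e.2 (Or.inl rfl), rfl⟩
      have h2 : pos (ev e) ∈ convexHull ℝ (pos '' {v | v ∈ (e : Sym2 V)}) := subset_convexHull ℝ _ ⟨_, mem_e.2 (Or.inr rfl), rfl⟩
      have := convex_convexHull ℝ _ h1 h2 (sub_nonneg.2 ht.2.le) ht.1.le (by ring : (1 - t) + t = 1)
      convert this using 1
      unfold scurve
      rw [smul_sub, sub_smul, one_smul]; abel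
    set F : Finset (G.edgeSet × G.edgeSet) := Finset.univ.filter fun x =>
      (convexHull ℝ (pos '' {v | v ∈ (x.1 : Sym2 V)}) ∩ convexHull ℝ (pos '' {v | v ∈ (x.2 : Sym2 V)})).Nonempty with hF
    have hsum : (F.card : ℝ) = ∑ e, ∑ e', mt (fun (e : G.edgeSet) v => v ∈ (e : Sym2 V)) pos e e' := by
      rw [hF, Finset.card_filter, ← Finset.univ_product_univ, Finset.sum_product]
      push_cast
      refine Finset.sum_congr rfl fun e _ => Finset.sum_congr rfl fun e' _ => ?_
      unfold mt
      split_ifs <;> rfl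
    rw [← hsum]
    have hout : ∀ x ∈ D.crossings, (Quot.out x.1).1 ≠ (Quot.out x.1).2 ∧ D.IsCross (Quot.out x.1).1 (Quot.out x.1).2 x.2 := by
      rintro x ⟨e, f, hef, hx, hc⟩
      have h : s((Quot.out x.1).1, (Quot.out x.1).2) = s(e, f) := (Quot.out_eq x.1).trans hx
      rcases Sym2.eq_iff.1 h with ⟨h1, h2⟩ | ⟨h1, h2⟩
      · rw [h1, h2]; exact ⟨hef, hc⟩
      · rw [h1, h2]; exact ⟨hef.symm, hc.2, hc.1⟩
    have hle : D.crossings.ncard ≤ (F : Set (G.edgeSet × G.edgeSet)).ncard := by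
      refine Set.ncard_le_ncard_of_injOn (fun x => Quot.out x.1) ?_ ?_ (Finset.finite_toSet F)
      · intro x hx
        obtain ⟨_, h1, h2⟩ := hout x hx
        exact Finset.mem_coe.2 (Finset.mem_filter.2 ⟨Finset.mem_univ _, ⟨x.2, hH _ _ h1, hH _ _ h2⟩⟩)
      · intro x hx y hy hxy
        obtain ⟨hne, h1, h2⟩ := hout x hx
        obtain ⟨_, h1', h2'⟩ := hout y hy
        beta_reduce at hxy
        rw [← hxy] at h1' h2'
        have e1 : x.1 = y.1 := by rw [← Quot.out_eq x.1, hxy, Quot.out_eq]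
        obtain ⟨a1, _, b1⟩ := h1
        obtain ⟨a2, _, b2⟩ := h2
        obtain ⟨a3, _, b3⟩ := h1'
        obtain ⟨a4, _, b4⟩ := h2'
        exact Prod.ext e1 (suniq hpos hT hgp hne (b1 ▸ scurve_ori _ a1) (b3 ▸ scurve_ori _ a3) (b2 ▸ scurve_ori _ a2) (b4 ▸ scurve_ori _ a4))
    rw [Set.ncard_coe_finset] at hle
    exact_mod_cast hle

end
end PCR

set_option linter.all false
open scoped BigOperators

namespace PCR
section
variable {V : Type} [Fintype V] [DecidableEq V] {G : SimpleGraph V} [Fintype G.edgeSet]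

open Classical in
theorem deg_le (inc : G.edgeSet → V → Prop) (hinc : ∀ e v, inc e v ↔ v ∈ (e : Sym2 V)) (v : V) :
    (Finset.univ.filter fun e => inc e v).card = (G.neighborSet v).ncard := by
  have h1 : (G.incidenceSet v).ncard = (G.neighborSet v).ncard := Nat.card_congr (G.incidenceSetEquivNeighborSet v)
  rw [← h1, ← Set.ncard_coe_finset, ← Set.ncard_image_of_injective _ Subtype.val_injective]
  congr 1
  ext e
  constructor
  · rintro ⟨e, he, rfl⟩
    exact ⟨e.2, (hinc e v).1 (Finset.mem_filter.1 (Finset.mem_coe.1 he)).2⟩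
  · rintro ⟨h1, h2⟩
    exact ⟨⟨e, h1⟩, Finset.mem_coe.2 (Finset.mem_filter.2 ⟨Finset.mem_univ _, (hinc _ v).2 h2⟩), rfl⟩

open Classical in
theorem touch_sum (D : Drawing G) (inc : G.edgeSet → V → Prop) (hinc : ∀ e v, inc e v ↔ v ∈ (e : Sym2 V)) :
    ∑ e, (Finset.univ.filter fun f => (drawHost D).Tch e f).card ≤ 2 * D.numCrossingPairs + ssqd G := by
  set F : Finset (G.edgeSet × G.edgeSet) := Finset.univ.filter fun x => x.1 ≠ x.2 ∧ ∃ p, D.IsCross x.1 x.2 p with hF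
  set E : V → Finset G.edgeSet := fun v => Finset.univ.filter fun e => inc e v with hE
  have h1 : ∑ e, (Finset.univ.filter fun f => (drawHost D).Tch e f).card ≤ (F ∪ Finset.univ.biUnion fun v => E v ×ˢ E v).card := by
    have : ∑ e, (Finset.univ.filter fun f => (drawHost D).Tch e f).card =
        (Finset.univ.filter fun x : G.edgeSet × G.edgeSet => (drawHost D).Tch x.1 x.2).card := by
      simp only [Finset.card_filter]
      rw [← Finset.univ_product_univ, Finset.sum_product]
    rw [this]
    refine Finset.card_le_card fun x hx => ?_
    have hx := (Finset.mem_filter.1 hx).2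
    have hv : (∃ v, v ∈ (x.1 : Sym2 V) ∧ v ∈ (x.2 : Sym2 V)) → x ∈ F ∪ Finset.univ.biUnion fun v => E v ×ˢ E v := by
      rintro ⟨v, h1, h2⟩
      refine Finset.mem_union_right _ (Finset.mem_biUnion.2 ⟨v, Finset.mem_univ _, Finset.mem_product.2 ⟨?_, ?_⟩⟩)
      · exact Finset.mem_filter.2 ⟨Finset.mem_univ _, (hinc _ _).2 h1⟩
      · exact Finset.mem_filter.2 ⟨Finset.mem_univ _, (hinc _ _).2 h2⟩
    by_cases hxx : x.1 = x.2
    · exact hv ⟨eu x.1, mem_e.2 (Or.inl rfl), hxx ▸ mem_e.2 (Or.inl rfl)⟩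
    rcases touch_cases D x.1 x.2 hx with h | h
    · exact Finset.mem_union_left _ (Finset.mem_filter.2 ⟨Finset.mem_univ _, hxx, h⟩)
    · exact hv h
  have h2 : F.card ≤ 2 * D.numCrossingPairs := by
    have a1 : F.card ≤ 2 * (F.image fun x => s(x.1, x.2)).card := by
      refine Finset.card_le_mul_card_image F 2 fun b _ => ?_
      induction b using Sym2.ind with
      | _ a b =>
        calc _ ≤ ({(a, b), (b, a)} : Finset (G.edgeSet × G.edgeSet)).card := by
              refine Finset.card_le_card fun x hx => ?_
              have := (Finset.mem_filter.1 hx).2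
              rcases Sym2.eq_iff.1 this with ⟨h1, h2⟩ | ⟨h1, h2⟩
              · simp [← h1, ← h2]
              · simp [← h1, ← h2]
          _ ≤ 2 := Finset.card_le_two
    refine a1.trans (Nat.mul_le_mul_left 2 ?_)
    rw [Drawing.numCrossingPairs, ← Set.ncard_coe_finset]
    refine Set.ncard_le_ncard ?_ (Set.toFinite _)
    intro q hq
    obtain ⟨x, hx, rfl⟩ := Finset.mem_image.1 (Finset.mem_coe.1 hq)
    obtain ⟨h1, h2⟩ := (Finset.mem_filter.1 hx).2
    exact ⟨x.1, x.2, h1, rfl, h2⟩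
  have h3 : (Finset.univ.biUnion fun v => E v ×ˢ E v).card ≤ ssqd G := by
    refine Finset.card_biUnion_le.trans ?_
    rw [ssqd, finsum_eq_sum_of_fintype]
    refine le_of_eq (Finset.sum_congr rfl fun v _ => ?_)
    rw [Finset.card_product, hE]
    beta_reduce
    rw [deg_le inc hinc v, sq]
  exact h1.trans ((Finset.card_union_le _ _).trans (add_le_add h2 h3))

open Classical in
theorem core [Nonempty V] (D0 : Drawing G) (inc : G.edgeSet → V → Prop) (hinc : ∀ e v, inc e v ↔ v ∈ (e : Sym2 V)) :
    ∃ (p : V → ℝ) (t : Tr V), t.verts = Finset.univ ∧ t.Good inc p (2 * 10 ^ 6) ∧ (∀ v, 1 / (Fintype.card V : ℝ) ≤ p v) ∧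
      PP p t ≤ 2 * (2 * D0.numCrossingPairs + ssqd G : ℝ) + 1 ∧ PP p t ≤ 2 * (Fintype.card G.edgeSet : ℝ) ^ 2 + 1 := by
  set H := drawHost D0
  set dd : G.edgeSet → ℝ := fun e => ((Finset.univ.filter fun f => H.Tch e f).card : ℝ) with hdd
  set p : V → ℝ := fun v => ∑ e, (if inc e v then dd e else 0) + 1 / (Fintype.card V : ℝ) with hp
  have hn : (0 : ℝ) < Fintype.card V := by exact_mod_cast Fintype.card_pos
  have hdd0 : ∀ e, 0 ≤ dd e := fun e => Nat.cast_nonneg _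
  have hs0 : ∀ v, 0 ≤ ∑ e, (if inc e v then dd e else 0) := fun v => Finset.sum_nonneg fun e _ => by split_ifs; exacts [hdd0 e, le_rfl]
  have hm : ∀ v, 1 / (Fintype.card V : ℝ) ≤ p v := fun v => by simp only [hp]; linarith [hs0 v]
  have hreg : ∀ e v, inc e v → vpt D0 v ∈ H.reg e := fun e v h => vpt_mem D0 v e ((hinc e v).1 h)
  have hinj : Function.Injective (vpt D0) := fun u v h => D0.pos_inj (congrArg Subtype.val h)
  have hiu : ∀ e, inc e (eu e) := fun e => (hinc _ _).2 (mem_e.2 (Or.inl rfl))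
  have hD1 : ∀ e, 1 ≤ dd e := by
    intro e
    have : 0 < (Finset.univ.filter fun f => H.Tch e f).card :=
      Finset.card_pos.2 ⟨e, Finset.mem_filter.2 ⟨Finset.mem_univ _, ⟨vpt D0 (eu e), hreg _ _ (hiu e), hreg _ _ (hiu e)⟩⟩⟩
    have h1 : 1 ≤ (Finset.univ.filter fun f => H.Tch e f).card := this
    simp only [hdd]
    exact_mod_cast h1
  have hpD : ∀ W : Finset V, ∑ e ∈ Host.ins inc W, dd e ≤ ∑ v ∈ W, p v := by
    intro W
    have hq : (0 : ℝ) ≤ 1 / (Fintype.card V : ℝ) := by positivity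
    calc _ ≤ ∑ e ∈ Host.ins inc W, ∑ v ∈ W, (if inc e v then dd e else 0) := by
          refine Finset.sum_le_sum fun e he => ?_
          have := Finset.single_le_sum (f := fun v => if inc e v then dd e else 0) (fun v _ => by beta_reduce; split_ifs; exacts [hdd0 e, le_rfl])
            (Host.mem_ins.1 he _ (hiu e))
          beta_reduce at this
          rwa [if_pos (hiu e)] at this
      _ ≤ ∑ e, ∑ v ∈ W, (if inc e v then dd e else 0) := by
          refine Finset.sum_le_sum_of_subset_of_nonneg (Finset.subset_univ _) fun e _ _ => Finset.sum_nonneg fun v _ => ?_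
          split_ifs; exacts [hdd0 e, le_rfl]
      _ = ∑ v ∈ W, ∑ e, (if inc e v then dd e else 0) := Finset.sum_comm
      _ ≤ _ := Finset.sum_le_sum fun v _ => by simp only [hp]; linarith
  have hdeg : ∀ v, ((Finset.univ.filter fun e => inc e v).card : ℝ) ^ 2 ≤ p v := by
    intro v
    have : ((Finset.univ.filter fun e => inc e v).card : ℝ) ^ 2 ≤ ∑ e, (if inc e v then dd e else 0) := by
      rw [← Finset.sum_filter, sq, ← nsmul_eq_mul]
      refine Finset.card_nsmul_le_sum _ _ _ fun e he => ?_
      simp only [hdd]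
      refine Nat.cast_le.2 (Finset.card_le_card fun f hf => ?_)
      exact Finset.mem_filter.2 ⟨Finset.mem_univ _, ⟨vpt D0 v, hreg _ _ (Finset.mem_filter.1 he).2, hreg _ _ (Finset.mem_filter.1 hf).2⟩⟩
    have h0 : (0:ℝ) < 1 / (Fintype.card V : ℝ) := by positivity
    simp only [hp]; linarith
  have h2 : ∀ e u v x, inc e u → inc e v → u ≠ v → inc e x → x = u ∨ x = v := by
    intro e u v x hu hv huv hx
    rw [hinc, mem_e] at hu hv hx
    grind
  obtain ⟨t, ht, htG⟩ := Tr.exists_tree (H := H) (vpt D0) hinj inc hreg h2 p (fun v => lt_of_lt_of_le (by positivity) (hm v)) dd hD1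
    (fun e => le_rfl) hpD hdeg _ Finset.univ rfl Finset.univ_nonempty
  have hP : PP p t ≤ 2 * ∑ e, dd e + 1 := by
    unfold PP
    rw [ht]
    simp only [hp]
    rw [Finset.sum_add_distrib, Finset.sum_const, Finset.card_univ, nsmul_eq_mul, mul_one_div_cancel hn.ne', Finset.sum_comm, Finset.mul_sum]
    refine add_le_add (Finset.sum_le_sum fun e _ => ?_) le_rfl
    rw [← Finset.sum_filter, Finset.sum_const, nsmul_eq_mul]
    refine mul_le_mul_of_nonneg_right ?_ (hdd0 e)
    have : (Finset.univ.filter fun v => inc e v).card ≤ 2 := by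
      calc _ ≤ ({eu e, ev e} : Finset V).card := Finset.card_le_card fun v hv => by
            have := (Finset.mem_filter.1 hv).2
            rw [hinc, mem_e] at this
            simpa using this
        _ ≤ 2 := Finset.card_le_two
    exact_mod_cast this
  refine ⟨p, t, ht, htG, hm, hP.trans ?_, hP.trans ?_⟩
  · have := touch_sum D0 inc hinc
    have : ∑ e, dd e ≤ 2 * D0.numCrossingPairs + ssqd G := by simp only [hdd]; exact_mod_cast this
    linarith
  · have : ∑ e, dd e ≤ (Fintype.card G.edgeSet : ℝ) ^ 2 := by
      rw [sq, ← nsmul_eq_mul]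
      refine Finset.sum_le_card_nsmul _ _ _ fun e _ => ?_
      simp only [hdd]
      exact Nat.cast_le.2 (Finset.card_le_univ _)
    linarith

end

theorem final : ∃ C : ℝ, 1 ≤ C ∧ ∃ c : ℝ, 0 < c ∧
      ∀ (n : ℕ) (G : SimpleGraph (Fin n)) (S : Finset (ℝ × ℝ)), 2 ≤ n →
        InGeneralPosition (S : Set (ℝ × ℝ)) → (n : ℝ) ^ C ≤ (S.card : ℝ) →
        ∃ D : Drawing G, (∀ v, D.pos v ∈ S) ∧ D.IsStraightLine ∧
          (D.numCrossings : ℝ) ≤ c * Real.log n * ((pcrNum G : ℝ) + (ssqd G : ℝ)) := by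
  refine ⟨((1016 * 5 + 1 : ℕ) : ℝ), by norm_num, 8401 * (2 * 10 ^ 6) ^ 2 * 254 * 5, by norm_num, ?_⟩
  intro n G S hn hgp hS
  classical
  rw [Real.rpow_natCast] at hS
  have hS' : n ^ (1016 * 5 + 1) ≤ S.card := by exact_mod_cast hS
  obtain ⟨T, hTS, hQ, hcard⟩ := exists_NoQ S hgp
  have hgT : InGeneralPosition (T : Set (ℝ × ℝ)) := gp_mono hgp (Finset.coe_subset.2 hTS)
  have hTc : n ^ 1016 ≤ T.card := by
    by_contra h
    push Not at h
    rw [pow_succ, pow_mul] at hS'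
    have hA : 1 ≤ n ^ 1016 := Nat.one_le_pow _ _ (by omega)
    generalize n ^ 1016 = A at *
    have h5 : T.card ^ 5 < A ^ 5 := Nat.pow_lt_pow_left h (by norm_num)
    have h6 : A ≤ A ^ 5 := Nat.le_self_pow (by norm_num) A
    have h7 : A ^ 5 * 2 ≤ A ^ 5 * n := Nat.mul_le_mul_left _ hn
    omega
  haveI : Nonempty (Fin n) := ⟨⟨0, by omega⟩⟩
  -- the optimal drawing
  obtain ⟨D0, hD0⟩ : ∃ D : Drawing G, D.numCrossingPairs = pcrNum G := by
    have hle : n ≤ T.card := (Nat.le_self_pow (by norm_num) n).trans hTc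
    obtain ⟨T', hT', hc'⟩ := Finset.exists_subset_card_eq hle
    let eqv := (T'.equivFinOfCardEq hc').symm
    obtain ⟨D, _⟩ := straight (G := G) (pos := fun v => (eqv v : ℝ × ℝ)) (T := T) (fun u v h => eqv.injective (Subtype.ext h))
      (fun v => hT' (eqv v).2) hgT hQ
    exact Nat.sInf_mem (s := {n | ∃ D : Drawing G, D.numCrossingPairs = n}) ⟨_, D, rfl⟩
  set inc : G.edgeSet → Fin n → Prop := fun e v => v ∈ (e : Sym2 (Fin n)) with hinc
  obtain ⟨p, t, ht, htG, hm, hP1, hP2⟩ := core D0 inc (fun e v => Iff.rfl)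
  rw [Fintype.card_fin] at hm
  have hn0 : (0 : ℝ) < n := by exact_mod_cast (by omega : 0 < n)
  have hn2 : (2 : ℝ) ≤ n := by exact_mod_cast hn
  have hlog : 1 / 2 ≤ Real.log n := by
    have h1 := Real.log_le_log (by norm_num) hn2
    linarith [Real.log_two_gt_d9]
  have hp0 : ∀ v, 0 ≤ p v := fun v => le_trans (by positivity) (hm v)
  have hPpos : 0 < PP p t := by
    unfold PP
    exact Finset.sum_pos (fun v _ => lt_of_lt_of_le (by positivity) (hm v)) t.verts_nonempty
  have hdep : (t.dep : ℝ) ≤ 254 * Real.log n := by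
    have h1 := Tr.dep_le (m := 1 / (n : ℝ)) (by positivity) hm t htG
    have hE : (Fintype.card G.edgeSet : ℝ) ≤ (n : ℝ) ^ 2 := by
      have : Fintype.card G.edgeSet ≤ Fintype.card (Fin n × Fin n) := by
        refine Fintype.card_le_of_injective (fun e => (eu e, ev e)) fun e f h => ?_
        apply Subtype.ext
        rw [euv e, euv f]
        rw [Prod.mk.injEq] at h
        rw [h.1, h.2]
      rw [Fintype.card_prod, Fintype.card_fin, ← sq] at this
      exact_mod_cast this
    have h2 : PP p t / (1 / (n : ℝ)) ≤ (n : ℝ) ^ 7 := by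
      rw [div_div_eq_mul_div, div_one]
      have h3 : PP p t ≤ 3 * (n : ℝ) ^ 4 := by
        have h4 : (Fintype.card G.edgeSet : ℝ) ^ 2 ≤ ((n : ℝ) ^ 2) ^ 2 := pow_le_pow_left₀ (by positivity) hE 2
        have h5 : (1 : ℝ) ≤ (n : ℝ) ^ 4 := one_le_pow₀ (by linarith)
        have h6 : ((n : ℝ) ^ 2) ^ 2 = (n : ℝ) ^ 4 := by ring
        linarith
      have h4 : (4 : ℝ) ≤ (n : ℝ) ^ 2 := by nlinarith
      calc PP p t * n ≤ 3 * (n : ℝ) ^ 4 * n := by gcongr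
        _ ≤ (n : ℝ) ^ 2 * (n : ℝ) ^ 4 * n := by gcongr; linarith
        _ = _ := by ring
    have h3 := Real.log_le_log (by positivity) h2
    rw [Real.log_pow] at h3
    change (t.dep : ℝ) ≤ 1 + 36 * Real.log (PP p t / (1 / (n : ℝ))) at h1
    push_cast at h3
    linarith
  have h21 : 21 ^ t.dep ≤ T.card := by
    refine le_trans ?_ hTc
    have e4 : (21 : ℝ) ≤ Real.exp 4 := by
      have h1 : (2.7 : ℝ) ≤ Real.exp 1 := by linarith [Real.exp_one_gt_d9]
      have h2 : Real.exp 4 = Real.exp 1 ^ 4 := by rw [← Real.exp_nat_mul]; norm_num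
      rw [h2]
      calc (21 : ℝ) ≤ 2.7 ^ 4 := by norm_num
        _ ≤ _ := pow_le_pow_left₀ (by norm_num) h1 4
    have : (21 : ℝ) ^ t.dep ≤ (n : ℝ) ^ 1016 := by
      calc (21 : ℝ) ^ t.dep ≤ Real.exp 4 ^ t.dep := pow_le_pow_left₀ (by norm_num) e4 _
        _ = Real.exp (t.dep * 4) := by rw [← Real.exp_nat_mul]
        _ ≤ Real.exp ((1016 : ℕ) * Real.log n) := Real.exp_le_exp.2 (by push_cast; linarith)
        _ = (n : ℝ) ^ 1016 := by rw [Real.exp_nat_mul, Real.exp_log hn0]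
    exact_mod_cast this
  obtain ⟨c, hcg, hcf, hcS⟩ := exists_CT t.dep T hgT h21
  have hinc2 : ∀ e, ∃ u v, u ≠ v ∧ inc e u ∧ inc e v := fun e => ⟨eu e, ev e, eu_ne e, mem_e.2 (Or.inl rfl), mem_e.2 (Or.inr rfl)⟩
  have h2 : ∀ e u v x, inc e u → inc e v → u ≠ v → inc e x → x = u ∨ x = v := by
    intro e u v x hu hv huv hx
    have hu := mem_e.1 hu
    have hv := mem_e.1 hv
    have hx := mem_e.1 hx
    grind
  obtain ⟨f, ⟨hf1, hf2⟩, hfE⟩ := EE_exists t c htG hcg hcf (fun f => TT inc t f)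
  have hET := ET (K := 2 * 10 ^ 6) (by norm_num) hp0 hinc2 h2 t c htG hcg hcf
  rw [ht] at hf1 hf2
  obtain ⟨D, hDp, hDs, hDc⟩ := straight (G := G) (pos := f) (T := T) (fun u v h => hf2 (by simp) (by simp) h)
    (fun v => hcS (hf1 v (Finset.mem_univ _))) hgT hQ
  refine ⟨D, fun v => by rw [hDp]; exact hTS (hcS (hf1 v (Finset.mem_univ _))), hDs, ?_⟩
  have hRHS : 0 ≤ 8401 * (2 * 10 ^ 6) ^ 2 * 254 * 5 * Real.log n * ((pcrNum G : ℝ) + (ssqd G : ℝ)) := by positivity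
  rcases isEmpty_or_nonempty G.edgeSet with hemp | ⟨⟨e0⟩⟩
  · refine hDc.trans (le_trans (le_of_eq ?_) hRHS)
    exact Finset.sum_eq_zero fun e _ => (hemp.false e).elim
  have hins : Host.ins inc t.verts = Finset.univ := by
    ext e
    rw [Host.mem_ins, ht]
    simp
  have hTT : ∑ e, ∑ e', mt inc f e e' = TT inc t f := by unfold TT; rw [hins]
  have hss : (1 : ℝ) ≤ ssqd G := by
    have h1 : 1 ≤ ∑ e, (Finset.univ.filter fun f => (drawHost D0).Tch e f).card := by
      refine le_trans ?_ (Finset.single_le_sum (fun e _ => Nat.zero_le _) (Finset.mem_univ e0))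
      refine Finset.card_pos.2 ⟨e0, Finset.mem_filter.2 ⟨Finset.mem_univ _, ?_⟩⟩
      exact ⟨vpt D0 (eu e0), vpt_mem D0 _ _ (mem_e.2 (Or.inl rfl)), vpt_mem D0 _ _ (mem_e.2 (Or.inl rfl))⟩
    have h2 : 1 ≤ ssqd G := by
      rw [ssqd, finsum_eq_sum_of_fintype]
      refine le_trans ?_ (Finset.single_le_sum (fun e _ => Nat.zero_le _) (Finset.mem_univ (eu e0)))
      refine Nat.one_le_pow _ _ ((Set.ncard_pos (Set.toFinite _)).2 ⟨ev e0, ?_⟩)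
      have h := e0.2
      rw [euv e0, SimpleGraph.mem_edgeSet] at h
      exact h
    exact_mod_cast h2
  rw [hD0] at hP1
  have hpc : (0:ℝ) ≤ pcrNum G := Nat.cast_nonneg _
  have hP5 : PP p t ≤ 5 * ((pcrNum G : ℝ) + ssqd G) := by linarith
  calc (D.numCrossings : ℝ) ≤ TT inc t f := by rw [← hTT]; exact hDc
    _ ≤ 8401 * (2 * 10 ^ 6) ^ 2 * t.dep * PP p t := hfE.trans hET
    _ ≤ 8401 * (2 * 10 ^ 6) ^ 2 * (254 * Real.log n) * (5 * ((pcrNum G : ℝ) + ssqd G)) := by gcongr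
    _ = _ := by ring

end PCR

/-- There are absolute constants `C ≥ 1` and `c > 0` such that for every simple graph `G` on
`n ≥ 2` vertices and every set `S` of at least `n^C` points in general position, `G` has a
straight-line drawing with vertices at points of `S` and at most
`c · log n · (pcr(G) + Σ d_k²)` crossings. -/
theorem exists_drawing_on_point_set :
    ∃ C : ℝ, 1 ≤ C ∧ ∃ c : ℝ, 0 < c ∧
      ∀ (n : ℕ) (G : SimpleGraph (Fin n)) (S : Finset (ℝ × ℝ)), 2 ≤ n →
        InGeneralPosition (S : Set (ℝ × ℝ)) → (n : ℝ) ^ C ≤ (S.card : ℝ) →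
        ∃ D : Drawing G, (∀ v, D.pos v ∈ S) ∧ D.IsStraightLine ∧
          (D.numCrossings : ℝ) ≤ c * Real.log n * ((pcrNum G : ℝ) + (ssqd G : ℝ)) := by
  exact PCR.final
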